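/- Let T be an increasing shifted tableau with no primed entries on the main diagonal. Fix z ∈ I_ℤ and suppose u ∈ ℤ⊔ℤ' has row(T)u ∈ R_inv^+(z). Then row(T)u ~ᴼ row(T ←ᴼ u). Consequently, if a ∈ R_inv^+(z) then a ~ᴼ row(P_EGᴼ(a)). -/

import Mathlib

/-! ## Primed letters: the alphabet `ℤ ⊔ ℤ'`, with `i' = i - 1/2`.
A letter is encoded by its "ceiling" together with a flag recording whether it is primed. -/

structure Letter where
  ceil : ℤ
  primed : Bool
deriving DecidableEq, Repr

instance : Inhabited Letter := ⟨⟨0, false⟩⟩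

/-- The order `⋯ < 1' < 1 < 2' < 2 < ⋯`. -/
instance : LinearOrder Letter :=
  LinearOrder.lift' (fun x : Letter => toLex (x.ceil, !x.primed))
    (fun a b h => by
      have h' : (a.ceil, !a.primed) = (b.ceil, !b.primed) := toLex.injective h
      obtain ⟨ac, ap⟩ := a
      obtain ⟨bc, bp⟩ := b
      simp only [Prod.mk.injEq] at h'
      obtain ⟨h1, h2⟩ := h'
      cases ap <;> cases bp <;> simp_all)

/-- A primed word. -/
abbrev PWord := List Letter

def Letter.unprime (x : Letter) : Letter := ⟨x.ceil, false⟩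

def Letter.succL (x : Letter) : Letter := ⟨x.ceil + 1, x.primed⟩

/-- `unprime` of a primed word: replace each letter `x` by `⌈x⌉`. -/
def unprimeWord (a : PWord) : List ℤ := a.map Letter.ceil

/-- `unprime` of a primed word, as a primed word with no primes. -/
def unprimeP (a : PWord) : PWord := a.map Letter.unprime

/-! ## Involution words -/

/-- The simple transposition `s_i = (i, i+1)` of `ℤ`. -/
def sPerm (i : ℤ) : Equiv.Perm ℤ := Equiv.swap i (i + 1)

/-- The Demazure product `s_{w_1} ∘ s_{w_2} ∘ ⋯ ∘ s_{w_k}` of a word, computed by the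
defining recursion `σ ∘ s_i = σ·s_i` if `σ(i) < σ(i+1)` and `σ ∘ s_i = σ` otherwise. -/
def heckeProd (w : List ℤ) : Equiv.Perm ℤ :=
  w.foldl (fun σ i => if σ i < σ (i + 1) then σ * sPerm i else σ) 1

/-- `s_{a_n} ∘ ⋯ ∘ s_{a_2} ∘ s_{a_1} ∘ s_{a_2} ∘ ⋯ ∘ s_{a_n}` for `a = a_1 a_2 ⋯ a_n`. -/
def invHecke (a : List ℤ) : Equiv.Perm ℤ := heckeProd (a.reverse ++ a.tail)

/-- Membership in `I_ℤ`: a finitely supported involution of `ℤ`. -/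
def IZ (z : Equiv.Perm ℤ) : Prop := {x : ℤ | z x ≠ x}.Finite ∧ z * z = 1

/-- The set of involution words of `z`. -/
def Rinv (z : Equiv.Perm ℤ) : Set (List ℤ) :=
  {a | invHecke a = z ∧ ∀ b : List ℤ, invHecke b = z → a.length ≤ b.length}

/-- 0-based index `k` is a commutation in the word `a` (this corresponds to the 1-based
index `k+1`): `a_{k+1}` and `a_{k+1} + 1` are both fixed points of
`s_{a_k} ∘ ⋯ ∘ s_{a_1} ∘ ⋯ ∘ s_{a_k}`. -/
def IsCommutation (a : List ℤ) (k : ℕ) : Prop :=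
  ∃ x, a[k]? = some x ∧ invHecke (a.take k) x = x ∧ invHecke (a.take k) (x + 1) = x + 1

/-- The set of primed involution words of `z`. -/
def RinvPlus (z : Equiv.Perm ℤ) : Set PWord :=
  {a | unprimeWord a ∈ Rinv z ∧
     ∀ (k : ℕ) (x : Letter), a[k]? = some x → x.primed = true →
       IsCommutation (unprimeWord a) k}

/-! ## Shifted tableaux.
A shifted tableau is recorded as its list of rows, from the first (bottom) row upward;
the entry at 0-based index `k` of 0-based row `r` occupies the box in row `r+1` and
column `r+1+k` of the shifted diagram. -/

abbrev STab := List (List Letter)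

/-- A strict partition, recorded as its (strictly decreasing) list of positive parts. -/
def IsStrictPartition (sh : List ℕ) : Prop :=
  List.Chain' (fun a b => b < a) sh ∧ ∀ m ∈ sh, 0 < m

def shapeOf {α : Type*} (T : List (List α)) : List ℕ := T.map List.length

/-- The rows form the shifted diagram of a strict partition. -/
def IsShifted {α : Type*} (T : List (List α)) : Prop := IsStrictPartition (shapeOf T)

/-- The entry of `T` in (0-based) row `r` and column `c` of the shifted diagram. -/
def entryG? {α : Type*} (T : List (List α)) (r c : ℕ) : Option α :=
  if r ≤ c then (T[r]?).bind (fun row => row[c - r]?) else none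

def entry? (T : STab) (r c : ℕ) : Option Letter := entryG? T r c

def setRowG {α : Type*} (T : List (List α)) (r : ℕ) (row : List α) : List (List α) :=
  if r < T.length then T.set r row else T ++ [row]

def setEntryG {α : Type*} (T : List (List α)) (r c : ℕ) (x : α) : List (List α) :=
  T.set r ((T.getD r []).set (c - r) x)

def numCols {α : Type*} (T : List (List α)) : ℕ := (T.getD 0 []).length

/-- Row reading word: rows left to right, starting with the last (top) row. -/
def rowWord (T : STab) : PWord := T.reverse.flatten

/-- Column reading word: columns top to bottom, starting with the first column. -/
def colWord (T : STab) : PWord :=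
  (List.range (numCols T)).flatMap (fun c =>
    ((List.range (c + 1)).reverse).filterMap (fun r => entry? T r c))

def unprimeT (T : STab) : STab := T.map (List.map Letter.unprime)

/-- Remove the primes from all main-diagonal entries. -/
def unprimeDiagT (T : STab) : STab :=
  T.map (fun row =>
    match row with
    | [] => []
    | x :: rest => Letter.unprime x :: rest)

/-- Rows and columns are strictly increasing. -/
def IsIncreasing (T : STab) : Prop :=
  (∀ r c x y, entry? T r c = some x → entry? T r (c + 1) = some y → x < y) ∧
  (∀ r c x y, entry? T r c = some x → entry? T (r + 1) c = some y → x < y)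

/-- No primed entries on the main diagonal. -/
def NoDiagPrimes (T : STab) : Prop :=
  ∀ r x, entry? T r r = some x → x.primed = false

/-- Entries positive, rows and columns weakly increasing, no primed entry repeated
in a row and no unprimed entry repeated in a column. -/
def IsSemistandard (T : STab) : Prop :=
  (∀ x ∈ T.flatten, 0 < x.ceil) ∧
  (∀ r c x y, entry? T r c = some x → entry? T r (c + 1) = some y → x ≤ y) ∧
  (∀ r c x y, entry? T r c = some x → entry? T (r + 1) c = some y → x ≤ y) ∧
  (∀ r c c' x, c < c' → entry? T r c = some x → entry? T r c' = some x →
    x.primed = false) ∧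
  (∀ r r' c x, r < r' → entry? T r c = some x → entry? T r' c = some x →
    x.primed = true)

/-- Increasing, with exactly one of `i` or `i'` as an entry for each `i = 1, …, n`,
where `n` is the number of boxes. -/
def IsStandard (T : STab) : Prop :=
  IsIncreasing T ∧
  ∀ i : ℤ, 1 ≤ i → i ≤ (T.flatten.length : ℤ) →
    T.flatten.countP (fun x => decide (x.ceil = i)) = 1
/-! ## Orthogonal Edelman–Greene insertion -/

/-- "Switching the primes" of a pair: reverse the primes on both letters if exactly one
of them is unprimed, and leave them unchanged otherwise. -/
def switchPrimes (x y : Letter) : Letter × Letter :=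
  if x.primed = y.primed then (x, y)
  else (⟨x.ceil, !x.primed⟩, ⟨y.ceil, !y.primed⟩)

/-- Column-insertion stage of orthogonal Edelman–Greene insertion:
insert letter `w` into column `c` of `T` (then continue into later columns). -/
def egCol : ℕ → STab → ℕ → Letter → STab × Bool
  | 0, T, _, _ => (T, true)
  | fuel + 1, T, c, w =>
    let occ := (List.range (c + 1)).filterMap (fun r => (entry? T r c).map (fun x => (r, x)))
    match occ.findIdx? (fun p => decide (w.ceil < p.2.ceil)) with
    | none =>
        -- place `w` in the first empty box of the column
        let r := occ.length
        let w' := if r = c ∧ w.primed then Letter.unprime w else w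
        (setRowG T r ((T.getD r []) ++ [w']), if r = c then w.primed else true)
    | some kM =>
        let km := (occ.findIdx? (fun p => decide (w.ceil ≤ p.2.ceil))).getD kM
        let im := (occ.getD km (0, default)).1
        let m := (occ.getD km (0, default)).2
        if km = kM then
          if im = c then
            -- m = M on the main diagonal
            egCol fuel (setEntryG T im c (Letter.unprime w)) (c + 1) ⟨m.ceil, w.primed⟩
          else
            -- m = M off the main diagonal
            egCol fuel (setEntryG T im c w) (c + 1) m
        else
          -- m < M : switch the primes on m and M, insert w+1 into the next column
          let iM := (occ.getD kM (0, default)).1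
          let M := (occ.getD kM (0, default)).2
          let p := switchPrimes m M
          egCol fuel (setEntryG (setEntryG T im c p.1) iM c p.2) (c + 1) (Letter.succL w)

/-- Row-insertion stage of orthogonal Edelman–Greene insertion:
insert letter `w` into row `r` of `T`. -/
def egRow : ℕ → STab → ℕ → Letter → STab × Bool
  | 0, T, _, _ => (T, true)
  | fuel + 1, T, r, w =>
    let row := T.getD r []
    match row.findIdx? (fun x => decide (w.ceil < x.ceil)) with
    | none =>
        if row.isEmpty ∧ w.primed then (setRowG T r [Letter.unprime w], true)
        else (setRowG T r (row ++ [w]), false)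
    | some kM =>
        let km := (row.findIdx? (fun x => decide (w.ceil ≤ x.ceil))).getD kM
        let m := row.getD km default
        if km = kM then
          if km = 0 then
            -- m = M on the main diagonal
            egCol fuel (setRowG T r (row.set 0 (Letter.unprime w))) (r + 1)
              ⟨m.ceil, w.primed⟩
          else
            -- m = M off the main diagonal
            egRow fuel (setRowG T r (row.set km w)) (r + 1) m
        else
          -- m < M : switch primes; insert w+1 into the next column (if m is on the
          -- main diagonal) or the next row (otherwise)
          let M := row.getD kM default
          let p := switchPrimes m M
          let row' := (row.set km p.1).set kM p.2
          if km = 0 then egCol fuel (setRowG T r row') (r + 1) (Letter.succL w)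
          else egRow fuel (setRowG T r row') (r + 1) (Letter.succL w)

/-- `T ←ᴼ u` together with the flag recording whether the insertion ended in
column insertion. -/
def egInsert (T : STab) (u : Letter) : STab × Bool :=
  egRow (T.flatten.length + T.length + 2) T 0 u

/-- The orthogonal Edelman–Greene insertion tableau `P_EGᴼ(a)`. -/
def PEG (a : PWord) : STab := a.foldl (fun T u => (egInsert T u).1) []

/-- Add the recording letter `x` to `Q` in the unique box of `Pnew` not in `Pold`. -/
def addBox (Q Pold Pnew : STab) (x : Letter) : STab :=
  match (List.range Pnew.length).find?
      (fun r => decide ((Pold.getD r []).length ≠ (Pnew.getD r []).length)) with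
  | some r => setRowG Q r ((Q.getD r []) ++ [x])
  | none => Q

def QEGaux : STab → STab → ℕ → PWord → STab
  | _, Q, _, [] => Q
  | P, Q, n, u :: rest =>
      let res := egInsert P u
      QEGaux res.1 (addBox Q P res.1 ⟨(n : ℤ), res.2⟩) (n + 1) rest

/-- The orthogonal Edelman–Greene recording tableau `Q_EGᴼ(a)`. -/
def QEG (a : PWord) : STab := QEGaux [] [] 1 a

/-! ## Orthogonal Coxeter–Knuth operators -/

def ock1 (x : Letter) : Letter := ⟨x.ceil, !x.primed⟩

def ock2 (x y : Letter) : Letter × Letter := (⟨y.ceil, x.primed⟩, ⟨x.ceil, y.primed⟩)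

def ock3 (x y z : Letter) : Letter × Letter × Letter :=
  if x.ceil = z.ceil ∧ (x.ceil - y.ceil = 1 ∨ y.ceil - x.ceil = 1) then
    if x.primed = false ∧ y.primed = false ∧ z.primed = false then
      -- XYX ↔ YXY
      (⟨y.ceil, false⟩, ⟨x.ceil, false⟩, ⟨y.ceil, false⟩)
    else if x.primed = true ∧ y.primed = false ∧ z.primed = false then
      -- X'YX ↦ YXY'
      (⟨y.ceil, false⟩, ⟨x.ceil, false⟩, ⟨y.ceil, true⟩)
    else if x.primed = false ∧ y.primed = false ∧ z.primed = true then
      -- YXY' ↦ X'YX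
      (⟨y.ceil, true⟩, ⟨x.ceil, false⟩, ⟨y.ceil, false⟩)
    else (x, y, z)
  else if (x.ceil < z.ceil ∧ z.ceil < y.ceil) ∨ (y.ceil < z.ceil ∧ z.ceil < x.ceil) then
    -- ACB ↔ CAB
    (y, x, z)
  else if (y.ceil < x.ceil ∧ x.ceil < z.ceil) ∨ (z.ceil < x.ceil ∧ x.ceil < y.ceil) then
    -- BCA ↔ BAC
    (x, z, y)
  else (x, y, z)

/-- The operator `ock_i` for `i ∈ ℤ`. -/
def ockW (i : ℤ) (a : PWord) : PWord :=
  if i = -1 then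
    match a with
    | [] => []
    | x :: rest => ock1 x :: rest
  else if i = 0 then
    match a with
    | x :: y :: rest => (ock2 x y).1 :: (ock2 x y).2 :: rest
    | _ => a
  else if 1 ≤ i ∧ i + 2 ≤ (a.length : ℤ) then
    let k := (i - 1).toNat
    match a[k]?, a[k + 1]?, a[k + 2]? with
    | some x, some y, some z =>
        a.take k ++ [(ock3 x y z).1, (ock3 x y z).2.1, (ock3 x y z).2.2] ++ a.drop (k + 3)
    | _, _, _ => a
  else a

/-- Orthogonal Coxeter–Knuth equivalence: generated by `a ∼ ock_i(a)` for all `i ∈ ℤ`. -/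
def OckEquiv : PWord → PWord → Prop :=
  Relation.EqvGen (fun a b => ∃ i : ℤ, b = ockW i a)
/-! ## Descents -/

/-- Descent set of a primed word (as a set of 1-based positions). -/
def DesWord (a : PWord) : Set ℤ :=
  {i | ∃ k : ℕ, i = (k : ℤ) + 1 ∧ ∃ x y, a[k]? = some x ∧ a[k + 1]? = some y ∧ y < x}

/-- Descent set of a standard shifted tableau. -/
def DesT (T : STab) : Set ℤ :=
  {i | 0 < i ∧ (
    (∃ r c r' c', entry? T r c = some ⟨i, false⟩ ∧
        entry? T r' c' = some ⟨i + 1, false⟩ ∧ r < r') ∨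
    (∃ r c r' c', entry? T r c = some ⟨i, true⟩ ∧
        entry? T r' c' = some ⟨i + 1, true⟩ ∧ c < c') ∨
    (∃ r c r' c', entry? T r c = some ⟨i, false⟩ ∧
        entry? T r' c' = some ⟨i + 1, true⟩))}

/-! ## Dual equivalence operators on standard shifted tableaux -/

def numPrimes (T : STab) : ℕ := T.flatten.countP (fun x => x.primed)

/-- The entries of column `c`, read from bottom to top (increasing). -/
def colLetters (T : STab) (c : ℕ) : PWord :=
  (List.range (c + 1)).filterMap (fun r => entry? T r c)

/-- The shifted reading word `unprime(C_q R_q ⋯ C_1 R_1)`. -/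
def shword (T : STab) : List ℤ :=
  (((List.range (numCols T)).reverse).flatMap (fun idx =>
    (colLetters T idx).filter (fun x => x.primed) ++
      ((T.getD idx []).filter (fun x => !x.primed)))).map Letter.ceil

def idxOfZ (v : ℤ) : List ℤ → ℕ
  | [] => 0
  | x :: r => if x = v then 0 else idxOfZ v r + 1

def positionsOf (T : STab) : List (ℕ × ℕ) :=
  (List.range T.length).flatMap (fun r =>
    (List.range (T.getD r []).length).map (fun k => (r, r + k)))

/-- The box `□_v` of `T` containing `v` or `v'`. -/
def boxOf (T : STab) (v : ℤ) : Option (ℕ × ℕ) :=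
  (positionsOf T).find? (fun p =>
    match entry? T p.1 p.2 with
    | some x => decide (x.ceil = v)
    | none => false)

/-- Reverse the prime of the entry in position `(r, c)`. -/
def togglePos (T : STab) (r c : ℕ) : STab :=
  match entry? T r c with
  | some x => setEntryG T r c ⟨x.ceil, !x.primed⟩
  | none => T

/-- Switch the primes of the entries in the two given positions. -/
def switchAt (T : STab) (p q : ℕ × ℕ) : STab :=
  match entry? T p.1 p.2, entry? T q.1 q.2 with
  | some x, some y =>
      if x.primed = y.primed then T else togglePos (togglePos T p.1 p.2) q.1 q.2
  | _, _ => T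

/-- The row index of `□_v` if it is a main-diagonal box. -/
def diagBox? (T : STab) (v : ℤ) : Option ℕ :=
  (boxOf T v).bind (fun p => if p.1 = p.2 then some p.1 else none)

def switchDiag (T T' : STab) (u v : ℤ) : STab :=
  match diagBox? T u, diagBox? T v with
  | some r, some s => switchAt T' (r, r) (s, s)
  | _, _ => T'

/-- The operator `𝔰_i`. -/
def sOp (i : ℤ) (T : STab) : STab :=
  match boxOf T i, boxOf T (i + 1) with
  | some (r1, c1), some (r2, c2) =>
      if r1 ≠ r2 ∧ c1 ≠ c2 then
        -- swap i ↔ i+1 and i' ↔ (i+1)'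
        setEntryG (setEntryG T r1 c1 ⟨i + 1, ((entry? T r1 c1).getD default).primed⟩)
          r2 c2 ⟨i, ((entry? T r2 c2).getD default).primed⟩
      else if r1 ≠ c1 ∧ r2 ≠ c2 then
        -- same row or column, neither box diagonal: reverse both primes
        togglePos (togglePos T r1 c1) r2 c2
      else
        -- same row or column, one box diagonal
        let T1 := if r1 = c1 then togglePos T r2 c2 else togglePos T r1 c1
        let T2 :=
          if 1 ≤ i - 1 ∧ (diagBox? T (i - 1)).isSome ∧ (diagBox? T (i + 1)).isSome then
            switchDiag T T1 (i - 1) (i + 1)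
          else T1
        if i + 2 ≤ (T.flatten.length : ℤ) ∧ (diagBox? T i).isSome ∧
            (diagBox? T (i + 2)).isSome then
          switchDiag T T2 i (i + 2)
        else T2
  | _, _ => T

def btwn (a m b : ℕ) : Prop := (a < m ∧ m < b) ∨ (b < m ∧ m < a)

instance (a m b : ℕ) : Decidable (btwn a m b) := by unfold btwn; infer_instance

/-- The dual equivalence operator `𝔡_i` for `i ∈ ℤ`. -/
def dOp (i : ℤ) (T : STab) : STab :=
  if ¬(1 ≤ i + 2 ∧ i + 2 ≤ (T.flatten.length : ℤ)) then T
  else if i = -1 then togglePos T 0 0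
  else if i = 0 then togglePos T 0 1
  else
    let w := shword T
    if btwn (idxOfZ i w) (idxOfZ (i + 2) w) (idxOfZ (i + 1) w) then sOp i T
    else if btwn (idxOfZ (i + 1) w) (idxOfZ i w) (idxOfZ (i + 2) w) then sOp (i + 1) T
    else T

/-! ## Marked cycles -/

/-- The 2-cycles of `z`, as ordered pairs `(i, j)` with `i < j = z(i)`. -/
def cycSet (z : Equiv.Perm ℤ) : Set (ℤ × ℤ) := {p | p.1 < p.2 ∧ z p.1 = p.2}

/-- `s_{a_n} ⋯ s_{a_{k+2}} s_{a_{k+1}}` (ordinary product; 0-based index `k`). -/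
def suffixPerm (a : List ℤ) (k : ℕ) : Equiv.Perm ℤ :=
  ((a.drop (k + 1)).reverse.map sPerm).prod

/-- `γ_{k+1}(a)` as an ordered pair (junk value `(0,0)` off the commutation set). -/
def gammaPair (a : List ℤ) (k : ℕ) : ℤ × ℤ :=
  match a[k]? with
  | some x => (min (suffixPerm a k x) (suffixPerm a k (x + 1)),
               max (suffixPerm a k x) (suffixPerm a k (x + 1)))
  | none => (0, 0)
/-! ## Increasing factorization sequences and Schur Q-functions -/

/-- `Incr_∞(R_inv^+(z))`: sequences of weakly increasing primed words, all but
finitely many empty, whose concatenation is a primed involution word for `z`. -/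
def IncrSeq (z : Equiv.Perm ℤ) : Set (ℕ → PWord) :=
  {φ | (∀ n, List.Chain' (· ≤ ·) (φ n)) ∧
    ∃ N, (∀ n, N ≤ n → φ n = []) ∧ ((List.range N).map φ).flatten ∈ RinvPlus z}

/-- Least bound past which a sequence of words is empty. -/
noncomputable def seqBound (φ : ℕ → PWord) : ℕ := sInf {N | ∀ n, N ≤ n → φ n = []}

/-- The concatenation `a^1 a^2 ⋯` of a sequence of words. -/
noncomputable def concatSeq (φ : ℕ → PWord) : PWord :=
  ((List.range (seqBound φ)).map φ).flatten

/-- `ℓ(a^1) + ⋯ + ℓ(a^i)`. -/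
def prefLen (φ : ℕ → PWord) (i : ℕ) : ℕ := (((List.range i).map φ).map List.length).sum

/-- The minimal `i ≥ 1` with `j ≤ ℓ(a^1) + ⋯ + ℓ(a^i)`. -/
noncomputable def relabel (φ : ℕ → PWord) (j : ℤ) : ℤ :=
  ((sInf {i : ℕ | 1 ≤ i ∧ j ≤ (prefLen φ i : ℤ)} : ℕ) : ℤ)

/-- The semistandard recording tableau `Q_EGᴼ(φ)`. -/
noncomputable def QEGseq (φ : ℕ → PWord) : STab :=
  (QEG (concatSeq φ)).map (List.map (fun x => (⟨relabel φ x.ceil, x.primed⟩ : Letter)))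

/-- The insertion tableau `P_EGᴼ(φ)`. -/
noncomputable def PEGseq (φ : ℕ → PWord) : STab := PEG (concatSeq φ)

/-- The Schur Q-function of a strict partition: the coefficient of the monomial with
exponent vector `d` is the number of semistandard shifted tableaux `T` of the given
shape with `x^T = x^d`. -/
noncomputable def SchurQ (sh : List ℕ) : MvPowerSeries ℤ ℤ :=
  fun d => (({T : STab | shapeOf T = sh ∧ IsSemistandard T ∧
    ∀ i : ℤ, d i = T.flatten.countP (fun x => decide (x.ceil = i))} : Set STab).ncard : ℤ)

/-- `Q_z = Σ_{φ ∈ Incr_∞(R_inv^+(z))} x^φ`. -/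
noncomputable def Qz (z : Equiv.Perm ℤ) : MvPowerSeries ℤ ℤ :=
  fun d => (({φ : ℕ → PWord | φ ∈ IncrSeq z ∧
    (∀ i : ℕ, d ((i : ℤ) + 1) = (φ i).length) ∧
    (∀ j : ℤ, j ≤ 0 → d j = 0)} : Set (ℕ → PWord)).ncard : ℤ)

/-! ## Dominant involutions -/

/-- The shifted diagram `SD_λ ⊆ ℤ × ℤ` of a strict partition. -/
def SDset (sh : List ℕ) : Set (ℤ × ℤ) :=
  {p | ∃ i j : ℕ, 1 ≤ i ∧ i ≤ sh.length ∧ 1 ≤ j ∧ j ≤ sh.getD (i - 1) 0 ∧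
    p.1 = (i : ℤ) ∧ p.2 = (i : ℤ) + (j : ℤ) - 1}

/-- The involution Rothe diagram `D̂(z) = {(i,j) : z(i) > j ≤ i < z(j)}`. -/
def invRothe (z : Equiv.Perm ℤ) : Set (ℤ × ℤ) :=
  {p | p.2 < z p.1 ∧ p.2 ≤ p.1 ∧ p.1 < z p.2}

/-- The tableau `T_λ` with entry `i + j - 1` in box `(i, j)` of `SD_λ`. -/
def Tlam (sh : List ℕ) : STab :=
  (List.range sh.length).map (fun r =>
    (List.range (sh.getD r 0)).map (fun k =>
      (⟨2 * (r : ℤ) + (k : ℤ) + 1, false⟩ : Letter)))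

/-- The permutation `i + m ↦ w(i) + m` (fixing everything outside `m + support`). -/
def shiftPerm (m : ℕ) (w : Equiv.Perm ℤ) : Equiv.Perm ℤ :=
  (Equiv.addLeft (m : ℤ)).permCongr w

/-- `z ∈ S_m`: `z` fixes every point outside `[1, m]`. -/
def SupportedOn (z : Equiv.Perm ℤ) (m : ℕ) : Prop :=
  ∀ x : ℤ, x < 1 ∨ (m : ℤ) < x → z x = x
/-! ## Primed compatible sequences -/

/-- A primed compatible sequence, recorded as the list of its columns `(index; value)`. -/
def IsPrimedCompatible (φ : List (ℕ × Letter)) : Prop :=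
  (∀ p ∈ φ, 0 < p.1 ∧ 0 < p.2.ceil) ∧
  List.Chain' (fun p q : ℕ × Letter => p.1 ≤ q.1 ∧ (p.1 = q.1 → p.2 ≤ q.2)) φ ∧
  (∀ (k l : ℕ) (p : ℕ × Letter), k < l → φ[k]? = some p → φ[l]? = some p →
    p.2.primed = false)

def IsIndexStrict (φ : List (ℕ × Letter)) : Prop :=
  List.Chain' (fun p q : ℕ × Letter => p.1 < q.1) φ

/-! ## Sagan–Worley insertion (orthogonal and symplectic versions) -/

/-- Whether `u` bumps `v`: strict comparison when inserting an unprimed letter into a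
row or a primed letter into a column, weak comparison otherwise. -/
def swBump (isRow : Bool) (u v : Letter) : Bool :=
  if (isRow && !u.primed) || (!isRow && u.primed) then decide (u < v) else decide (u ≤ v)

/-- Column stage of orthogonal Sagan–Worley insertion. -/
def swColO : ℕ → STab → ℕ → Letter → STab × Bool
  | 0, T, _, _ => (T, true)
  | fuel + 1, T, c, u =>
    let occ := (List.range (c + 1)).filterMap (fun r => (entry? T r c).map (fun x => (r, x)))
    match occ.find? (fun p => swBump false u p.2) with
    | none =>
        let r := occ.length
        let u' := if r = c ∧ u.primed then Letter.unprime u else u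
        (setRowG T r ((T.getD r []) ++ [u']), true)
    | some p =>
        if p.1 = c then
          if u.ceil = p.2.ceil then swColO fuel T (c + 1) (Letter.unprime p.2)
          else
            let q := switchPrimes u p.2
            swColO fuel (setEntryG T p.1 c q.1) (c + 1) q.2
        else swColO fuel (setEntryG T p.1 c u) (c + 1) p.2

/-- Row stage of orthogonal Sagan–Worley insertion. -/
def swRowO : ℕ → STab → ℕ → Letter → STab × Bool
  | 0, T, _, _ => (T, true)
  | fuel + 1, T, r, u =>
    let row := T.getD r []
    match row.findIdx? (fun v => swBump true u v) with
    | none =>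
        if row.isEmpty ∧ u.primed then (setRowG T r [Letter.unprime u], true)
        else (setRowG T r (row ++ [u]), false)
    | some k =>
        let v := row.getD k default
        if k = 0 then
          if u.ceil = v.ceil then swColO fuel T (r + 1) (Letter.unprime v)
          else
            let q := switchPrimes u v
            swColO fuel (setRowG T r (row.set 0 q.1)) (r + 1) q.2
        else swRowO fuel (setRowG T r (row.set k u)) (r + 1) v

def swInsertO (T : STab) (u : Letter) : STab × Bool :=
  swRowO (T.flatten.length + T.length + 2) T 0 u

/-- Column stage of symplectic (original) Sagan–Worley insertion. -/
def swColSp : ℕ → STab → ℕ → Letter → STab × Bool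
  | 0, T, _, _ => (T, true)
  | fuel + 1, T, c, u =>
    let occ := (List.range (c + 1)).filterMap (fun r => (entry? T r c).map (fun x => (r, x)))
    match occ.find? (fun p => swBump false u p.2) with
    | none => (setRowG T occ.length ((T.getD occ.length []) ++ [u]), true)
    | some p =>
        if p.1 = c then
          if u.ceil = p.2.ceil then swColSp fuel T (c + 1) (Letter.unprime p.2)
          else swColSp fuel (setEntryG T p.1 c u) (c + 1) p.2
        else swColSp fuel (setEntryG T p.1 c u) (c + 1) p.2

/-- Row stage of symplectic (original) Sagan–Worley insertion. -/
def swRowSp : ℕ → STab → ℕ → Letter → STab × Bool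
  | 0, T, _, _ => (T, true)
  | fuel + 1, T, r, u =>
    let row := T.getD r []
    match row.findIdx? (fun v => swBump true u v) with
    | none => (setRowG T r (row ++ [u]), false)
    | some k =>
        let v := row.getD k default
        if k = 0 then
          if u.ceil = v.ceil then swColSp fuel T (r + 1) (Letter.unprime v)
          else swColSp fuel (setRowG T r (row.set 0 u)) (r + 1) v
        else swRowSp fuel (setRowG T r (row.set k u)) (r + 1) v

def swInsertSp (T : STab) (u : Letter) : STab × Bool :=
  swRowSp (T.flatten.length + T.length + 2) T 0 u

def PSWO (φ : List (ℕ × Letter)) : STab := φ.foldl (fun T p => (swInsertO T p.2).1) []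

def PSWSp (φ : List (ℕ × Letter)) : STab := φ.foldl (fun T p => (swInsertSp T p.2).1) []

def QSWaux (ins : STab → Letter → STab × Bool) : STab → STab → List (ℕ × Letter) → STab
  | _, Q, [] => Q
  | P, Q, p :: rest =>
      let res := ins P p.2
      QSWaux ins res.1 (addBox Q P res.1 ⟨(p.1 : ℤ), res.2⟩) rest

def QSWO (φ : List (ℕ × Letter)) : STab := QSWaux swInsertO [] [] φ

def QSWSp (φ : List (ℕ × Letter)) : STab := QSWaux swInsertSp [] [] φ

/-- Entry `A_{ij}` of the circled matrix of `φ` (forgetting the circles). -/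
def cmEntry (φ : List (ℕ × Letter)) (i j : ℕ) : ℕ :=
  φ.countP (fun p => decide (p.1 = i ∧ p.2.ceil = (j : ℤ)))

/-! ## Shifted mixed insertion (orthogonal and symplectic versions) -/

/-- Tableaux whose entries are signed letters `(ε, u)`, `ε ∈ {+, -}`
(`true` records the sign `-`). -/
abbrev MTab := List (List (Bool × Letter))

def extractO (U : MTab) : STab :=
  U.map (fun row =>
    match row with
    | [] => []
    | (e, x) :: rest => (if e then (⟨x.ceil, true⟩ : Letter) else x) :: rest.map Prod.snd)

def extractSp (U : MTab) : STab := U.map (List.map Prod.snd)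

/-- One mixed insertion, of the pair `β` into row (`isCol = false`) or column
(`isCol = true`) number `idx`; returns the tableau and the added box. -/
def hmIns (sympl : Bool) : ℕ → MTab → Bool → ℕ → Bool × Letter → MTab × (ℕ × ℕ)
  | 0, T, _, _, _ => (T, (0, 0))
  | fuel + 1, T, isCol, idx, β =>
    if isCol then
      let c := idx
      let occ := (List.range (c + 1)).filterMap
        (fun r => (entryG? T r c).map (fun x => (r, x)))
      match occ.find? (fun p => decide (β.2 < p.2.2)) with
      | none =>
          let r := occ.length
          (setRowG T r ((T.getD r []) ++ [β]), (r, c))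
      | some p =>
          if p.1 = c then
            hmIns sympl fuel
              (setEntryG T p.1 c (if sympl then (p.2.1, β.2) else β)) true (c + 1)
              (if sympl then (β.1, ⟨p.2.2.ceil, true⟩) else (p.2.1, ⟨p.2.2.ceil, true⟩))
          else
            hmIns sympl fuel (setEntryG T p.1 c (p.2.1, β.2)) p.2.2.primed
              (if p.2.2.primed then c + 1 else p.1 + 1) (β.1, p.2.2)
    else
      let r := idx
      let row := T.getD r []
      match row.findIdx? (fun p => decide (β.2 < p.2)) with
      | none => (setRowG T r (row ++ [β]), (r, r + row.length))
      | some k =>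
          let q := row.getD k default
          if k = 0 then
            hmIns sympl fuel
              (setRowG T r (row.set 0 (if sympl then (q.1, β.2) else β))) true (r + 1)
              (if sympl then (β.1, ⟨q.2.ceil, true⟩) else (q.1, ⟨q.2.ceil, true⟩))
          else
            hmIns sympl fuel (setRowG T r (row.set k (q.1, β.2))) q.2.primed
              (if q.2.primed then r + k + 1 else r + 1) (β.1, q.2)

def hmInsert (sympl : Bool) (T : MTab) (x : Letter) : MTab × (ℕ × ℕ) :=
  hmIns sympl (2 * T.flatten.length + 4) T false 0 (x.primed, ⟨x.ceil, false⟩)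

def hmAuxCS (sympl : Bool) : MTab → STab → List (ℕ × Letter) → MTab × STab
  | U, Q, [] => (U, Q)
  | U, Q, p :: rest =>
      let res := hmInsert sympl U p.2
      let pos := res.2
      let sgn := ((entryG? res.1 pos.1 pos.2).map Prod.fst).getD false
      let pr : Bool := if sympl then sgn else (decide (pos.1 ≠ pos.2) && sgn)
      hmAuxCS sympl res.1
        (setRowG Q pos.1 ((Q.getD pos.1 []) ++ [(⟨(p.1 : ℤ), pr⟩ : Letter)])) rest

def PHMO (φ : List (ℕ × Letter)) : STab := extractO (hmAuxCS false [] [] φ).1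
def QHMO (φ : List (ℕ × Letter)) : STab := (hmAuxCS false [] [] φ).2
def PHMSp (φ : List (ℕ × Letter)) : STab := extractSp (hmAuxCS true [] [] φ).1
def QHMSp (φ : List (ℕ × Letter)) : STab := (hmAuxCS true [] [] φ).2

/-- A primed word, identified with the primed compatible sequence with
index row `1, 2, …, n`. -/
def wordCS (a : PWord) : List (ℕ × Letter) :=
  ((List.range a.length).zip a).map (fun p => (p.1 + 1, p.2))

/-! ## The transpose of a primed compatible sequence -/

def insSortedCS (p : ℕ × Letter) : List (ℕ × Letter) → List (ℕ × Letter)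
  | [] => [p]
  | q :: rest =>
      if p.1 < q.1 ∨ (p.1 = q.1 ∧ p.2 ≤ q.2) then p :: q :: rest
      else q :: insSortedCS p rest

def sortCS (l : List (ℕ × Letter)) : List (ℕ × Letter) := l.foldr insSortedCS []

/-- `φ^⊤`: move each prime from the value to the index above it, interchange the two
rows, and reorder the columns lexicographically. -/
def transposeCS (φ : List (ℕ × Letter)) : List (ℕ × Letter) :=
  sortCS (φ.map (fun p => (p.2.ceil.toNat, (⟨(p.1 : ℤ), p.2.primed⟩ : Letter))))

namespace ShiftedEG

/-! ### Orthogonal Coxeter–Knuth moves away from the start of a word -/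

/-- One application of `ock3` to three consecutive letters of a word. -/
def KStep (a b : PWord) : Prop :=
  ∃ (p : PWord) (x y z : Letter) (s : PWord), a = p ++ x :: y :: z :: s ∧
    b = p ++ (ock3 x y z).1 :: (ock3 x y z).2.1 :: (ock3 x y z).2.2 :: s

/-- The equivalence relation generated by `ock3` on consecutive letters. -/
def Knuth : PWord → PWord → Prop := Relation.EqvGen KStep

theorem Knuth.refl (a : PWord) : Knuth a a := Relation.EqvGen.refl a

theorem Knuth.symm {a b : PWord} (h : Knuth a b) : Knuth b a := Relation.EqvGen.symm _ _ h

theorem Knuth.trans {a b c : PWord} (h : Knuth a b) (h' : Knuth b c) : Knuth a c :=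
  Relation.EqvGen.trans _ _ _ h h'

theorem _root_.OckEquiv.refl (a : PWord) : OckEquiv a a := Relation.EqvGen.refl a

theorem _root_.OckEquiv.symm {a b : PWord} (h : OckEquiv a b) : OckEquiv b a :=
  Relation.EqvGen.symm _ _ h

theorem _root_.OckEquiv.trans {a b c : PWord} (h : OckEquiv a b) (h' : OckEquiv b c) : OckEquiv a c :=
  Relation.EqvGen.trans _ _ _ h h'

theorem Knuth.append {a b : PWord} (h : Knuth a b) (p s : PWord) :
    Knuth (p ++ a ++ s) (p ++ b ++ s) := by
  induction h with
  | rel a b h =>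
    obtain ⟨q, x, y, z, t, rfl, rfl⟩ := h
    exact Relation.EqvGen.rel _ _ ⟨p ++ q, x, y, z, t ++ s, by simp, by simp⟩
  | refl a => exact Knuth.refl _
  | symm a b _ ih => exact ih.symm
  | trans a b c _ _ ih ih' => exact ih.trans ih'

theorem Knuth.append_left {a b : PWord} (h : Knuth a b) (p : PWord) :
    Knuth (p ++ a) (p ++ b) := by simpa using h.append p []

theorem Knuth.append_right {a b : PWord} (h : Knuth a b) (s : PWord) :
    Knuth (a ++ s) (b ++ s) := by simpa using h.append [] s

theorem Knuth.cons {a b : PWord} (h : Knuth a b) (x : Letter) :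
    Knuth (x :: a) (x :: b) := h.append_left [x]

theorem ock3_reverse (x y z : Letter) :
    ock3 z y x = ((ock3 x y z).2.2, (ock3 x y z).2.1, (ock3 x y z).1) := by
  obtain ⟨x, xp⟩ := x
  obtain ⟨y, yp⟩ := y
  obtain ⟨z, zp⟩ := z
  unfold ock3
  by_cases h : x = z
  · subst h
    cases xp <;> cases yp <;> cases zp <;> simp <;> split_ifs <;> simp_all
  · have h' : z ≠ x := fun h' => h h'.symm
    simp only [h, h', false_and, if_false]
    split_ifs <;> first | rfl | (exfalso; omega)

theorem Knuth.reverse {a b : PWord} (h : Knuth a b) : Knuth a.reverse b.reverse := by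
  induction h with
  | rel a b h =>
    obtain ⟨p, x, y, z, s, rfl, rfl⟩ := h
    refine Relation.EqvGen.rel _ _ ⟨s.reverse, z, y, x, p.reverse, by simp, ?_⟩
    rw [ock3_reverse x y z]
    simp
  | refl a => exact Knuth.refl _
  | symm a b _ ih => exact ih.symm
  | trans a b c _ _ ih ih' => exact ih.trans ih'

/-! ### Orthogonal Coxeter–Knuth moves at the start of a word -/

theorem ockEquiv_toggle (x : Letter) (s : PWord) : OckEquiv (x :: s) (ock1 x :: s) :=
  Relation.EqvGen.rel _ _ ⟨-1, by simp [ockW]⟩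

theorem ockEquiv_swap (x y : Letter) (s : PWord) :
    OckEquiv (x :: y :: s) (⟨y.ceil, x.primed⟩ :: ⟨x.ceil, y.primed⟩ :: s) :=
  Relation.EqvGen.rel _ _ ⟨0, by simp [ockW, ock2]⟩

theorem Knuth.ockEquiv {a b : PWord} (h : Knuth a b) : OckEquiv a b := by
  induction h with
  | rel a b h =>
    obtain ⟨p, x, y, z, s, rfl, rfl⟩ := h
    refine Relation.EqvGen.rel _ _ ⟨(p.length : ℤ) + 1, ?_⟩
    have h1 : ¬ ((p.length : ℤ) + 1 = -1) := by omega
    have h2 : ¬ ((p.length : ℤ) + 1 = 0) := by omega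
    have h3 : 1 ≤ (p.length : ℤ) + 1 ∧
        (p.length : ℤ) + 1 + 2 ≤ ((p ++ x :: y :: z :: s).length : ℤ) := by
      simp; omega
    have h4 : ((p.length : ℤ) + 1 - 1).toNat = p.length := by omega
    unfold ockW
    rw [if_neg h1, if_neg h2, if_pos h3]
    simp
  | refl a => exact OckEquiv.refl _
  | symm a b _ ih => exact ih.symm
  | trans a b c _ _ ih ih' => exact ih.trans ih'

/-- The possible effects of `ock_i` on a word. -/
theorem ockW_cases (i : ℤ) (a : PWord) :
    ockW i a = a ∨ (∃ x s, a = x :: s ∧ ockW i a = ock1 x :: s) ∨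
    (∃ x y s, a = x :: y :: s ∧
      ockW i a = (⟨y.ceil, x.primed⟩ : Letter) :: ⟨x.ceil, y.primed⟩ :: s) ∨
    KStep a (ockW i a) := by
  by_cases h1 : i = -1
  · subst h1
    cases a with
    | nil => left; simp [ockW]
    | cons x s => right; left; exact ⟨x, s, rfl, by simp [ockW]⟩
  by_cases h2 : i = 0
  · subst h2
    match a with
    | [] => left; simp [ockW]
    | [x] => left; simp [ockW]
    | x :: y :: s => right; right; left; exact ⟨x, y, s, rfl, by simp [ockW, ock2]⟩
  by_cases h3 : 1 ≤ i ∧ i + 2 ≤ (a.length : ℤ)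
  · right; right; right
    obtain ⟨k, hk⟩ : ∃ k : ℕ, i = k + 1 := ⟨(i - 1).toNat, by omega⟩
    subst hk
    have hl : k + 2 < a.length := by omega
    refine ⟨a.take k, a[k], a[k + 1], a[k + 2], a.drop (k + 3), ?_, ?_⟩
    · conv_lhs => rw [← List.take_append_drop k a]
      rw [List.drop_eq_getElem_cons (by omega), List.drop_eq_getElem_cons (by omega),
        List.drop_eq_getElem_cons (by omega)]
    · have h4 : ((k : ℤ) + 1 - 1).toNat = k := by omega
      unfold ockW
      rw [if_neg h1, if_neg h2, if_pos h3]
      simp only [h4]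
      rw [List.getElem?_eq_getElem (by omega), List.getElem?_eq_getElem (by omega),
        List.getElem?_eq_getElem (by omega)]
      simp
  · left
    unfold ockW
    rw [if_neg h1, if_neg h2, if_neg h3]

theorem _root_.OckEquiv.append_right {a b : PWord} (h : OckEquiv a b) (t : PWord) :
    OckEquiv (a ++ t) (b ++ t) := by
  induction h with
  | rel a b h =>
    obtain ⟨i, rfl⟩ := h
    rcases ockW_cases i a with h | ⟨x, s, rfl, h⟩ | ⟨x, y, s, rfl, h⟩ | h
    · rw [h]; exact OckEquiv.refl _
    · rw [h]; exact ockEquiv_toggle _ _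
    · rw [h]; exact ockEquiv_swap _ _ _
    · have : Knuth a (ockW i a) := Relation.EqvGen.rel _ _ h
      exact (this.append_right t).ockEquiv
  | refl a => exact OckEquiv.refl _
  | symm a b _ ih => exact ih.symm
  | trans a b c _ _ ih ih' => exact ih.trans ih'

/-! ### Sliding letters past monotone words

The commutation moves are invariant under reversing the order of `ℤ`, so they are stated for
a key which is either the ceiling or its negative. -/

/-- The ceiling of a letter or its negative. -/
def key (dual : Bool) (x : Letter) : ℤ := if dual then -x.ceil else x.ceil

/-- Strictly increasing with respect to `key dual`. -/
abbrev Incr (dual : Bool) (l : PWord) : Prop := l.Pairwise (fun a b => key dual a < key dual b)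

/-- Strictly decreasing with respect to `key dual`. -/
abbrev Decr (dual : Bool) (l : PWord) : Prop := l.Pairwise (fun a b => key dual b < key dual a)

variable {dual : Bool}

theorem incr_cons {a : Letter} {l : PWord} :
    Incr dual (a :: l) ↔ (∀ b ∈ l, key dual a < key dual b) ∧ Incr dual l := List.pairwise_cons

theorem decr_cons {a : Letter} {l : PWord} :
    Decr dual (a :: l) ↔ (∀ b ∈ l, key dual b < key dual a) ∧ Decr dual l := List.pairwise_cons

theorem incr_append {l l' : PWord} : Incr dual (l ++ l') ↔
    Incr dual l ∧ Incr dual l' ∧ ∀ a ∈ l, ∀ b ∈ l', key dual a < key dual b :=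
  List.pairwise_append

theorem decr_append {l l' : PWord} : Decr dual (l ++ l') ↔
    Decr dual l ∧ Decr dual l' ∧ ∀ a ∈ l, ∀ b ∈ l', key dual b < key dual a :=
  List.pairwise_append

theorem knuth_triple (x y z : Letter) (s : PWord) :
    Knuth (x :: y :: z :: s)
      ((ock3 x y z).1 :: (ock3 x y z).2.1 :: (ock3 x y z).2.2 :: s) :=
  Relation.EqvGen.rel _ _ ⟨[], x, y, z, s, rfl, rfl⟩

theorem knuth_acb {a b c : Letter} (hab : key dual a < key dual b) (hbc : key dual b < key dual c)
    (s : PWord) : Knuth (a :: c :: b :: s) (c :: a :: b :: s) := by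
  have h := knuth_triple a c b s
  have : ock3 a c b = (c, a, b) := by
    unfold ock3
    cases dual <;> simp only [key] at hab hbc <;> simp at hab hbc <;>
    · rw [if_neg (by omega), if_pos (by omega)]
  rwa [this] at h

theorem knuth_bca {a b c : Letter} (hab : key dual a < key dual b) (hbc : key dual b < key dual c)
    (s : PWord) : Knuth (b :: c :: a :: s) (b :: a :: c :: s) := by
  have h := knuth_triple b c a s
  have : ock3 b c a = (b, a, c) := by
    unfold ock3
    cases dual <;> simp only [key] at hab hbc <;> simp at hab hbc <;>
    · rw [if_neg (by omega), if_neg (by omega), if_pos (by omega)]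
  rwa [this] at h

/-- A small letter moves left through an increasing word following an intermediate letter. -/
theorem knuth_slide_left {m w : Letter} {B : PWord} (hw : key dual w < key dual m)
    (hB : Incr dual (m :: B)) (s : PWord) :
    Knuth (m :: B ++ w :: s) (m :: w :: B ++ s) := by
  induction B generalizing m with
  | nil => exact Knuth.refl _
  | cons b B ih =>
    rw [incr_cons] at hB
    have hmb := hB.1 b (by simp)
    have h1 := (ih (hw.trans hmb) hB.2).cons m
    exact h1.trans (knuth_bca hw hmb _)

/-- A big letter moves left through an increasing word preceding an intermediate letter. -/
theorem knuth_slide_big {M w : Letter} {A : PWord} (hw : key dual w < key dual M)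
    (hA : Incr dual (A ++ [w])) (s : PWord) :
    Knuth (A ++ M :: w :: s) (M :: A ++ w :: s) := by
  induction A with
  | nil => exact Knuth.refl _
  | cons a A ih =>
    rw [List.cons_append, incr_cons] at hA
    have h1 := (ih hA.2).cons a
    refine h1.trans ?_
    cases A with
    | nil => exact knuth_acb (hA.1 w (by simp)) hw s
    | cons b A =>
      refine knuth_acb (hA.1 b (by simp)) ?_ _
      have := hA.2
      rw [List.cons_append, incr_cons] at this
      exact (this.1 w (by simp)).trans hw

/-- A decreasing word of big letters moves through an increasing word of smaller ones. -/
theorem knuth_slide_word {h F : PWord} {f : Letter} (hh : Decr dual (h ++ [f]))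
    (hF : Incr dual (F ++ [f])) (s : PWord) :
    Knuth (h ++ F ++ f :: s) (F ++ h ++ f :: s) := by
  induction h using List.reverseRecOn generalizing f s with
  | nil => simpa using Knuth.refl _
  | append_singleton h u ih =>
    have hu : key dual f < key dual u := by
      rw [decr_append] at hh
      exact hh.2.2 u (by simp) f (by simp)
    have hd : Decr dual (h ++ [u]) := by
      rw [decr_append] at hh
      exact hh.1
    have hi : Incr dual (F ++ [u]) := by
      rw [incr_append] at hF ⊢
      refine ⟨hF.1, by simp, fun a ha b hb => ?_⟩
      simp only [List.mem_singleton] at hb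
      subst hb
      exact (hF.2.2 a ha f (by simp)).trans hu
    have h1 := ((knuth_slide_big hu hF s).symm).append_left h
    have h2 := ih hd hi (f :: s)
    simp only [List.append_assoc, List.cons_append, List.nil_append] at h1 h2 ⊢
    exact h1.trans h2

/-- A decreasing word of small letters moves left through an increasing word following an
intermediate letter. -/
theorem knuth_slide_decr {m : Letter} {F δ : PWord} (hF : Incr dual (m :: F))
    (hδ : Decr dual (m :: δ)) (s : PWord) :
    Knuth (m :: F ++ δ ++ s) (m :: δ ++ F ++ s) := by
  induction δ generalizing m with
  | nil => simpa using Knuth.refl _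
  | cons w δ ih =>
    rw [decr_cons] at hδ
    rw [incr_cons] at hF
    have hwm := hδ.1 w (by simp)
    have h1 := knuth_slide_left hwm (List.pairwise_cons.2 hF) (δ ++ s)
    have h2 := (ih (m := w)
      (List.pairwise_cons.2 ⟨fun a ha => hwm.trans (hF.1 a ha), hF.2⟩) hδ.2).cons m
    simp only [List.append_assoc, List.cons_append] at h1 h2 ⊢
    exact h1.trans h2

/-- If the words `B.1 ++ [B.2.1]`, concatenated, decrease, and each `B.2.1 :: B.2.2` increases,
then the former can be gathered in front of the latter. -/
theorem knuth_gather (bs : List (PWord × Letter × PWord))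
    (hD : Decr dual (bs.flatMap fun b => b.1 ++ [b.2.1]))
    (hF : ∀ b ∈ bs, Incr dual (b.2.1 :: b.2.2)) :
    Knuth (bs.flatMap fun b => b.1 ++ b.2.1 :: b.2.2)
      ((bs.flatMap fun b => b.1 ++ [b.2.1]) ++ bs.flatMap fun b => b.2.2) := by
  induction bs with
  | nil => exact Knuth.refl _
  | cons b bs ih =>
    obtain ⟨A, m, F⟩ := b
    simp only [List.flatMap_cons, List.append_assoc, List.cons_append, List.nil_append] at hD ⊢
    rw [decr_append] at hD
    have h1 := ((ih (List.pairwise_cons.1 hD.2.1).2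
      (fun b hb => hF b (by simp [hb]))).append_left (A ++ m :: F))
    have h2 := (knuth_slide_decr (hF (A, m, F) (by simp)) hD.2.1
      (bs.flatMap fun b => b.2.2)).append_left A
    simp only [List.append_assoc, List.cons_append] at h1 h2 ⊢
    exact h1.trans h2

/-! ### Reversing decreasing initial words -/

theorem unprimed_eq {x : Letter} (h : x.primed = false) : (⟨x.ceil, false⟩ : Letter) = x := by
  cases x; simp_all

theorem ockEquiv_reverse_aux {q : Letter} {Q L : PWord} (hq : q.primed = false)
    (hQ : Incr false (q :: Q)) (hL : Decr false (q :: L)) (hp : ∀ x ∈ L, x.primed = false)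
    (s : PWord) : OckEquiv (q :: Q ++ L ++ s) (L.reverse ++ q :: Q ++ s) := by
  induction L generalizing q Q with
  | nil => simpa using OckEquiv.refl _
  | cons x L ih =>
    rw [decr_cons] at hL
    have hxq : key false x < key false q := hL.1 x (by simp)
    have hx := hp x (by simp)
    have h1 := (knuth_slide_left hxq hQ (L ++ s)).ockEquiv
    have h2 := ockEquiv_swap q x (Q ++ (L ++ s))
    rw [hq, hx, unprimed_eq hx, unprimed_eq hq] at h2
    have h3 := ih (q := x) (Q := q :: Q) hx (List.pairwise_cons.2 ⟨fun a ha => by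
      rcases List.mem_cons.1 ha with rfl | ha
      · exact hxq
      · exact hxq.trans ((List.pairwise_cons.1 hQ).1 a ha), hQ⟩) hL.2
      (fun y hy => hp y (by simp [hy]))
    simp only [List.append_assoc, List.cons_append, List.reverse_cons, List.nil_append]
      at h1 h2 h3 ⊢
    exact h1.trans (h2.trans h3)

theorem ockEquiv_reverse {L : PWord} (hL : Decr false L) (hp : ∀ x ∈ L, x.primed = false)
    (s : PWord) : OckEquiv (L ++ s) (L.reverse ++ s) := by
  cases L with
  | nil => exact OckEquiv.refl _
  | cons x L =>
    have h := ockEquiv_reverse_aux (q := x) (Q := []) (L := L) (hp x (by simp)) (by simp) hL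
      (fun y hy => hp y (by simp [hy])) s
    simpa using h

/-- Reversal of a decreasing initial word with at most one primed letter, not in front; the
prime moves to the next bigger letter. -/
theorem ockEquiv_reverse_primed {D E : PWord} {v m : Letter}
    (hL : Decr false (D ++ v :: m :: E)) (hD : ∀ x ∈ D, x.primed = false)
    (hv : v.primed = false) (hE : ∀ x ∈ E, x.primed = false) (s : PWord) :
    OckEquiv (D ++ v :: m :: E ++ s)
      (E.reverse ++ ⟨m.ceil, false⟩ :: ⟨v.ceil, m.primed⟩ :: D.reverse ++ s) := by
  have hL' := hL
  rw [decr_append, decr_cons, decr_cons] at hL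
  obtain ⟨hL1, ⟨hL2, hL3, hL4⟩, hL5⟩ := hL
  have hmv : key false m < key false v := hL2 m (by simp)
  have hDv : Decr false (D ++ [v]) := by
    rw [decr_append]
    exact ⟨hL1, by simp, fun a ha b hb => hL5 a ha b (by simp at hb; simp [hb])⟩
  have h1 := ockEquiv_reverse hDv (by
    intro x hx
    rcases List.mem_append.1 hx with hx | hx
    · exact hD x hx
    · simp at hx; rw [hx]; exact hv) (m :: E ++ s)
  have hinc : Incr false (v :: D.reverse) := by
    have := List.pairwise_reverse.2 hDv
    simpa using this
  have h2 := (knuth_slide_left hmv hinc (E ++ s)).ockEquiv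
  have h3 := ockEquiv_swap v m (D.reverse ++ (E ++ s))
  rw [hv] at h3
  have h4 := ockEquiv_reverse_aux (q := ⟨m.ceil, false⟩)
    (Q := ⟨v.ceil, m.primed⟩ :: D.reverse) (L := E) rfl (by
      simp only [List.pairwise_cons, key] at hinc hmv ⊢
      refine ⟨fun a ha => ?_, hinc.1, hinc.2⟩
      rcases List.mem_cons.1 ha with rfl | ha
      · exact hmv
      · exact hmv.trans (hinc.1 a ha))
    (List.pairwise_cons.2 ⟨hL3, hL4⟩) hE s
  simp only [List.append_assoc, List.cons_append, List.reverse_append, List.reverse_cons,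
    List.reverse_nil, List.nil_append] at h1 h2 h3 h4 ⊢
  exact h1.trans (h2.trans (h3.trans h4))

/-! ### Bumping through a line -/

theorem knuth_bump {A B : PWord} {M w : Letter} (hI : Incr false (A ++ M :: B))
    (hA : Incr false (A ++ [w])) (hw : w.ceil < M.ceil) :
    Knuth (A ++ M :: B ++ [w]) (M :: A ++ w :: B) := by
  rw [incr_append] at hI
  have hw' : key false w < key false M := by simpa [key] using hw
  have h1 := (knuth_slide_left hw' hI.2.1 []).append_left A
  have h2 := knuth_slide_big hw' hA B
  simp only [List.append_assoc, List.cons_append, List.append_nil] at h1 h2 ⊢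
  exact h1.trans h2

theorem knuth_bump_braid {A B : PWord} {m M w : Letter} (hI : Incr false (A ++ m :: M :: B))
    (hw : m.ceil = w.ceil) (hM : M.ceil = m.ceil + 1) (hMp : M.primed = false)
    (hp : m.primed = false ∨ w.primed = false) :
    Knuth (A ++ m :: M :: B ++ [w])
      (w.succL :: A ++ (switchPrimes m M).1 :: (switchPrimes m M).2 :: B) := by
  rw [incr_append] at hI
  have hw' : key false w < key false M := by simp [key]; omega
  have h1 := (knuth_slide_left hw' (List.pairwise_cons.1 hI.2.1).2 []).append_left (A ++ [m])
  have h2 := (knuth_triple m M w B).append_left A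
  have h3 : ock3 m M w = (w.succL, (switchPrimes m M).1, (switchPrimes m M).2) := by
    obtain ⟨m, mp⟩ := m
    obtain ⟨M, Mp⟩ := M
    obtain ⟨w, wp⟩ := w
    simp only at hw hM hMp
    subst hw hMp hM
    cases mp <;> cases wp <;> simp_all [ock3, switchPrimes, Letter.succL]
  have hc : (switchPrimes m M).1.ceil = m.ceil := by unfold switchPrimes; split_ifs <;> rfl
  rw [h3] at h2
  have h4 := knuth_slide_big (dual := false) (M := w.succL) (w := (switchPrimes m M).1) (A := A)
    (by simp [key, hc, Letter.succL]; omega) (by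
      rw [incr_append]
      refine ⟨hI.1, by simp, fun a ha b hb => ?_⟩
      simp only [List.mem_singleton] at hb
      subst hb
      have := hI.2.2 a ha m (by simp)
      simpa [key, hc] using this) ((switchPrimes m M).2 :: B)
  simp only [List.append_assoc, List.cons_append, List.append_nil, List.nil_append] at h1 h2 h4 ⊢
  exact h1.trans (h2.trans h4)

/-! ### The Demazure action from both sides -/

/-- Right Demazure action of `s_i`. -/
def demR (σ : Equiv.Perm ℤ) (i : ℤ) : Equiv.Perm ℤ := if σ i < σ (i + 1) then σ * sPerm i else σ

/-- Left Demazure action of `s_i`. -/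
def demL (i : ℤ) (σ : Equiv.Perm ℤ) : Equiv.Perm ℤ :=
  if σ⁻¹ i < σ⁻¹ (i + 1) then sPerm i * σ else σ

theorem sPerm_apply (i j : ℤ) : sPerm i j = if j = i then i + 1 else if j = i + 1 then i else j :=
  Equiv.swap_apply_def _ _ _

theorem sPerm_inv (i : ℤ) : (sPerm i)⁻¹ = sPerm i := Equiv.swap_inv _ _

theorem sPerm_mul_self (i : ℤ) : sPerm i * sPerm i = 1 := Equiv.swap_mul_self _ _

theorem sPerm_sPerm (i j : ℤ) : sPerm i (sPerm i j) = j := Equiv.swap_apply_self _ _ _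

theorem sPerm_left (i : ℤ) : sPerm i i = i + 1 := Equiv.swap_apply_left _ _

theorem sPerm_right (i : ℤ) : sPerm i (i + 1) = i := Equiv.swap_apply_right _ _

theorem sPerm_of_ne {i j : ℤ} (h : j ≠ i) (h' : j ≠ i + 1) : sPerm i j = j :=
  Equiv.swap_apply_of_ne_of_ne h h'

theorem perm_ne (σ : Equiv.Perm ℤ) {i j : ℤ} (h : i ≠ j) : σ i ≠ σ j := fun h' => h (σ.injective h')

theorem perm_lt_iff (σ : Equiv.Perm ℤ) {i j : ℤ} (h : i ≠ j) : σ j < σ i ↔ ¬ σ i < σ j := by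
  have := perm_ne σ h
  omega

theorem sPerm_lt_iff {i a b : ℤ} (h : ¬ (a = i ∧ b = i + 1)) (h' : ¬ (a = i + 1 ∧ b = i)) :
    sPerm i a < sPerm i b ↔ a < b := by
  simp only [sPerm_apply]
  split_ifs <;> omega

theorem sPerm_comm {i j : ℤ} (h : i + 2 ≤ j) : sPerm i * sPerm j = sPerm j * sPerm i := by
  ext k
  simp only [Equiv.Perm.mul_apply, sPerm_apply]
  split_ifs <;> omega

theorem sPerm_braid (i : ℤ) :
    sPerm i * sPerm (i + 1) * sPerm i = sPerm (i + 1) * sPerm i * sPerm (i + 1) := by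
  ext k
  simp only [Equiv.Perm.mul_apply, sPerm_apply]
  split_ifs <;> omega

theorem demR_comm_of_lt (σ : Equiv.Perm ℤ) {i j : ℤ} (h : i + 2 ≤ j) :
    demR (demR σ i) j = demR (demR σ j) i := by
  have hc := sPerm_comm h
  have e1 : sPerm i j = j := sPerm_of_ne (by omega) (by omega)
  have e2 : sPerm i (j + 1) = j + 1 := sPerm_of_ne (by omega) (by omega)
  have e3 : sPerm j i = i := sPerm_of_ne (by omega) (by omega)
  have e4 : sPerm j (i + 1) = i + 1 := sPerm_of_ne (by omega) (by omega)
  unfold demR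
  by_cases h1 : σ i < σ (i + 1) <;> by_cases h2 : σ j < σ (j + 1) <;>
    simp [h1, h2, e1, e2, e3, e4, mul_assoc, hc]

theorem demR_comm (σ : Equiv.Perm ℤ) {i j : ℤ} (h : i + 2 ≤ j ∨ j + 2 ≤ i) :
    demR (demR σ i) j = demR (demR σ j) i := by
  rcases h with h | h
  · exact demR_comm_of_lt σ h
  · exact (demR_comm_of_lt σ h).symm

theorem demR_braid (σ : Equiv.Perm ℤ) (i : ℤ) :
    demR (demR (demR σ i) (i + 1)) i = demR (demR (demR σ (i + 1)) i) (i + 1) := by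
  have e1 := sPerm_left i
  have e2 := sPerm_right i
  have e3 : sPerm i (i + 1 + 1) = i + 1 + 1 := sPerm_of_ne (by omega) (by omega)
  have e4 := sPerm_left (i + 1)
  have e5 := sPerm_right (i + 1)
  have e6 : sPerm (i + 1) i = i := sPerm_of_ne (by omega) (by omega)
  have hb := sPerm_braid i
  rw [mul_assoc, mul_assoc] at hb
  have g1 := perm_lt_iff σ (show i ≠ i + 1 by omega)
  have g2 := perm_lt_iff σ (show i ≠ i + 1 + 1 by omega)
  have g3 := perm_lt_iff σ (show i + 1 ≠ i + 1 + 1 by omega)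
  unfold demR
  by_cases h1 : σ i < σ (i + 1) <;> by_cases h2 : σ (i + 1) < σ (i + 1 + 1) <;>
    by_cases h3 : σ i < σ (i + 1 + 1) <;>
    first
    | (exfalso; omega)
    | simp [h1, h2, h3, g1, g3, e1, e2, e3, e4, e5, e6, mul_assoc, hb]

theorem demL_eq (i : ℤ) (σ : Equiv.Perm ℤ) : demL i σ = (demR σ⁻¹ i)⁻¹ := by
  unfold demL demR
  split_ifs <;> simp [sPerm_inv]

theorem demL_demR (i j : ℤ) (σ : Equiv.Perm ℤ) : demL i (demR σ j) = demR (demL i σ) j := by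
  have ha : σ (σ⁻¹ i) = i := by simp
  have hb : σ (σ⁻¹ (i + 1)) = i + 1 := by simp
  unfold demL demR
  by_cases h1 : σ j < σ (j + 1) <;> by_cases h2 : σ⁻¹ i < σ⁻¹ (i + 1)
  · simp only [h1, h2, if_true, mul_inv_rev, sPerm_inv, Equiv.Perm.mul_apply]
    by_cases h : σ⁻¹ i = j ∧ σ⁻¹ (i + 1) = j + 1
    · rw [h.1] at ha
      rw [h.2] at hb
      rw [h.1, h.2, ha, hb, sPerm_left, sPerm_right, sPerm_left, sPerm_right, if_neg (by omega),
        if_neg (by omega)]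
      ext k
      simp only [Equiv.Perm.mul_apply, sPerm_apply]
      have e1 : σ k = i ↔ k = j := by rw [← ha]; simp
      have e2 : σ k = i + 1 ↔ k = j + 1 := by rw [← hb]; simp
      simp only [e1, e2]
      split_ifs <;> simp [ha, hb]
    · have h' : ¬ (σ j = i ∧ σ (j + 1) = i + 1) := by
        rintro ⟨h3, h4⟩
        apply h
        rw [← h4, ← h3]
        simp
      rw [if_pos ((sPerm_lt_iff h (by omega)).2 h2), if_pos ((sPerm_lt_iff h' (by omega)).2 h1),
        mul_assoc]
  · simp only [h1, h2, if_true, if_false, mul_inv_rev, sPerm_inv, Equiv.Perm.mul_apply]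
    have h' : ¬ (σ⁻¹ i = j + 1 ∧ σ⁻¹ (i + 1) = j) := by
      rintro ⟨h3, h4⟩
      rw [h3] at ha
      rw [h4] at hb
      omega
    rw [if_neg (mt (sPerm_lt_iff (by omega) h').1 h2)]
  · simp only [h1, h2, if_true, if_false, Equiv.Perm.mul_apply]
    have h' : ¬ (σ j = i + 1 ∧ σ (j + 1) = i) := by
      rintro ⟨h3, h4⟩
      have e1 : σ⁻¹ i = j + 1 := by rw [← h4]; simp
      have e2 : σ⁻¹ (i + 1) = j := by rw [← h3]; simp
      omega
    rw [if_neg (mt (sPerm_lt_iff (by omega) h').1 h1)]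
  · simp only [h1, h2, if_false]

/-- The twisted Demazure action `y ↦ s_i ∘ y ∘ s_i`. -/
def twist (y : Equiv.Perm ℤ) (i : ℤ) : Equiv.Perm ℤ := demL i (demR y i)

theorem foldl_demL (i : ℤ) (σ : Equiv.Perm ℤ) (w : List ℤ) :
    w.foldl demR (demL i σ) = demL i (w.foldl demR σ) := by
  induction w generalizing σ with
  | nil => rfl
  | cons x w ih => rw [List.foldl_cons, List.foldl_cons, ← demL_demR, ih]

theorem demR_one (i : ℤ) : demR 1 i = sPerm i := by simp [demR]

theorem demL_one (i : ℤ) : demL i 1 = sPerm i := by simp [demL]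

theorem demL_sPerm (i : ℤ) : demL i (sPerm i) = sPerm i := by
  unfold demL
  rw [sPerm_inv, sPerm_left, sPerm_right, if_neg (by omega)]

theorem heckeProd_cons (x : ℤ) (w : List ℤ) : heckeProd (x :: w) = demL x (heckeProd w) := by
  change (x :: w).foldl demR 1 = demL x (w.foldl demR 1)
  rw [List.foldl_cons, demR_one, ← demL_one, foldl_demL]

theorem heckeProd_snoc (x : ℤ) (w : List ℤ) : heckeProd (w ++ [x]) = demR (heckeProd w) x := by
  change (w ++ [x]).foldl demR 1 = demR (w.foldl demR 1) x
  rw [List.foldl_append]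
  rfl

theorem invHecke_eq_foldl (a : List ℤ) : invHecke a = a.foldl twist 1 := by
  induction a using List.reverseRecOn with
  | nil => rfl
  | append_singleton p x ih =>
    rw [List.foldl_append, ← ih]
    cases p with
    | nil =>
      change heckeProd [x] = demL x (demR 1 x)
      rw [demR_one, demL_sPerm, heckeProd_cons]
      exact demL_one x
    | cons y p =>
      unfold invHecke twist
      simp only [List.reverse_append, List.reverse_cons, List.reverse_nil, List.nil_append,
        List.cons_append, List.tail_cons, List.foldl_cons, List.foldl_nil]
      rw [heckeProd_cons, ← List.append_assoc, heckeProd_snoc]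

theorem demL_comm (σ : Equiv.Perm ℤ) {i j : ℤ} (h : i + 2 ≤ j ∨ j + 2 ≤ i) :
    demL i (demL j σ) = demL j (demL i σ) := by
  simp only [demL_eq, inv_inv]
  rw [demR_comm _ h]

theorem demL_braid (σ : Equiv.Perm ℤ) (i : ℤ) :
    demL i (demL (i + 1) (demL i σ)) = demL (i + 1) (demL i (demL (i + 1) σ)) := by
  simp only [demL_eq, inv_inv]
  rw [demR_braid]

theorem twist_comm (y : Equiv.Perm ℤ) {i j : ℤ} (h : i + 2 ≤ j ∨ j + 2 ≤ i) :
    twist (twist y i) j = twist (twist y j) i := by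
  unfold twist
  rw [← demL_demR, ← demL_demR, demL_comm _ h, demR_comm _ h]

theorem twist_braid (y : Equiv.Perm ℤ) (i : ℤ) :
    twist (twist (twist y i) (i + 1)) i = twist (twist (twist y (i + 1)) i) (i + 1) := by
  unfold twist
  simp only [← demL_demR]
  rw [demL_braid, demR_braid]

theorem twist_one_comm (i j : ℤ) : twist (twist 1 i) j = twist (twist 1 j) i := by
  have key : ∀ i j : ℤ, twist (twist 1 i) j = demR (demR (demR 1 j) i) j := by
    intro i j
    unfold twist
    rw [demR_one, demL_sPerm, ← demR_one, demL_demR, demL_demR, demL_one, demR_one]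
  rcases lt_trichotomy i j with h | h | h
  · by_cases h' : j = i + 1
    · subst h'
      rw [key, key, demR_braid]
    · exact twist_comm _ (by omega)
  · rw [h]
  · by_cases h' : i = j + 1
    · subst h'
      rw [key, key, demR_braid]
    · exact twist_comm _ (by omega)

/-! ### The twisted action on involutions -/

/-- Both `i` and `i + 1` are fixed points of `y`. -/
def Fix2 (y : Equiv.Perm ℤ) (i : ℤ) : Prop := y i = i ∧ y (i + 1) = i + 1

theorem twist_desc {y : Equiv.Perm ℤ} (hy : y * y = 1) {i : ℤ} (h : ¬ y i < y (i + 1)) :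
    twist y i = y := by
  have hi : y⁻¹ = y := inv_eq_of_mul_eq_one_left hy
  unfold twist demL demR
  rw [if_neg h, hi, if_neg h]

theorem invol_apply {y : Equiv.Perm ℤ} (hy : y * y = 1) (j : ℤ) : y (y j) = j := by
  rw [← Equiv.Perm.mul_apply, hy, Equiv.Perm.one_apply]

theorem twist_fixed {y : Equiv.Perm ℤ} (hy : y * y = 1) {i : ℤ} (h : Fix2 y i) :
    twist y i = y * sPerm i := by
  have hi : y⁻¹ = y := inv_eq_of_mul_eq_one_left hy
  unfold twist demL demR
  rw [h.1, h.2, if_pos (lt_add_one i), mul_inv_rev, hi, sPerm_inv, Equiv.Perm.mul_apply,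
    Equiv.Perm.mul_apply, h.1, h.2, sPerm_left, sPerm_right, if_neg (by omega)]

theorem twist_conj {y : Equiv.Perm ℤ} (hy : y * y = 1) {i : ℤ} (h : y i < y (i + 1))
    (h' : ¬ Fix2 y i) : twist y i = sPerm i * y * sPerm i := by
  have hi : y⁻¹ = y := inv_eq_of_mul_eq_one_left hy
  have h2 : (y * sPerm i)⁻¹ i < (y * sPerm i)⁻¹ (i + 1) := by
    rw [mul_inv_rev, hi, sPerm_inv, Equiv.Perm.mul_apply, Equiv.Perm.mul_apply,
      sPerm_lt_iff h' (by omega)]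
    exact h
  unfold twist demL demR
  rw [if_pos h, if_pos h2, mul_assoc]

theorem twist_invol {y : Equiv.Perm ℤ} (hy : y * y = 1) (i : ℤ) : twist y i * twist y i = 1 := by
  by_cases h : y i < y (i + 1)
  · by_cases h' : Fix2 y i
    · rw [twist_fixed hy h']
      have : sPerm i * y = y * sPerm i := by
        ext k
        have e1 := h'.1
        have e2 := h'.2
        simp only [Equiv.Perm.mul_apply, sPerm_apply]
        have e3 : y k = i ↔ k = i := by conv_lhs => rw [← e1]; simp
        have e4 : y k = i + 1 ↔ k = i + 1 := by conv_lhs => rw [← e2]; simp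
        simp only [e3, e4]
        split_ifs <;> simp [e1, e2]
      rw [mul_assoc, ← mul_assoc (sPerm i), this, mul_assoc, sPerm_mul_self, mul_one, hy]
    · rw [twist_conj hy h h']
      calc sPerm i * y * sPerm i * (sPerm i * y * sPerm i)
          = sPerm i * y * (sPerm i * sPerm i) * y * sPerm i := by simp only [mul_assoc]
        _ = 1 := by rw [sPerm_mul_self, mul_one, mul_assoc (sPerm i), hy, mul_one, sPerm_mul_self]
  · rw [twist_desc hy h, hy]

theorem foldl_twist_invol {y : Equiv.Perm ℤ} (hy : y * y = 1) (a : List ℤ) :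
    a.foldl twist y * a.foldl twist y = 1 := by
  induction a generalizing y with
  | nil => exact hy
  | cons x a ih => exact ih (twist_invol hy x)

theorem twist_apply_of_fixed {y : Equiv.Perm ℤ} (hy : y * y = 1) {i : ℤ} (h : Fix2 y i) (j : ℤ) :
    twist y i j = y (sPerm i j) := by
  rw [twist_fixed hy h]
  rfl

theorem twist_apply_of_not_fixed {y : Equiv.Perm ℤ} (hy : y * y = 1) {i : ℤ}
    (h : y i < y (i + 1)) (h' : ¬ Fix2 y i) (j : ℤ) :
    twist y i j = sPerm i (y (sPerm i j)) := by
  rw [twist_conj hy h h']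
  rfl

/-- `a < b` are positions of an inversion of `y`. -/
def Inver (y : Equiv.Perm ℤ) (a b : ℤ) : Prop := a < b ∧ y b < y a

/-- Inversions are transported by ascending twists. -/
theorem Inver.twist {y : Equiv.Perm ℤ} (hy : y * y = 1) {i a b : ℤ} (hi : y i < y (i + 1))
    (h : Inver y a b) : Inver (twist y i) (sPerm i a) (sPerm i b) := by
  obtain ⟨hab, h⟩ := h
  refine ⟨(sPerm_lt_iff ?_ (by omega)).2 hab, ?_⟩
  · rintro ⟨rfl, rfl⟩
    omega
  by_cases h' : Fix2 y i
  · rw [twist_apply_of_fixed hy h', twist_apply_of_fixed hy h', sPerm_sPerm, sPerm_sPerm]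
    exact h
  · rw [twist_apply_of_not_fixed hy hi h', twist_apply_of_not_fixed hy hi h', sPerm_sPerm,
      sPerm_sPerm, sPerm_lt_iff _ (by omega)]
    · exact h
    · rintro ⟨h1, h2⟩
      have e1 : b = y i := by rw [← h1, invol_apply hy]
      have e2 : a = y (i + 1) := by rw [← h2, invol_apply hy]
      omega

theorem inver_twist_self {y : Equiv.Perm ℤ} (hy : y * y = 1) {i : ℤ} (hi : y i < y (i + 1)) :
    Inver (twist y i) i (i + 1) := by
  refine ⟨by omega, ?_⟩
  by_cases h' : Fix2 y i
  · rw [twist_apply_of_fixed hy h', twist_apply_of_fixed hy h', sPerm_left, sPerm_right]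
    exact hi
  · rw [twist_apply_of_not_fixed hy hi h', twist_apply_of_not_fixed hy hi h', sPerm_left,
      sPerm_right, sPerm_lt_iff h' (by omega)]
    exact hi

theorem fix2_twist_iff {y : Equiv.Perm ℤ} (hy : y * y = 1) {i j : ℤ}
    (hij : i + 2 ≤ j ∨ j + 2 ≤ i) : Fix2 (twist y i) j ↔ Fix2 y j := by
  have e1 : sPerm i j = j := sPerm_of_ne (by omega) (by omega)
  have e2 : sPerm i (j + 1) = j + 1 := sPerm_of_ne (by omega) (by omega)
  have e3 : ∀ k l, sPerm i k = l ↔ k = sPerm i l := by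
    intro k l
    constructor
    · rintro rfl; rw [sPerm_sPerm]
    · rintro rfl; rw [sPerm_sPerm]
  unfold Fix2
  by_cases hi : y i < y (i + 1)
  · by_cases h' : Fix2 y i
    · rw [twist_apply_of_fixed hy h', twist_apply_of_fixed hy h', e1, e2]
    · rw [twist_apply_of_not_fixed hy hi h', twist_apply_of_not_fixed hy hi h', e1, e2, e3, e3,
        e1, e2]
  · rw [twist_desc hy hi]

theorem fix2_of_braid {y : Equiv.Perm ℤ} (hy : y * y = 1) {i j : ℤ} (hij : i = j + 1 ∨ j = i + 1)
    (h1 : y j < y (j + 1)) (h2 : twist y j i < twist y j (i + 1))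
    (h : Fix2 (twist (twist y j) i) j) : Fix2 y i := by
  have hy1 := twist_invol hy j
  have n1 : ¬ Fix2 (twist y j) i := by
    intro h'
    unfold Fix2 at h
    rw [twist_apply_of_fixed hy1 h', twist_apply_of_fixed hy1 h'] at h
    rcases hij with rfl | rfl
    · rw [sPerm_left] at h
      have := h'.2
      omega
    · rw [sPerm_right] at h
      have := h'.1
      omega
  have e : ∀ k, twist y j k = sPerm i (twist (twist y j) i (sPerm i k)) := by
    intro k
    rw [twist_apply_of_not_fixed hy1 h2 n1, sPerm_sPerm, sPerm_sPerm]
  have n2 : ¬ Fix2 y j := by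
    intro h'
    have e' := twist_apply_of_fixed hy h'
    rcases hij with rfl | rfl
    · have := e j
      have g : sPerm (j + 1) j = j := sPerm_of_ne (by omega) (by omega)
      rw [g, h.1, g, e', sPerm_left, h'.2] at this
      omega
    · have := e (i + 1 + 1)
      have g : sPerm i (i + 1 + 1) = i + 1 + 1 := sPerm_of_ne (by omega) (by omega)
      rw [g, h.2, g, e', sPerm_right, h'.1] at this
      omega
  have e' : ∀ k, y k = sPerm j (twist y j (sPerm j k)) := by
    intro k
    rw [twist_apply_of_not_fixed hy h1 n2, sPerm_sPerm, sPerm_sPerm]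
  unfold Fix2
  rw [e', e', e, e]
  have f1 := h.1
  have f2 := h.2
  rcases hij with rfl | rfl
  · have g1 : sPerm j (j + 1 + 1) = j + 1 + 1 := sPerm_of_ne (by omega) (by omega)
    have g2 : sPerm (j + 1) j = j := sPerm_of_ne (by omega) (by omega)
    simp only [sPerm_right, g1, g2, f1, f2, sPerm_left, and_self]
  · have g1 : sPerm (i + 1) i = i := sPerm_of_ne (by omega) (by omega)
    have g2 : sPerm i (i + 1 + 1) = i + 1 + 1 := sPerm_of_ne (by omega) (by omega)
    simp only [sPerm_left, g1, g2, f1, f2, sPerm_right, and_self]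

theorem fix2_braid {y : Equiv.Perm ℤ} (hy : y * y = 1) {i j : ℤ} (hij : i = j + 1 ∨ j = i + 1)
    (h2 : twist y i j < twist y i (j + 1))
    (h3 : twist (twist y i) j i < twist (twist y i) j (i + 1))
    (h : Fix2 y i) : Fix2 (twist (twist y j) i) j := by
  have hy1 := twist_invol hy i
  have e := twist_apply_of_fixed hy h
  have n1 : ¬ Fix2 (twist y i) j := by
    rintro ⟨h4, h5⟩
    rw [e] at h4 h5
    rcases hij with rfl | rfl
    · rw [sPerm_left, h.2] at h5
      omega
    · rw [sPerm_right, h.1] at h4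
      omega
  have e' := twist_apply_of_not_fixed hy1 h2 n1
  have f1 := h.1
  have f2 := h.2
  rw [e', e', e, e] at h3
  rw [e, e] at h2
  rcases hij with rfl | rfl
  · have g1 : sPerm j (j + 1 + 1) = j + 1 + 1 := sPerm_of_ne (by omega) (by omega)
    have g2 : sPerm (j + 1) j = j := sPerm_of_ne (by omega) (by omega)
    simp only [sPerm_left, sPerm_right, g1, g2, f1, f2] at h2 h3
    have m1 : y j ≠ j + 1 := fun h' => by
      have := y.injective (h'.trans f1.symm)
      omega
    have m2 : y j < j := by
      by_contra h'
      have : y j = j := by omega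
      rw [this, sPerm_left] at h3
      omega
    have a1 : y j < y (j + 1) := by omega
    have b1 := twist_apply_of_not_fixed hy a1 (fun h' => by have := h'.1; omega)
    have g3 : sPerm j (y j) = y j := sPerm_of_ne (by omega) (by omega)
    have c1 : twist y j j = j := by rw [b1, sPerm_left, f1, sPerm_right]
    have c2 : twist y j (j + 1) = y j := by rw [b1, sPerm_right, g3]
    have c3 : twist y j (j + 1 + 1) = j + 1 + 1 := by rw [b1, g1, f2, g1]
    have d1 := twist_apply_of_not_fixed (twist_invol hy j) (i := j + 1) (by omega)
      (fun h' => by have := h'.1; omega)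
    constructor
    · rw [d1, g2, c1, g2]
    · rw [d1, sPerm_left, c3, sPerm_right]
  · have g1 : sPerm (i + 1) i = i := sPerm_of_ne (by omega) (by omega)
    have g2 : sPerm i (i + 1 + 1) = i + 1 + 1 := sPerm_of_ne (by omega) (by omega)
    simp only [sPerm_left, sPerm_right, g1, g2, f1, f2] at h2 h3
    have m1 : y (i + 1 + 1) ≠ i + 1 := fun h' => by
      have := y.injective (h'.trans f2.symm)
      omega
    have m2 : i + 1 + 1 < y (i + 1 + 1) := by
      by_contra h'
      have : y (i + 1 + 1) = i + 1 + 1 := by omega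
      rw [this, sPerm_right] at h3
      omega
    have a1 : y (i + 1) < y (i + 1 + 1) := by omega
    have b1 := twist_apply_of_not_fixed hy a1 (fun h' => by have := h'.2; omega)
    have g3 : sPerm (i + 1) (y (i + 1 + 1)) = y (i + 1 + 1) :=
      sPerm_of_ne (by omega) (by omega)
    have c1 : twist y (i + 1) i = i := by rw [b1, g1, f1, g1]
    have c2 : twist y (i + 1) (i + 1) = y (i + 1 + 1) := by rw [b1, sPerm_left, g3]
    have c3 : twist y (i + 1) (i + 1 + 1) = i + 1 + 1 := by rw [b1, sPerm_right, f2, sPerm_left]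
    have d1 := twist_apply_of_not_fixed (twist_invol hy (i + 1)) (i := i) (by omega)
      (fun h' => by have := h'.2; omega)
    constructor
    · rw [d1, sPerm_right, c1, sPerm_left]
    · rw [d1, g2, c3, g2]

/-! ### Validity of primed words -/

/-- Every letter of `a` is an ascent when acting on `y`. -/
def Asc : Equiv.Perm ℤ → List ℤ → Prop
  | _, [] => True
  | y, x :: a => y x < y (x + 1) ∧ Asc (twist y x) a

/-- Every primed letter of `a` is a commutation when acting on `y`. -/
def PrimesOK : Equiv.Perm ℤ → PWord → Prop
  | _, [] => True
  | y, x :: a => (x.primed = true → Fix2 y x.ceil) ∧ PrimesOK (twist y x.ceil) a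

/-- The action of a primed word on an involution. -/
def act (y : Equiv.Perm ℤ) (a : PWord) : Equiv.Perm ℤ := (unprimeWord a).foldl twist y

/-- `a` is a primed involution word for some involution. -/
def Valid (a : PWord) : Prop := ∃ z, a ∈ RinvPlus z

theorem act_append (y : Equiv.Perm ℤ) (a b : PWord) : act y (a ++ b) = act (act y a) b := by
  simp [act, unprimeWord]

theorem act_cons (y : Equiv.Perm ℤ) (x : Letter) (a : PWord) :
    act y (x :: a) = act (twist y x.ceil) a := rfl

theorem act_invol {y : Equiv.Perm ℤ} (hy : y * y = 1) (a : PWord) : act y a * act y a = 1 :=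
  foldl_twist_invol hy _

theorem primesOK_append {y : Equiv.Perm ℤ} {a b : PWord} :
    PrimesOK y (a ++ b) ↔ PrimesOK y a ∧ PrimesOK (act y a) b := by
  induction a generalizing y with
  | nil => simp [PrimesOK, act, unprimeWord]
  | cons x a ih => rw [List.cons_append, PrimesOK, PrimesOK, ih, and_assoc]; rfl

theorem asc_append {y : Equiv.Perm ℤ} {a b : List ℤ} :
    Asc y (a ++ b) ↔ Asc y a ∧ Asc (a.foldl twist y) b := by
  induction a generalizing y with
  | nil => simp [Asc]
  | cons x a ih => rw [List.cons_append, Asc, Asc, ih, and_assoc]; rfl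

theorem invHecke_unprimeWord (a : PWord) : invHecke (unprimeWord a) = act 1 a :=
  invHecke_eq_foldl _

theorem asc_of_rinv {z : Equiv.Perm ℤ} {a : List ℤ} (h : a ∈ Rinv z) : Asc 1 a := by
  have main : ∀ p s : List ℤ, p ++ s ∈ Rinv z → Asc (p.foldl twist 1) s := by
    intro p s
    induction s generalizing p with
    | nil => intro _; trivial
    | cons x s ih =>
      intro h
      constructor
      · by_contra hx
        have h1 : invHecke (p ++ s) = z := by
          rw [← h.1, invHecke_eq_foldl, invHecke_eq_foldl, List.foldl_append, List.foldl_append,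
            List.foldl_cons, twist_desc (foldl_twist_invol (one_mul 1) p) hx]
        have := h.2 _ h1
        simp at this
      · have := ih (p ++ [x]) (by simpa using h)
        simpa using this
  exact main [] a h

theorem primesOK_of_mem {z : Equiv.Perm ℤ} {a : PWord} (h : a ∈ RinvPlus z) : PrimesOK 1 a := by
  have main : ∀ p s : PWord, p ++ s = a → PrimesOK (act 1 p) s := by
    intro p s
    induction s generalizing p with
    | nil => intro _; trivial
    | cons x s ih =>
      intro hs
      constructor
      · intro hx
        obtain ⟨c, hc, h1, h2⟩ := h.2 p.length x (by rw [← hs]; simp) hx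
        have e1 : c = x.ceil := by
          rw [← hs] at hc
          simp [unprimeWord] at hc
          exact hc.symm
        have e2 : (unprimeWord a).take p.length = unprimeWord p := by
          rw [← hs]; simp [unprimeWord]
        rw [e2, invHecke_unprimeWord, e1] at h1 h2
        exact ⟨h1, h2⟩
      · have := ih (p ++ [x]) (by simpa using hs)
        rw [act_append] at this
        exact this
  exact main [] a rfl

theorem mem_of_primesOK {z : Equiv.Perm ℤ} {a : PWord} (h : unprimeWord a ∈ Rinv z)
    (h' : PrimesOK 1 a) : a ∈ RinvPlus z := by
  refine ⟨h, fun k x hk hx => ⟨x.ceil, by simp [unprimeWord, hk], ?_⟩⟩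
  have hlt : k < a.length := by
    by_contra hlt
    rw [List.getElem?_eq_none (by omega)] at hk
    cases hk
  have e1 : a = a.take k ++ x :: a.drop (k + 1) := by
    conv_lhs => rw [← List.take_append_drop k a]
    rw [List.drop_eq_getElem_cons hlt]
    rw [List.getElem?_eq_getElem hlt] at hk
    cases hk
    rfl
  have e2 : (unprimeWord a).take k = unprimeWord (a.take k) := by simp [unprimeWord]
  rw [e2, invHecke_unprimeWord]
  rw [e1, primesOK_append] at h'
  exact h'.2.1 hx

theorem Valid.asc {a : PWord} (h : Valid a) : Asc 1 (unprimeWord a) := by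
  obtain ⟨z, hz⟩ := h
  exact asc_of_rinv hz.1

theorem Valid.primesOK {a : PWord} (h : Valid a) : PrimesOK 1 a := by
  obtain ⟨z, hz⟩ := h
  exact primesOK_of_mem hz

/-- Validity transfers to a word of the same length with the same action, as soon as its primes
are consistent. -/
theorem mem_transfer {z : Equiv.Perm ℤ} {a b : PWord} (h : a ∈ RinvPlus z)
    (hl : b.length = a.length) (hact : act 1 b = act 1 a)
    (hp : Asc 1 (unprimeWord b) → PrimesOK 1 b) : b ∈ RinvPlus z := by
  have h1 : unprimeWord b ∈ Rinv z := by
    refine ⟨by rw [invHecke_unprimeWord, hact, ← invHecke_unprimeWord]; exact h.1.1,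
      fun c hc => ?_⟩
    have := h.1.2 c hc
    simp only [unprimeWord, List.length_map] at this ⊢
    omega
  exact mem_of_primesOK h1 (hp (asc_of_rinv h1))

/-! ### Coxeter–Knuth moves preserve primed involution words -/

theorem act_three (y : Equiv.Perm ℤ) (a b c : Letter) (s : PWord) :
    act y (a :: b :: c :: s) = act (twist (twist (twist y a.ceil) b.ceil) c.ceil) s := rfl

theorem twist_braid' (y : Equiv.Perm ℤ) {i j : ℤ} (h : i - j = 1 ∨ j - i = 1) :
    twist (twist (twist y i) j) i = twist (twist (twist y j) i) j := by
  rcases h with h | h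
  · obtain rfl : i = j + 1 := by omega
    exact (twist_braid y j).symm
  · obtain rfl : j = i + 1 := by omega
    exact twist_braid y i

theorem ock3_act (y : Equiv.Perm ℤ) (a b c : Letter) :
    twist (twist (twist y (ock3 a b c).1.ceil) (ock3 a b c).2.1.ceil) (ock3 a b c).2.2.ceil =
      twist (twist (twist y a.ceil) b.ceil) c.ceil := by
  unfold ock3
  split_ifs with h1 h2 h3 h4 h5 h6
  · rw [← h1.1]; exact (twist_braid' y h1.2).symm
  · rw [← h1.1]; exact (twist_braid' y h1.2).symm
  · rw [← h1.1]; exact (twist_braid' y h1.2).symm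
  · rfl
  · simp only [twist_comm y (show b.ceil + 2 ≤ a.ceil ∨ a.ceil + 2 ≤ b.ceil by omega)]
  · simp only [twist_comm _ (show c.ceil + 2 ≤ b.ceil ∨ b.ceil + 2 ≤ c.ceil by omega)]
  · rfl

theorem ock3_primesOK {y : Equiv.Perm ℤ} (hy : y * y = 1) {a b c : Letter}
    (hA : Asc y [a.ceil, b.ceil, c.ceil])
    (hp : PrimesOK y [a, b, c]) :
    PrimesOK y [(ock3 a b c).1, (ock3 a b c).2.1, (ock3 a b c).2.2] := by
  unfold ock3
  split_ifs with h1 h2 h3 h4 h5 h6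
  · simp [PrimesOK]
  · obtain ⟨h11, h12⟩ := h1
    simp only [Asc, PrimesOK, and_true] at hA hp ⊢
    refine ⟨by simp, by simp, fun _ => ?_⟩
    rw [← h11] at hA
    exact fix2_braid hy (by omega) hA.2.1 hA.2.2 (hp.1 h3.1)
  · obtain ⟨h11, h12⟩ := h1
    simp only [Asc, PrimesOK, and_true] at hA hp ⊢
    refine ⟨fun _ => ?_, by simp, by simp⟩
    have := hp.2.2 h4.2.2
    rw [← h11] at this
    exact fix2_of_braid hy (by omega) hA.1 hA.2.1 this
  · exact hp
  · simp only [PrimesOK, and_true] at hp ⊢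
    refine ⟨fun h => (fix2_twist_iff hy (by omega)).1 (hp.2.1 h),
      fun h => (fix2_twist_iff hy (by omega)).2 (hp.1 h), fun h => ?_⟩
    rw [twist_comm y (by omega)]
    exact hp.2.2 h
  · simp only [PrimesOK, and_true] at hp ⊢
    have hy' := twist_invol hy a.ceil
    exact ⟨hp.1, fun h => (fix2_twist_iff hy' (by omega)).1 (hp.2.2 h),
      fun h => (fix2_twist_iff hy' (by omega)).2 (hp.2.1 h)⟩
  · exact hp

theorem asc_three {y : Equiv.Perm ℤ} {p s : PWord} {a b c : Letter}
    (h : Asc y (unprimeWord (p ++ a :: b :: c :: s))) :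
    Asc (act y p) [a.ceil, b.ceil, c.ceil] := by
  simp only [unprimeWord, List.map_append, List.map_cons, asc_append, Asc] at h ⊢
  exact ⟨h.2.1, h.2.2.1, h.2.2.2.1, trivial⟩

theorem KStep.mem {z : Equiv.Perm ℤ} {a b : PWord} (h : KStep a b) (ha : a ∈ RinvPlus z) :
    b ∈ RinvPlus z := by
  obtain ⟨p, x, y, w, s, rfl, rfl⟩ := h
  have hact : ∀ t, act t ((ock3 x y w).1 :: (ock3 x y w).2.1 :: (ock3 x y w).2.2 :: s) =
      act t (x :: y :: w :: s) := fun t => by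
    rw [act_three, ock3_act, act_three]
  refine mem_transfer ha (by simp) (by rw [act_append, act_append, hact]) fun _ => ?_
  have hp := primesOK_of_mem ha
  have hA0 := asc_of_rinv ha.1
  rw [primesOK_append] at hp ⊢
  refine ⟨hp.1, ?_⟩
  have hy := act_invol (one_mul (1 : Equiv.Perm ℤ)) p
  have e : ∀ u v w : Letter, u :: v :: w :: s = [u, v, w] ++ s := fun _ _ _ => rfl
  rw [e, primesOK_append]
  rw [e, primesOK_append] at hp
  refine ⟨ock3_primesOK hy (asc_three hA0) hp.2.1, ?_⟩
  have : act (act 1 p) [(ock3 x y w).1, (ock3 x y w).2.1, (ock3 x y w).2.2] =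
      act (act 1 p) [x, y, w] := ock3_act _ _ _ _
  rw [this]
  exact hp.2.2

theorem fix2_one (i : ℤ) : Fix2 1 i := ⟨rfl, rfl⟩

theorem ock1_mem {z : Equiv.Perm ℤ} {x : Letter} {s : PWord} (h : x :: s ∈ RinvPlus z) :
    ock1 x :: s ∈ RinvPlus z := by
  refine mem_transfer h rfl rfl fun _ => ?_
  exact ⟨fun _ => fix2_one _, (primesOK_of_mem h).2⟩

theorem not_fix2_twist_one {i j : ℤ} (h : Fix2 (twist 1 i) j) : i + 2 ≤ j ∨ j + 2 ≤ i := by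
  have e := twist_apply_of_fixed (one_mul (1 : Equiv.Perm ℤ)) (fix2_one i)
  by_contra hij
  obtain ⟨h1, h2⟩ := h
  simp only [e, Equiv.Perm.one_apply] at h1 h2
  have : i = j ∨ i = j + 1 ∨ j = i + 1 := by omega
  rcases this with rfl | rfl | rfl
  · rw [sPerm_left] at h1; omega
  · rw [sPerm_left] at h2; omega
  · rw [sPerm_right] at h1; omega

theorem ock2_mem {z : Equiv.Perm ℤ} {x y : Letter} {s : PWord} (h : x :: y :: s ∈ RinvPlus z) :
    (⟨y.ceil, x.primed⟩ : Letter) :: ⟨x.ceil, y.primed⟩ :: s ∈ RinvPlus z := by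
  have e := twist_one_comm x.ceil y.ceil
  refine mem_transfer h rfl (congrArg (fun t => act t s) e.symm) fun _ => ?_
  have hp := primesOK_of_mem h
  refine ⟨fun _ => fix2_one _, fun hy => ?_, ?_⟩
  · have := not_fix2_twist_one (hp.2.1 hy)
    exact (fix2_twist_iff (one_mul 1) (by simp only; omega)).2 (fix2_one _)
  · have := hp.2.2
    rw [e] at this
    exact this

theorem ock3_invol (x y z : Letter) :
    ock3 (ock3 x y z).1 (ock3 x y z).2.1 (ock3 x y z).2.2 = (x, y, z) := by
  obtain ⟨x, xp⟩ := x
  obtain ⟨y, yp⟩ := y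
  obtain ⟨z, zp⟩ := z
  unfold ock3
  simp only
  split_ifs <;> simp_all <;> omega

theorem KStep.symm {a b : PWord} (h : KStep a b) : KStep b a := by
  obtain ⟨p, x, y, z, s, rfl, rfl⟩ := h
  exact ⟨p, _, _, _, s, rfl, by rw [ock3_invol]⟩

theorem ockW_mem_iff {z : Equiv.Perm ℤ} {a : PWord} (i : ℤ) :
    ockW i a ∈ RinvPlus z ↔ a ∈ RinvPlus z := by
  rcases ockW_cases i a with h1 | ⟨x, s, rfl, h1⟩ | ⟨x, y, s, rfl, h1⟩ | h1
  · rw [h1]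
  · rw [h1]
    exact ⟨fun h => by simpa [ock1] using ock1_mem h, ock1_mem⟩
  · rw [h1]
    exact ⟨fun h => by simpa using ock2_mem h, ock2_mem⟩
  · exact ⟨KStep.mem h1.symm, KStep.mem h1⟩

theorem _root_.OckEquiv.mem_iff {a b : PWord} (h : OckEquiv a b) (z : Equiv.Perm ℤ) :
    a ∈ RinvPlus z ↔ b ∈ RinvPlus z := by
  induction h with
  | rel a b h => obtain ⟨i, rfl⟩ := h; exact (ockW_mem_iff i).symm
  | refl => exact Iff.rfl
  | symm _ _ _ ih => exact ih.symm
  | trans _ _ _ _ _ ih1 ih2 => exact ih1.trans ih2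

theorem Valid.of_equiv {a b : PWord} (ha : Valid a) (h : OckEquiv a b) : Valid b := by
  obtain ⟨z, hz⟩ := ha
  exact ⟨z, (h.mem_iff z).1 hz⟩

/-- Prefixes of primed involution words are primed involution words. -/
theorem Valid.of_append {a b : PWord} (h : Valid (a ++ b)) : Valid a := by
  obtain ⟨z, hz⟩ := h
  refine ⟨act 1 a, mem_of_primesOK ⟨invHecke_unprimeWord a, fun c hc => ?_⟩
    (primesOK_append.1 (primesOK_of_mem hz)).1⟩
  have h1 := hz.1.2 (c ++ unprimeWord b) (by
    rw [← hz.1.1, invHecke_unprimeWord, act_append, ← hc, invHecke_eq_foldl, invHecke_eq_foldl,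
      List.foldl_append]
    rfl)
  simp only [unprimeWord, List.map_append, List.length_append, List.length_map] at h1 ⊢
  omega

/-! ### Forbidden factors -/

theorem Valid.asc_at {p s : PWord} {x : Letter} (h : Valid (p ++ x :: s)) :
    act 1 p x.ceil < act 1 p (x.ceil + 1) := by
  have := h.asc
  simp only [unprimeWord, List.map_append, List.map_cons, asc_append, Asc] at this
  exact this.2.1

theorem Valid.fix_at {p s : PWord} {x : Letter} (h : Valid (p ++ x :: s))
    (hx : x.primed = true) : Fix2 (act 1 p) x.ceil := by
  have := h.primesOK
  rw [primesOK_append] at this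
  exact this.2.1 hx

theorem act_snoc (y : Equiv.Perm ℤ) (p : PWord) (x : Letter) :
    act y (p ++ [x]) = twist (act y p) x.ceil := by rw [act_append]; rfl

theorem one_act_invol (p : PWord) : act 1 p * act 1 p = 1 := act_invol (one_mul _) p

theorem Valid.ne_of_adjacent {p s : PWord} {x y : Letter} (h : Valid (p ++ x :: y :: s)) :
    x.ceil ≠ y.ceil := by
  intro e
  have h1 := h.asc_at
  have h2 : Valid ((p ++ [x]) ++ y :: s) := by simpa using h
  have h3 := h2.asc_at
  rw [act_snoc, ← e] at h3
  have := (inver_twist_self (one_act_invol p) h1).2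
  omega

/-- A factor `m M w` with `⌈m⌉ = ⌈w⌉ < ⌈M⌉` is a braid. -/
theorem Valid.braid {p s : PWord} {m M w : Letter} (h : Valid (p ++ m :: M :: w :: s))
    (e : m.ceil = w.ceil) (hM : m.ceil < M.ceil) :
    M.ceil = m.ceil + 1 ∧ M.primed = false ∧ (m.primed = false ∨ w.primed = false) := by
  have hy := one_act_invol p
  have h1 : act 1 p m.ceil < act 1 p (m.ceil + 1) := h.asc_at
  have v2 : Valid ((p ++ [m]) ++ M :: w :: s) := by simpa using h
  have v3 : Valid ((p ++ [m, M]) ++ w :: s) := by simpa using h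
  have h2 := v2.asc_at
  have h3 := v3.asc_at
  have e3 : act 1 (p ++ [m, M]) = twist (twist (act 1 p) m.ceil) M.ceil := by
    rw [act_append]; rfl
  rw [act_snoc] at h2
  rw [e3, ← e] at h3
  have h1' := inver_twist_self hy h1
  have c1 : M.ceil = m.ceil + 1 := by
    by_contra hne
    have h4 := Inver.twist (twist_invol hy _) h2 h1'
    rw [sPerm_of_ne (by omega) (by omega), sPerm_of_ne (by omega) (by omega)] at h4
    have := h4.2
    omega
  refine ⟨c1, ?_, ?_⟩
  · by_contra hp
    have f := v2.fix_at (by simpa using hp)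
    rw [act_snoc, c1] at f
    rw [c1, twist_apply_of_fixed (twist_invol hy _) f, twist_apply_of_fixed (twist_invol hy _) f,
      sPerm_left, f.2, sPerm_of_ne (by omega) (by omega)] at h3
    have i1 := h1'.2
    rw [f.1] at i1
    omega
  · by_contra hp
    rw [not_or] at hp
    have f1 := h.fix_at (by simpa using hp.1)
    have f2 := (v3.fix_at (by simpa using hp.2)).1
    rw [e3, ← e, c1] at f2
    rw [c1] at h2
    have a1 := twist_apply_of_fixed hy f1
    have n1 : ¬ Fix2 (twist (act 1 p) m.ceil) (m.ceil + 1) := by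
      intro hf
      have := hf.1
      rw [a1, sPerm_right, f1.1] at this
      omega
    have g : sPerm (m.ceil + 1) m.ceil = m.ceil := sPerm_of_ne (by omega) (by omega)
    rw [twist_apply_of_not_fixed (twist_invol hy _) h2 n1, g, a1,
      sPerm_left, f1.2, sPerm_left] at f2
    omega

theorem twist_apply_eq_self_iff {y : Equiv.Perm ℤ} (hy : y * y = 1) {i k : ℤ} (h : k < i) :
    twist y i k = k ↔ y k = k := by
  have g : sPerm i k = k := sPerm_of_ne (by omega) (by omega)
  by_cases h1 : y i < y (i + 1)
  · by_cases h2 : Fix2 y i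
    · rw [twist_apply_of_fixed hy h2, g]
    · rw [twist_apply_of_not_fixed hy h1 h2, g]
      constructor
      · intro e
        have := congrArg (sPerm i) e
        rwa [sPerm_sPerm, g] at this
      · intro e
        rw [e, g]
  · rw [twist_desc hy h1]

theorem act_apply_eq_self_iff {y : Equiv.Perm ℤ} (hy : y * y = 1) {k : ℤ} {p : PWord}
    (h : ∀ x ∈ p, k < x.ceil) : act y p k = k ↔ y k = k := by
  induction p generalizing y with
  | nil => rfl
  | cons x p ih =>
    rw [act_cons, ih (twist_invol hy _) fun a ha => h a (List.mem_cons_of_mem _ ha),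
      twist_apply_eq_self_iff hy (h x List.mem_cons_self)]

theorem one_act_apply_self {k : ℤ} {p : PWord} (h : ∀ x ∈ p, k < x.ceil) : act 1 p k = k :=
  (act_apply_eq_self_iff (one_mul 1) h).2 rfl

/-- A smallest letter occurring twice is unprimed at its second occurrence. -/
theorem Valid.unprimed_of_repeat {p q s : PWord} {x w : Letter}
    (h : Valid (p ++ x :: q ++ w :: s)) (hp : ∀ a ∈ p, x.ceil + 1 < a.ceil)
    (hq : ∀ a ∈ q, x.ceil < a.ceil) (hw : w.ceil = x.ceil) : w.primed = false := by
  by_contra hw'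
  have f := (h.fix_at (by simpa using hw')).1
  have f1 : Fix2 (act 1 p) x.ceil :=
    ⟨one_act_apply_self fun a ha => by have := hp a ha; omega,
      one_act_apply_self fun a ha => by have := hp a ha; omega⟩
  rw [act_append, act_cons, hw,
    act_apply_eq_self_iff (twist_invol (one_act_invol p) _) hq,
    twist_apply_of_fixed (one_act_invol p) f1, sPerm_left, f1.2] at f
  omega

/-! ### Entries of shifted tableaux -/

theorem entry?_of_lt {T : STab} {r c : ℕ} (h : c < r) : entry? T r c = none := by
  simp [entry?, entryG?, Nat.not_le.2 h]

theorem entry?_of_le {T : STab} {r c : ℕ} (h : r ≤ c) :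
    entry? T r c = (T.getD r [])[c - r]? := by
  simp only [entry?, entryG?, if_pos h, List.getD_eq_getElem?_getD]
  cases T[r]? <;> simp

theorem entry?_add (T : STab) (r k : ℕ) : entry? T r (r + k) = (T.getD r [])[k]? := by
  rw [entry?_of_le (by omega)]
  congr 1
  omega

theorem entry?_of_length_le {T : STab} {r : ℕ} (h : T.length ≤ r) (c : ℕ) :
    entry? T r c = none := by
  unfold entry? entryG?
  rw [List.getElem?_eq_none h]
  simp

theorem entry?_isSome_le {T : STab} {r c : ℕ} {x : Letter} (h : entry? T r c = some x) : r ≤ c := by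
  by_contra h'
  rw [entry?_of_lt (by omega)] at h
  cases h

theorem entry?_cons_zero (R : List Letter) (T : STab) (c : ℕ) : entry? (R :: T) 0 c = R[c]? := by
  simp [entry?, entryG?]

theorem entry?_cons_succ (R : List Letter) (T : STab) (r c : ℕ) :
    entry? (R :: T) (r + 1) (c + 1) = entry? T r c := by
  simp [entry?, entryG?]

/-- A tableau of shifted shape, with unprimed diagonal, whose rows and columns strictly increase
after all primes are removed. -/
structure Good (T : STab) : Prop where
  ne : ∀ R ∈ T, R ≠ []
  dn : ∀ r c, entry? T r c = none → entry? T (r + 1) c = none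
  row : ∀ r c x y, entry? T r c = some x → entry? T r (c + 1) = some y → x.ceil < y.ceil
  col : ∀ r c x y, entry? T r c = some x → entry? T (r + 1) c = some y → x.ceil < y.ceil
  diag : ∀ r x, entry? T r r = some x → x.primed = false

theorem entry?_none_of_lt {T : STab} {r c c' : ℕ} (hr : r ≤ c) (h : entry? T r c = none)
    (hc : c ≤ c') : entry? T r c' = none := by
  rw [entry?_of_le hr, List.getElem?_eq_none_iff] at h
  rw [entry?_of_le (by omega), List.getElem?_eq_none_iff]
  omega

theorem Good.dn_of_le {T : STab} (hT : Good T) {r r' c : ℕ} (h : entry? T r c = none)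
    (hr : r ≤ r') : entry? T r' c = none := by
  induction r', hr using Nat.le_induction with
  | base => exact h
  | succ n _ ih => exact hT.dn _ _ ih

theorem Good.row_lt {T : STab} (hT : Good T) {r c c' : ℕ} {x y : Letter}
    (hx : entry? T r c = some x) (hy : entry? T r c' = some y) (hc : c < c') :
    x.ceil < y.ceil := by
  have hr := entry?_isSome_le hx
  induction c', hc using Nat.le_induction generalizing y with
  | base => exact hT.row _ _ _ _ hx hy
  | succ n hn ih =>
    cases h : entry? T r n with
    | none =>
      rw [entry?_none_of_lt (by omega) h (Nat.le_succ n)] at hy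
      cases hy
    | some z => exact (ih h).trans (hT.row _ _ _ _ h hy)

theorem Good.col_lt {T : STab} (hT : Good T) {r r' c : ℕ} {x y : Letter}
    (hx : entry? T r c = some x) (hy : entry? T r' c = some y) (hr : r < r') :
    x.ceil < y.ceil := by
  induction r', hr using Nat.le_induction generalizing y with
  | base => exact hT.col _ _ _ _ hx hy
  | succ n hn ih =>
    cases h : entry? T n c with
    | none =>
      rw [hT.dn _ _ h] at hy
      cases hy
    | some z => exact (ih h).trans (hT.col _ _ _ _ h hy)

theorem Good.of_cons {R : List Letter} {T : STab} (h : Good (R :: T)) : Good T where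
  ne R' hR' := h.ne R' (List.mem_cons_of_mem _ hR')
  dn r c h' := by
    have := h.dn (r + 1) (c + 1)
    rw [entry?_cons_succ, entry?_cons_succ] at this
    exact this h'
  row r c x y hx hy := h.row (r + 1) (c + 1) x y (by rwa [entry?_cons_succ])
    (by rwa [entry?_cons_succ])
  col r c x y hx hy := h.col (r + 1) (c + 1) x y (by rwa [entry?_cons_succ])
    (by rwa [entry?_cons_succ])
  diag r x hx := h.diag (r + 1) x (by rwa [entry?_cons_succ])

theorem Good.incr_row {T : STab} (hT : Good T) {R : List Letter} (hR : R ∈ T) :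
    Incr false R := by
  obtain ⟨r, hr, rfl⟩ := List.getElem_of_mem hR
  refine List.pairwise_iff_getElem.2 fun i j hi hj hij => ?_
  have e : ∀ k (hk : k < T[r].length), entry? T r (r + k) = some T[r][k] := by
    intro k hk
    rw [entry?_add, List.getD_eq_getElem _ _ hr, List.getElem?_eq_getElem hk]
  exact hT.row_lt (e i hi) (e j hj) (by omega)

/-- `T'` is obtained from `T` by writing `x` in the box `(r, c)`. -/
structure Upd (T T' : STab) (r c : ℕ) (x : Letter) : Prop where
  ne : ∀ R ∈ T', R ≠ []
  entry : ∀ r' c', entry? T' r' c' = if r' = r ∧ c' = c then some x else entry? T r' c'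

theorem Upd.good {T T' : STab} {r c : ℕ} {x : Letter} (hT : Good T) (h : Upd T T' r c x)
    (left : ∀ c' y, c = c' + 1 → entry? T r c' = some y → y.ceil < x.ceil)
    (right : ∀ y, entry? T r (c + 1) = some y → x.ceil < y.ceil)
    (below : ∀ r', r = r' + 1 → ∃ y, entry? T r' c = some y ∧ y.ceil < x.ceil)
    (above : ∀ y, entry? T (r + 1) c = some y → x.ceil < y.ceil)
    (hd : r = c → x.primed = false) : Good T' where
  ne := h.ne
  dn r' c' := by
    rw [h.entry, h.entry]
    split_ifs with h1 h2 h2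
    · simp
    · simp
    · intro h3
      obtain ⟨y, hy, _⟩ := below r' h2.1.symm
      rw [← h2.2, h3] at hy
      cases hy
    · exact hT.dn r' c'
  row r' c' a b := by
    rw [h.entry, h.entry]
    split_ifs with h1 h2 h2
    · omega
    · rintro ⟨⟩ h3
      rw [h1.1, h1.2] at h3
      exact right _ h3
    · rintro h3 ⟨⟩
      rw [h2.1] at h3
      exact left _ _ h2.2.symm h3
    · exact hT.row r' c' a b
  col r' c' a b := by
    rw [h.entry, h.entry]
    split_ifs with h1 h2 h2
    · omega
    · rintro ⟨⟩ h3
      rw [h1.1, h1.2] at h3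
      exact above _ h3
    · rintro h3 ⟨⟩
      obtain ⟨y, hy, hlt⟩ := below r' h2.1.symm
      rw [← h2.2, h3] at hy
      cases hy
      exact hlt
    · exact hT.col r' c' a b
  diag r' a := by
    rw [h.entry]
    split_ifs with h1
    · rintro ⟨⟩
      exact hd (by omega)
    · exact hT.diag r' a

/-- Changing the prime of an existing off-diagonal entry. -/
theorem Upd.good_of_ceil {T T' : STab} {r c : ℕ} {x y : Letter} (hT : Good T)
    (h : Upd T T' r c x) (hy : entry? T r c = some y) (hxy : y.ceil = x.ceil)
    (hd : r = c → x.primed = false) : Good T' := by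
  refine h.good hT ?_ ?_ ?_ ?_ hd
  · rintro c' z rfl hz
    rw [← hxy]
    exact hT.row _ _ _ _ hz hy
  · intro z hz
    rw [← hxy]
    exact hT.row _ _ _ _ hy hz
  · rintro r' rfl
    cases h : entry? T r' c with
    | none => rw [hT.dn _ _ h] at hy; cases hy
    | some z => exact ⟨z, rfl, hxy ▸ hT.col _ _ _ _ h hy⟩
  · intro z hz
    rw [← hxy]
    exact hT.col _ _ _ _ hy hz

/-! ### Columns -/

theorem contiguous_filterMap {α β : Type*} (f : ℕ → Option α) (g : ℕ → α → β)
    (hf : ∀ i, f i = none → f (i + 1) = none) (n i : ℕ) :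
    ((List.range n).filterMap fun r => (f r).map (g r))[i]? =
      if i < n then (f i).map (g i) else none := by
  have hf' : ∀ i j, i ≤ j → f i = none → f j = none := by
    intro i j hij h
    induction j, hij using Nat.le_induction with
    | base => exact h
    | succ j _ ih => exact hf j ih
  induction n generalizing i with
  | zero => simp
  | succ n ih =>
    rw [List.range_succ, List.filterMap_append]
    cases h : f n with
    | none =>
      have e : ([n].filterMap fun r => (f r).map (g r)) = [] := by simp [h]
      rw [e, List.append_nil, ih]
      split_ifs with h1 h2 h2
      · rfl
      · omega
      · obtain rfl : i = n := by omega
        simp [h]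
      · rfl
    | some y =>
      have e : ([n].filterMap fun r => (f r).map (g r)) = [g n y] := by simp [h]
      have hlen : ((List.range n).filterMap fun r => (f r).map (g r)).length = n := by
        apply le_antisymm
        · have := ih n
          rw [if_neg (lt_irrefl n), List.getElem?_eq_none_iff] at this
          exact this
        · by_contra hlt
          have := ih (n - 1)
          rw [if_pos (by omega), List.getElem?_eq_none (by omega)] at this
          have h2 : f (n - 1) = none := by simpa using this.symm
          rw [hf' _ _ (by omega) h2] at h
          cases h
      rw [e, List.getElem?_append, hlen]
      split_ifs with h1 h2 h2
      · rw [ih, if_pos h1]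
      · omega
      · obtain rfl : i = n := by omega
        simp [h]
      · rw [List.getElem?_eq_none]
        simp
        omega

theorem Good.getElem?_colLetters {T : STab} (hT : Good T) (c i : ℕ) :
    (colLetters T c)[i]? = entry? T i c := by
  have := contiguous_filterMap (fun r => entry? T r c) (fun _ x => x) (fun i => hT.dn i c)
    (c + 1) i
  simp only [Option.map_id'] at this
  unfold colLetters
  rw [this]
  split_ifs with h
  · rfl
  · exact (entry?_of_lt (by omega)).symm

/-- The list of boxes of a column that `egCol` works with. -/
abbrev colOcc (T : STab) (c : ℕ) : List (ℕ × Letter) :=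
  (List.range (c + 1)).filterMap fun r => (entry? T r c).map fun x => (r, x)

theorem Good.getElem?_colOcc {T : STab} (hT : Good T) (c i : ℕ) :
    (colOcc T c)[i]? = (entry? T i c).map fun x => (i, x) := by
  unfold colOcc
  rw [contiguous_filterMap (fun r => entry? T r c) (fun r x => (r, x)) (fun i => hT.dn i c)]
  split_ifs with h
  · rfl
  · rw [entry?_of_lt (by omega)]
    rfl

theorem colOcc_map_snd (T : STab) (c : ℕ) : (colOcc T c).map Prod.snd = colLetters T c := by
  simp [colOcc, colLetters, List.map_filterMap, Function.comp_def]

theorem Good.incr_col {T : STab} (hT : Good T) (c : ℕ) : Incr false (colLetters T c) := by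
  refine List.pairwise_iff_getElem.2 fun i j hi hj hij => ?_
  have e : ∀ k (hk : k < (colLetters T c).length),
      entry? T k c = some (colLetters T c)[k] := by
    intro k hk
    rw [← hT.getElem?_colLetters, List.getElem?_eq_getElem hk]
  exact hT.col_lt (e i hi) (e j hj) hij

/-! ### Row words and column words -/

theorem rowWord_append (S T : STab) : rowWord (S ++ T) = rowWord T ++ rowWord S := by
  simp [rowWord]

theorem rowWord_cons (R : List Letter) (T : STab) : rowWord (R :: T) = rowWord T ++ R := by
  simp [rowWord]

theorem rowWord_nil : rowWord [] = [] := rfl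

/-- The word of the column `c` of `T` read downwards, from row `c + b - 1`: the full column for
`b = 1` and its off-diagonal part for `b = 0`. -/
def colFrom (b : ℕ) (T : STab) (c : ℕ) : PWord :=
  ((List.range (c + b)).filterMap fun r => entry? T r c).reverse

theorem colFrom_one (T : STab) (c : ℕ) : colFrom 1 T c = (colLetters T c).reverse := rfl

theorem colFrom_cons_zero (b : ℕ) (R : List Letter) (T : STab) :
    colFrom (b + 1) (R :: T) 0 = (R.take 1) := by
  have : ((List.range b).filterMap fun r => entry? (R :: T) (r + 1) 0) = [] := by
    rw [List.filterMap_eq_nil_iff]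
    intro r _
    exact entry?_of_lt (Nat.succ_pos r)
  unfold colFrom
  rw [Nat.zero_add, List.range_succ_eq_map, List.filterMap_cons, entry?_cons_zero,
    List.filterMap_map]
  cases R <;> simp [this]

theorem colFrom_zero_zero (T : STab) : colFrom 0 T 0 = [] := rfl

theorem colFrom_cons_succ (b : ℕ) (R : List Letter) (T : STab) (c : ℕ) :
    colFrom b (R :: T) (c + 1) = colFrom b T c ++ R[c + 1]?.toList := by
  unfold colFrom
  rw [show c + 1 + b = (c + b) + 1 by omega, List.range_succ_eq_map, List.filterMap_cons,
    entry?_cons_zero, List.filterMap_map]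
  have : (fun r => entry? (R :: T) r (c + 1)) ∘ Nat.succ = fun r => entry? T r c := by
    funext r
    exact entry?_cons_succ R T r c
  rw [this]
  cases R[c + 1]? <;> simp

theorem mem_colFrom {b : ℕ} {T : STab} {c : ℕ} {x : Letter} (h : x ∈ colFrom b T c) :
    ∃ r, r < c + b ∧ entry? T r c = some x := by
  simpa [colFrom] using h

/-- A row can be distributed over the columns above it. -/
theorem knuth_distribute (L : List (PWord × Letter)) (hh : ∀ b ∈ L, Decr false (b.1 ++ [b.2]))
    (hF : Incr false (L.map Prod.snd)) :
    Knuth (L.flatMap Prod.fst ++ L.map Prod.snd) (L.flatMap fun b => b.1 ++ [b.2]) := by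
  induction L using List.reverseRecOn with
  | nil => exact Knuth.refl _
  | append_singleton L b ih =>
    have h1 := ih (fun a ha => hh a (by simp [ha])) (by
      rw [List.map_append, incr_append] at hF
      exact hF.1)
    have h2 := (knuth_slide_word (hh b (by simp)) (F := L.map Prod.snd) (by simpa using hF)
      []).append_left (L.flatMap Prod.fst)
    have h3 := h1.append_right (b.1 ++ [b.2])
    simp only [List.flatMap_append, List.map_append, List.append_assoc, List.flatMap_singleton,
      List.map_cons, List.map_nil] at h2 h3 ⊢
    exact h2.trans h3

/-- All boxes of `T` lie in columns `< N`. -/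
def ColBound (T : STab) (N : ℕ) : Prop := ∀ r c, N ≤ c → entry? T r c = none

theorem ColBound.mono {T : STab} {N N' : ℕ} (h : ColBound T N) (hN : N ≤ N') : ColBound T N' :=
  fun r c hc => h r c (hN.trans hc)

theorem colFrom_eq_nil {b : ℕ} {T : STab} {N c : ℕ} (h : ColBound T N) (hc : N ≤ c) :
    colFrom b T c = [] := by
  unfold colFrom
  rw [List.filterMap_eq_nil_iff.2 fun r _ => h r c hc]
  rfl

theorem flatMap_colFrom_of_le {b : ℕ} {T : STab} {N N' : ℕ} (h : ColBound T N) (hN : N ≤ N') :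
    (List.range N').flatMap (colFrom b T) = (List.range N).flatMap (colFrom b T) := by
  induction N', hN using Nat.le_induction with
  | base => rfl
  | succ n hn ih =>
    rw [List.range_succ, List.flatMap_append, ih, List.flatMap_singleton, colFrom_eq_nil h hn,
      List.append_nil]

theorem Good.decr_colFrom {T : STab} (hT : Good T) (b c : ℕ) : Decr false (colFrom b T c) := by
  unfold colFrom
  unfold Decr
  rw [List.pairwise_reverse, List.pairwise_filterMap]
  refine List.pairwise_lt_range.imp fun {i j} hij x hx y hy => ?_
  exact hT.col_lt hx hy hij

theorem Good.colBound_of_cons {R : List Letter} {T : STab} (hT : Good (R :: T)) :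
    ColBound T (R.length - 1) := by
  intro r c hc
  have h1 := hT.dn_of_le (r := 0) (r' := r + 1) (c := c + 1)
    (by rw [entry?_cons_zero, List.getElem?_eq_none]; omega) (Nat.zero_le _)
  rwa [entry?_cons_succ] at h1

theorem flatMap_colFrom_eq {b : ℕ} {T : STab} {N N' : ℕ} (h : ColBound T N)
    (h' : ColBound T N') :
    (List.range N).flatMap (colFrom b T) = (List.range N').flatMap (colFrom b T) := by
  rw [← flatMap_colFrom_of_le h (le_max_left N N'), flatMap_colFrom_of_le h' (le_max_right N N')]

theorem colBound_nil : ColBound [] 0 := fun _ _ _ => entry?_of_length_le (Nat.zero_le _) _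

theorem Good.colBound_cons {R : List Letter} {T : STab} (hT : Good (R :: T)) :
    ColBound (R :: T) R.length := fun r c hc =>
  hT.dn_of_le (r := 0) (by rw [entry?_cons_zero, List.getElem?_eq_none hc]) (Nat.zero_le r)

/-- The off-diagonal entries of the first row, each preceded by the part of its column above. -/
def colPairs (b : ℕ) (R : List Letter) (T : STab) : List (PWord × Letter) :=
  (List.range (R.length - 1)).map fun c => (colFrom b T c, R.getD (c + 1) default)

theorem colPairs_flatMap_fst (b : ℕ) (R : List Letter) (T : STab) :
    (colPairs b R T).flatMap Prod.fst = (List.range (R.length - 1)).flatMap (colFrom b T) := by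
  simp [colPairs, List.flatMap_map]

theorem colPairs_map_snd (b : ℕ) (R : List Letter) (T : STab) :
    (colPairs b R T).map Prod.snd = R.tail := by
  apply List.ext_getElem (by simp [colPairs])
  intro i h1 h2
  have : i + 1 < R.length := by simp at h2; omega
  simp [colPairs, List.getD_eq_getElem?_getD, this]

theorem colPairs_elem {b : ℕ} {R : List Letter} {T : STab} {c : ℕ} (hc : c < R.length - 1) :
    colFrom b (R :: T) (c + 1) = colFrom b T c ++ [R.getD (c + 1) default] := by
  simp [colFrom_cons_succ, List.getD_eq_getElem?_getD,
    List.getElem?_eq_getElem (show c + 1 < R.length by omega)]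

theorem flatMap_colFrom_cons {R : List Letter} (hR : R ≠ []) (b : ℕ) (T : STab) :
    (List.range R.length).flatMap (colFrom b (R :: T)) =
      colFrom b (R :: T) 0 ++ (colPairs b R T).flatMap fun p => p.1 ++ [p.2] := by
  have : R.length = (R.length - 1) + 1 := by
    have := List.length_pos_of_ne_nil hR
    omega
  rw [this, List.range_succ_eq_map, List.flatMap_cons, List.flatMap_map, colPairs,
    List.flatMap_map]
  congr 1
  refine List.flatMap_congr fun c hc => ?_
  rw [List.mem_range] at hc
  exact colPairs_elem (by omega)

theorem Good.decr_colPairs {R : List Letter} {T : STab} (hT : Good (R :: T)) (b : ℕ) :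
    ∀ p ∈ colPairs b R T, Decr false (p.1 ++ [p.2]) := by
  intro p hp
  simp only [colPairs, List.mem_map, List.mem_range] at hp
  obtain ⟨c, hc, rfl⟩ := hp
  rw [← colPairs_elem hc]
  exact hT.decr_colFrom b _

theorem knuth_cols_tail {T : STab} (hT : Good T) {N : ℕ} (hN : ColBound T N) :
    Knuth (rowWord (T.map List.tail)) ((List.range N).flatMap (colFrom 0 T)) := by
  induction T generalizing N with
  | nil =>
    rw [flatMap_colFrom_eq hN colBound_nil]
    exact Knuth.refl _
  | cons R T ih =>
    rw [flatMap_colFrom_eq hN hT.colBound_cons,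
      flatMap_colFrom_cons (hT.ne R List.mem_cons_self), colFrom_zero_zero, List.nil_append,
      List.map_cons, rowWord_cons]
    have h1 := (ih hT.of_cons (Good.colBound_of_cons hT)).append_right R.tail
    have h2 := knuth_distribute (colPairs 0 R T) (hT.decr_colPairs 0) (by
      rw [colPairs_map_snd]
      exact (hT.incr_row List.mem_cons_self).sublist (List.tail_sublist R))
    rw [colPairs_map_snd, colPairs_flatMap_fst] at h2
    exact h1.trans h2

/-- The row word of a tableau is Coxeter–Knuth equivalent to its column word. -/
theorem knuth_cols {T : STab} (hT : Good T) {N : ℕ} (hN : ColBound T N) :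
    Knuth (rowWord T) ((List.range N).flatMap (colFrom 1 T)) := by
  induction T generalizing N with
  | nil =>
    rw [flatMap_colFrom_eq hN colBound_nil]
    exact Knuth.refl _
  | cons R T ih =>
    obtain ⟨x, B, rfl⟩ := List.exists_cons_of_ne_nil (hT.ne R List.mem_cons_self)
    rw [flatMap_colFrom_eq hN hT.colBound_cons, flatMap_colFrom_cons (List.cons_ne_nil x B),
      colFrom_cons_zero, rowWord_cons]
    have h1 := (ih hT.of_cons (Good.colBound_of_cons hT)).append_right (x :: B)
    have h3 := knuth_distribute (([], x) :: colPairs 1 (x :: B) T) (by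
      intro p hp
      rcases List.mem_cons.1 hp with rfl | hp
      · simp
      · exact hT.decr_colPairs 1 p hp) (by
      rw [List.map_cons, colPairs_map_snd]
      exact hT.incr_row List.mem_cons_self)
    rw [List.map_cons, colPairs_map_snd, List.flatMap_cons, List.flatMap_cons,
      colPairs_flatMap_fst] at h3
    exact h1.trans h3

/-! ### From row insertion to column insertion -/

/-- The main diagonal of a tableau. -/
def diagList (T : STab) : PWord := T.map fun R => R.headD default

theorem Good.entry_diag {T : STab} (hT : Good T) {i : ℕ} (hi : i < (diagList T).length) :
    entry? T i i = some (diagList T)[i] := by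
  have hi' : i < T.length := by simpa [diagList] using hi
  have h := entry?_add T i 0
  rw [Nat.add_zero] at h
  rw [h, List.getD_eq_getElem _ _ hi']
  have := hT.ne T[i] (List.getElem_mem hi')
  obtain ⟨x, B, e⟩ := List.exists_cons_of_ne_nil this
  simp [diagList, e]

theorem Good.diag_lt {T : STab} (hT : Good T) {i j : ℕ} {x y : Letter} (hij : i < j)
    (hx : entry? T i i = some x) (hy : entry? T j j = some y) : x.ceil < y.ceil := by
  cases h : entry? T i j with
  | none =>
    rw [hT.dn_of_le h hij.le] at hy
    cases hy
  | some z => exact (hT.row_lt hx h hij).trans (hT.col_lt h hy hij)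

theorem Good.incr_diagList {T : STab} (hT : Good T) : Incr false (diagList T) :=
  List.pairwise_iff_getElem.2 fun _ _ hi hj hij =>
    hT.diag_lt hij (hT.entry_diag hi) (hT.entry_diag hj)

theorem Good.diagList_unprimed {T : STab} (hT : Good T) : ∀ x ∈ diagList T, x.primed = false := by
  intro x hx
  obtain ⟨i, hi, rfl⟩ := List.getElem_of_mem hx
  exact hT.diag _ _ (hT.entry_diag hi)

/-- The rows of a tableau from top to bottom, split for `knuth_gather`. -/
def rowBlocks (T : STab) : List (PWord × Letter × PWord) :=
  T.reverse.map fun R => ([], R.headD default, R.tail)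

theorem rowBlocks_word {T : STab} (hT : ∀ R ∈ T, R ≠ []) :
    ((rowBlocks T).flatMap fun b => b.1 ++ b.2.1 :: b.2.2) = rowWord T := by
  rw [rowBlocks, List.flatMap_map, rowWord, List.flatMap_def]
  congr 1
  conv_rhs => rw [← List.map_id T.reverse]
  refine List.map_congr_left fun R hR => ?_
  obtain ⟨x, B, rfl⟩ := List.exists_cons_of_ne_nil (hT R (List.mem_reverse.1 hR))
  rfl

theorem rowBlocks_heads (T : STab) :
    ((rowBlocks T).flatMap fun b => b.1 ++ [b.2.1]) = (diagList T).reverse := by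
  rw [rowBlocks, List.flatMap_map, diagList, ← List.map_reverse]
  exact (List.map_eq_flatMap ..).symm

theorem rowBlocks_tails (T : STab) :
    ((rowBlocks T).flatMap fun b => b.2.2) = rowWord (T.map List.tail) := by
  rw [rowBlocks, List.flatMap_map, rowWord, ← List.map_reverse, List.flatMap_def]

theorem colFrom_one_of_diag {T : STab} {c : ℕ} {x : Letter} (h : entry? T c c = some x) :
    colFrom 1 T c = x :: colFrom 0 T c := by
  simp [colFrom, List.range_succ, List.filterMap_append, h]

theorem colFrom_one_of_none {T : STab} {c : ℕ} (h : entry? T c c = none) :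
    colFrom 1 T c = colFrom 0 T c := by
  simp [colFrom, List.range_succ, List.filterMap_append, h]

/-- A diagonal entry together with the part of its column below, split for `knuth_gather`. -/
def colBlock (T : STab) (c : ℕ) : PWord × Letter × PWord :=
  ([], (diagList T).getD c default, colFrom 0 T c)

theorem Good.colBlock_eq {T : STab} (hT : Good T) {c : ℕ} (hc : c < T.length) :
    (colBlock T c).2.1 :: (colBlock T c).2.2 = colFrom 1 T c := by
  have hi : c < (diagList T).length := by simpa [diagList] using hc
  rw [colFrom_one_of_diag (hT.entry_diag hi), colBlock, List.getD_eq_getElem _ _ hi]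

theorem diagList_eq (T : STab) (a l : ℕ) (h : a + l ≤ T.length) :
    ((List.range' a l).flatMap fun c => (colBlock T c).1 ++ [(colBlock T c).2.1]) =
      ((diagList T).drop a).take l := by
  have : ∀ c, (colBlock T c).1 ++ [(colBlock T c).2.1] = [(diagList T).getD c default] :=
    fun c => rfl
  simp only [this]
  rw [← List.map_eq_flatMap]
  apply List.ext_getElem
  · simp [diagList]; omega
  · intro i h1 h2
    have : a + i < (diagList T).length := by simp [diagList] at *; omega
    simp [List.getD_eq_getElem?_getD, this]

theorem incr_true_iff {l : PWord} : Incr true l ↔ Decr false l := by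
  simp [Incr, Decr, key]

theorem decr_true_iff {l : PWord} : Decr true l ↔ Incr false l := by
  simp [Incr, Decr, key]

/-- Pulling a letter next to the diagonal box of row `r` turns a row word into a column word
interrupted by that letter, possibly moving a prime. -/
theorem ockEquiv_diag {pre post : STab} {x : Letter} {B : PWord} {v : ℤ} {p : Bool} {M : ℕ}
    (hT : Good (pre ++ (x :: B) :: post))
    (hM : ColBound (pre ++ (x :: B) :: post) (pre.length + 1 + M))
    (hxv : x.ceil < v) (hv : ∀ y ∈ diagList post, v < y.ceil) :
    OckEquiv (rowWord post ++ ⟨v, false⟩ :: ⟨x.ceil, p⟩ :: B ++ rowWord pre)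
      ((List.range (pre.length + 1)).flatMap (colFrom 1 (pre ++ (x :: B) :: post)) ++
        ⟨v, p⟩ :: (List.range' (pre.length + 1) M).flatMap
          (colFrom 1 (pre ++ (x :: B) :: post))) := by
  set T := pre ++ (x :: B) :: post with hTdef
  have hdl : diagList T = diagList pre ++ x :: diagList post := by simp [hTdef, diagList]
  have hinc := hT.incr_diagList
  have hunp := hT.diagList_unprimed
  rw [hdl] at hinc hunp
  have hinc2 : Incr false (diagList pre ++ x :: ⟨v, p⟩ :: diagList post) := by
    rw [incr_append, incr_cons] at hinc ⊢
    rw [incr_cons]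
    obtain ⟨h1, ⟨h2, h3⟩, h4⟩ := hinc
    refine ⟨h1, ⟨?_, ⟨fun y hy => hv y hy, h3⟩⟩, ?_⟩
    · intro y hy
      rcases List.mem_cons.1 hy with rfl | hy
      · exact hxv
      · exact h2 y hy
    · intro a ha y hy
      have h5 := h4 a ha x List.mem_cons_self
      rcases List.mem_cons.1 hy with rfl | hy
      · exact h5
      rcases List.mem_cons.1 hy with rfl | hy
      · exact lt_trans h5 hxv
      · exact h4 a ha y (List.mem_cons_of_mem _ hy)
  have hxp : x.primed = false := hunp x (by simp)
  have hdec : Decr false ((diagList post).reverse ++ ⟨v, false⟩ :: ⟨x.ceil, p⟩ ::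
      (diagList pre).reverse) := by
    have h1 : Incr false (diagList pre ++ ⟨x.ceil, p⟩ :: ⟨v, false⟩ :: diagList post) := by
      have h2 := List.pairwise_map.2 hinc2
      have h3 : (diagList pre ++ x :: ⟨v, p⟩ :: diagList post).map (key false) =
          (diagList pre ++ ⟨x.ceil, p⟩ :: ⟨v, false⟩ :: diagList post).map (key false) := by
        simp [key]
      rw [h3] at h2
      exact List.pairwise_map.1 h2
    have := List.pairwise_reverse.2 h1
    simpa using this
  have ne1 : ∀ R ∈ pre, R ≠ [] := fun R hR => hT.ne R (by simp [hTdef, hR])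
  have ne2 : ∀ R ∈ post, R ≠ [] := fun R hR => hT.ne R (by simp [hTdef, hR])
  -- gather the diagonal
  have s1 := knuth_gather (dual := false)
    (rowBlocks post ++ [([⟨v, false⟩], ⟨x.ceil, p⟩, B)] ++ rowBlocks pre) (by
      simp only [List.flatMap_append, rowBlocks_heads, List.flatMap_singleton]
      simpa using hdec) (by
      have hrow : ∀ R ∈ T, Incr false (R.headD default :: R.tail) := by
        intro R hR
        obtain ⟨y, C, rfl⟩ := List.exists_cons_of_ne_nil (hT.ne R hR)
        exact hT.incr_row hR
      intro b hb
      simp only [List.mem_append, List.mem_singleton, rowBlocks, List.mem_map,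
        List.mem_reverse] at hb
      rcases hb with (⟨R, hR, rfl⟩ | rfl) | ⟨R, hR, rfl⟩
      · exact hrow R (by simp [hTdef, hR])
      · have := hrow (x :: B) (by simp [hTdef])
        rw [incr_cons] at this ⊢
        exact this
      · exact hrow R (by simp [hTdef, hR]))
  simp only [List.flatMap_append, rowBlocks_heads, rowBlocks_tails, rowBlocks_word ne1,
    rowBlocks_word ne2, List.flatMap_singleton] at s1
  have htails : rowWord (post.map List.tail) ++ B ++ rowWord (pre.map List.tail) =
      rowWord (T.map List.tail) := by
    simp [hTdef, rowWord_append, rowWord_cons]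
  -- reverse the diagonal
  have s2 := ockEquiv_reverse_primed hdec (fun y hy => hunp y (by
    have := List.mem_reverse.1 hy
    simp [this])) rfl (fun y hy => hunp y (by
    have := List.mem_reverse.1 hy
    simp [this])) (rowWord (T.map List.tail))
  -- distribute the rows over the columns
  have s3 := (knuth_cols_tail hT hM).append_left (diagList pre ++ x :: ⟨v, p⟩ :: diagList post)
  -- put the diagonal back
  have hn : T.length = pre.length + 1 + post.length := by simp [hTdef]; omega
  have hx : entry? T pre.length pre.length = some x := by
    have := entry?_add T pre.length 0
    simpa [hTdef] using this
  have hoff : Incr true ((⟨v, p⟩ : Letter) :: colFrom 0 T pre.length) := by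
    rw [incr_true_iff, decr_cons]
    refine ⟨fun y hy => ?_, hT.decr_colFrom 0 _⟩
    obtain ⟨r, hr, hy⟩ := mem_colFrom hy
    exact (hT.col_lt hy hx (by omega)).trans hxv
  have hd1 := diagList_eq T 0 pre.length (by omega)
  have hd2 := diagList_eq T (pre.length + 1) post.length (by omega)
  have hl : (diagList pre).length = pre.length := by simp [diagList]
  have hl' : (diagList post).length = post.length := by simp [diagList]
  have e1 : ((diagList T).drop 0).take pre.length = diagList pre := by
    rw [hdl, ← hl]; simp
  have e2 : ((diagList T).drop (pre.length + 1)).take post.length = diagList post := by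
    rw [hdl, ← hl, ← hl', List.append_cons, List.drop_left' (by simp), List.take_length]
  rw [e1] at hd1
  rw [e2] at hd2
  have s4 := knuth_gather (dual := true)
    ((List.range' 0 pre.length).map (colBlock T) ++ [([x], ⟨v, p⟩, colFrom 0 T pre.length)] ++
      (List.range' (pre.length + 1) post.length).map (colBlock T)) (by
      simp only [List.flatMap_append, List.flatMap_map, hd1, hd2, List.flatMap_singleton]
      rw [decr_true_iff]
      simpa using hinc2) (by
      have hc : ∀ c < T.length, Incr true ((colBlock T c).2.1 :: (colBlock T c).2.2) := by
        intro c hc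
        rw [hT.colBlock_eq hc, incr_true_iff]
        exact hT.decr_colFrom 1 c
      intro b hb
      simp only [List.mem_append, List.mem_singleton, List.mem_map, List.mem_range'_1] at hb
      rcases hb with (⟨c, hc', rfl⟩ | rfl) | ⟨c, hc', rfl⟩
      · exact hc c (by omega)
      · exact hoff
      · exact hc c (by omega))
  have hlM : post.length ≤ M := by
    by_contra! hlt
    have h := hT.entry_diag (i := pre.length + post.length) (by simp [diagList, hn])
    rw [hM _ _ (by omega)] at h
    cases h
  have hblock : ∀ a l, a + l ≤ T.length →
      ((List.range' a l).flatMap fun c =>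
        (colBlock T c).1 ++ (colBlock T c).2.1 :: (colBlock T c).2.2) =
        (List.range' a l).flatMap (colFrom 1 T) := by
    intro a l hal
    refine List.flatMap_congr fun c hc => ?_
    rw [List.mem_range'_1] at hc
    rw [hT.colBlock_eq (by omega)]
    rfl
  have hrest : (List.range' (pre.length + 1 + post.length) (M - post.length)).flatMap
      (colFrom 1 T) = (List.range' (pre.length + 1 + post.length) (M - post.length)).flatMap
      (colFrom 0 T) := by
    refine List.flatMap_congr fun c hc => ?_
    rw [List.mem_range'_1] at hc
    exact colFrom_one_of_none (entry?_of_length_le (by omega) c)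
  have hsplit : List.range' (pre.length + 1) M = List.range' (pre.length + 1) post.length ++
      List.range' (pre.length + 1 + post.length) (M - post.length) := by
    rw [List.range'_append_1, Nat.add_sub_cancel' hlM]
  have hsplit' : List.range (pre.length + 1 + M) =
      List.range (pre.length + 1) ++ List.range' (pre.length + 1) M := by
    rw [List.range_eq_range', List.range_eq_range']
    have := (List.range'_append_1 (s := 0) (m := pre.length + 1) (n := M)).symm
    rwa [Nat.zero_add] at this
  simp only [List.flatMap_append, List.flatMap_map, hd1, hd2, List.flatMap_singleton,
    hblock 0 pre.length (by omega), hblock (pre.length + 1) post.length (by omega)] at s4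
  have s5 := s4.symm.append_right ((List.range' (pre.length + 1 + post.length)
    (M - post.length)).flatMap (colFrom 1 T))
  have hoff' : Incr true (x :: colFrom 0 T pre.length) := by
    rw [incr_true_iff, ← colFrom_one_of_diag hx]
    exact hT.decr_colFrom 1 _
  have s6 := ((knuth_slide_left (dual := true) (w := ⟨v, p⟩) (m := x)
    (B := colFrom 0 T pre.length) (by simpa [key] using hxv) hoff'
    ((List.range' (pre.length + 1) M).flatMap (colFrom 1 T))).symm).append_left
      ((List.range' 0 pre.length).flatMap (colFrom 1 T))
  have hcb : ∀ c, (colBlock T c).2.2 = colFrom 0 T c := fun _ => rfl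
  have hx' : x = ⟨x.ceil, false⟩ := hxp ▸ rfl
  rw [← htails] at s2 s3
  rw [hsplit', hsplit, List.flatMap_append, List.flatMap_append, ← hrest] at s3
  rw [hsplit, List.flatMap_append] at s6 ⊢
  simp only [hcb] at s5 s6
  have t1 := s1.ockEquiv.trans ((by simpa [← hx'] using s2 : OckEquiv _ _).trans s3.ockEquiv)
  have t2 := t1.trans ((by simpa [List.range_succ, List.range_eq_range'] using s5 :
    Knuth _ _).trans s6).ockEquiv
  simpa [colFrom_one_of_diag hx, List.range_succ, List.range_eq_range'] using t2

/-! ### Searching a line of a tableau -/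

/-- The three outcomes of inserting a letter of ceiling `v` into a strictly increasing line. -/
theorem Incr.line_cases {U : PWord} (hU : Incr false U) (v : ℤ) :
    (∀ x ∈ U, x.ceil ≤ v) ∨
    (∃ A M B, U = A ++ M :: B ∧ (∀ a ∈ A, a.ceil < v) ∧ v < M.ceil) ∨
    (∃ A m M B, U = A ++ m :: M :: B ∧ (∀ a ∈ A, a.ceil < v) ∧ m.ceil = v ∧ v < M.ceil) := by
  induction U with
  | nil => exact Or.inl (by simp)
  | cons x U ih =>
    rw [incr_cons] at hU
    obtain ⟨hx, hU⟩ := hU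
    rcases lt_trichotomy x.ceil v with h | h | h
    · rcases ih hU with h1 | ⟨A, M, B, rfl, hA, hM⟩ | ⟨A, m, M, B, rfl, hA, hm, hM⟩
      · refine Or.inl fun y hy => ?_
        rcases List.mem_cons.1 hy with rfl | hy
        · exact h.le
        · exact h1 y hy
      · refine Or.inr (Or.inl ⟨x :: A, M, B, rfl, fun a ha => ?_, hM⟩)
        rcases List.mem_cons.1 ha with rfl | ha
        · exact h
        · exact hA a ha
      · refine Or.inr (Or.inr ⟨x :: A, m, M, B, rfl, fun a ha => ?_, hm, hM⟩)
        rcases List.mem_cons.1 ha with rfl | ha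
        · exact h
        · exact hA a ha
    · cases U with
      | nil => exact Or.inl (by simp [h])
      | cons M B =>
        exact Or.inr (Or.inr ⟨[], x, M, B, rfl, by simp, h, h ▸ hx M List.mem_cons_self⟩)
    · exact Or.inr (Or.inl ⟨[], x, U, rfl, by simp, h⟩)

theorem findIdx?_append_of_forall {α : Type*} {p : α → Bool} {A : List α}
    (hA : ∀ a ∈ A, p a = false) {y : α} (hy : p y = true) (B : List α) :
    (A ++ y :: B).findIdx? p = some A.length := by
  induction A with
  | nil => simp [List.findIdx?_cons, hy]
  | cons a A ih =>
    have h1 := hA a List.mem_cons_self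
    have h2 := ih fun b hb => hA b (List.mem_cons_of_mem _ hb)
    simp [List.findIdx?_cons, h1, h2]

/-! ### Writing into a tableau -/

theorem setRowG_append (pre : STab) (R R' : List Letter) (post : STab) :
    setRowG (pre ++ R :: post) pre.length R' = pre ++ R' :: post := by
  simp [setRowG]

theorem setRowG_length (T : STab) (R : List Letter) : setRowG T T.length R = T ++ [R] := by
  simp [setRowG]

theorem getD_append_length (pre : STab) (R : List Letter) (post : STab) :
    (pre ++ R :: post).getD pre.length [] = R := by
  simp

theorem upd_setRowG {T : STab} (hT : ∀ R ∈ T, R ≠ []) {r k : ℕ} (hr : r ≤ T.length)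
    {x : Letter} {R' : List Letter}
    (hR : ∀ i, R'[i]? = if i = k then some x else (T.getD r [])[i]?) :
    Upd T (setRowG T r R') r (r + k) x where
  ne := by
    have hR' : R' ≠ [] := by
      rintro rfl
      have := hR k
      simp at this
    intro S hS
    unfold setRowG at hS
    split_ifs at hS with h
    · rcases List.mem_or_eq_of_mem_set hS with hS | rfl
      · exact hT S hS
      · exact hR'
    · rcases List.mem_append.1 hS with hS | hS
      · exact hT S hS
      · rw [List.mem_singleton.1 hS]; exact hR'
  entry r' c' := by
    rcases lt_or_ge c' r' with hc | hc
    · rw [entry?_of_lt hc, entry?_of_lt hc, if_neg (by omega)]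
    rw [entry?_of_le hc, entry?_of_le hc]
    have hget : (setRowG T r R').getD r' [] = if r' = r then R' else T.getD r' [] := by
      unfold setRowG
      split_ifs with h1 h2 h2
      · subst h2; simp [h1]
      · simp [List.getD_eq_getElem?_getD, List.getElem?_set_ne (Ne.symm h2)]
      · obtain rfl : r' = T.length := by omega
        simp
      · rcases lt_or_ge r' T.length with h3 | h3
        · simp [List.getD_eq_getElem?_getD, List.getElem?_append_left h3]
        · simp [List.getD_eq_getElem?_getD]
          rw [List.getElem?_eq_none (by simp; omega), List.getElem?_eq_none h3]
    rw [hget]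
    split_ifs with h1 h2 h2
    · rw [hR, if_pos (by omega)]
    · rw [hR, if_neg (by omega), h1]
    · omega
    · rfl

theorem upd_snoc {T : STab} (hT : ∀ R ∈ T, R ≠ []) {r : ℕ} (hr : r ≤ T.length) (x : Letter) :
    Upd T (setRowG T r (T.getD r [] ++ [x])) r (r + (T.getD r []).length) x :=
  upd_setRowG hT hr fun i => by
    rw [List.getElem?_append]
    split_ifs with h1 h2 h2
    · omega
    · rfl
    · simp [h2]
    · rw [List.getElem?_eq_none (by simp only [List.length_singleton]; omega),
        List.getElem?_eq_none (by omega)]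

theorem upd_setEntryG {T : STab} (hT : ∀ R ∈ T, R ≠ []) {r c : ℕ} {y : Letter}
    (hy : entry? T r c = some y) (x : Letter) : Upd T (setEntryG T r c x) r c x := by
  have hrc := entry?_isSome_le hy
  have hr : r < T.length := by
    by_contra h
    rw [entry?_of_length_le (by omega)] at hy
    cases hy
  obtain ⟨k, rfl⟩ := Nat.exists_eq_add_of_le hrc
  rw [entry?_add] at hy
  have hk := (List.getElem?_eq_some_iff.1 hy).1
  have : setEntryG T r (r + k) x = setRowG T r ((T.getD r []).set k x) := by
    simp [setEntryG, setRowG, hr]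
  rw [this]
  refine upd_setRowG hT hr.le fun i => ?_
  rw [List.getElem?_set]
  split_ifs <;> first | rfl | omega

/-! ### The columns of an updated tableau -/

theorem Upd.colFrom_of_ne {T T' : STab} {r c : ℕ} {x : Letter} (h : Upd T T' r c x) (b : ℕ)
    {c' : ℕ} (hc : c' ≠ c) : colFrom b T' c' = colFrom b T c' := by
  unfold colFrom
  congr 1
  refine List.filterMap_congr fun r' _ => ?_
  rw [h.entry, if_neg (by omega)]

theorem Upd.getElem?_colLetters {T T' : STab} {r c : ℕ} {x : Letter} (h : Upd T T' r c x)
    (hT : Good T) (hT' : Good T') (i : ℕ) :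
    (colLetters T' c)[i]? = if i = r then some x else (colLetters T c)[i]? := by
  rw [hT'.getElem?_colLetters, hT.getElem?_colLetters, h.entry]
  simp

theorem Upd.colLetters_replace {T T' : STab} {r c : ℕ} {x : Letter} (h : Upd T T' r c x)
    (hT : Good T) (hT' : Good T') {A B : PWord} {y : Letter}
    (hU : colLetters T c = A ++ y :: B) (hA : A.length = r) :
    colLetters T' c = A ++ x :: B := by
  apply List.ext_getElem?
  intro i
  rw [h.getElem?_colLetters hT hT', hU]
  subst hA
  rcases lt_trichotomy i A.length with hi | rfl | hi
  · rw [if_neg hi.ne, List.getElem?_append_left hi, List.getElem?_append_left hi]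
  · simp
  · rw [if_neg hi.ne', List.getElem?_append_right hi.le, List.getElem?_append_right hi.le,
      show i - A.length = (i - A.length - 1) + 1 by omega]
    rfl

theorem Upd.colLetters_snoc {T T' : STab} {r c : ℕ} {x : Letter} (h : Upd T T' r c x)
    (hT : Good T) (hT' : Good T') (hr : (colLetters T c).length = r) :
    colLetters T' c = colLetters T c ++ [x] := by
  apply List.ext_getElem?
  intro i
  rw [h.getElem?_colLetters hT hT', List.getElem?_append]
  split_ifs with h1 h2 h2
  · omega
  · simp [h1, hr]
  · rfl
  · rw [List.getElem?_eq_none (by omega), List.getElem?_eq_none (by simp; omega)]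

/-! ### One step of column insertion -/

theorem findIdx?_colOcc (T : STab) (c : ℕ) (q : Letter → Bool) :
    (colOcc T c).findIdx? (fun p => q p.2) = (colLetters T c).findIdx? q := by
  rw [← colOcc_map_snd, List.findIdx?_map]
  rfl

theorem Good.colOcc_getD {T : STab} (hT : Good T) {c : ℕ} {A B : PWord} {y : Letter}
    (hU : colLetters T c = A ++ y :: B) :
    (colOcc T c).getD A.length (0, default) = (A.length, y) := by
  rw [List.getD_eq_getElem?_getD, hT.getElem?_colOcc, ← hT.getElem?_colLetters, hU]
  simp

theorem length_colOcc (T : STab) (c : ℕ) : (colOcc T c).length = (colLetters T c).length := by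
  rw [← colOcc_map_snd, List.length_map]

theorem egCol_none {T : STab} {c : ℕ} {w : Letter} (fuel : ℕ)
    (h : ∀ x ∈ colLetters T c, x.ceil ≤ w.ceil) (hc : (colLetters T c).length ≠ c) :
    (egCol (fuel + 1) T c w).1 = setRowG T (colLetters T c).length
      (T.getD (colLetters T c).length [] ++ [w]) := by
  have h1 : (colOcc T c).findIdx? (fun p => decide (w.ceil < p.2.ceil)) = none := by
    rw [findIdx?_colOcc T c (fun x => decide (w.ceil < x.ceil)), List.findIdx?_eq_none_iff]
    intro x hx
    simpa using h x hx
  rw [egCol]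
  simp only
  rw [h1]
  simp only [length_colOcc, hc, false_and, if_false]

theorem egCol_bump {T : STab} (hT : Good T) {c : ℕ} {w M : Letter} {A B : PWord} (fuel : ℕ)
    (hU : colLetters T c = A ++ M :: B) (hA : ∀ a ∈ A, a.ceil < w.ceil) (hM : w.ceil < M.ceil)
    (hc : A.length ≠ c) :
    egCol (fuel + 1) T c w = egCol fuel (setEntryG T A.length c w) (c + 1) M := by
  have h1 : (colOcc T c).findIdx? (fun p => decide (w.ceil < p.2.ceil)) = some A.length := by
    rw [findIdx?_colOcc T c (fun x => decide (w.ceil < x.ceil)), hU]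
    exact findIdx?_append_of_forall (by simpa using fun a ha => (hA a ha).le) (by simpa using hM) _
  have h2 : (colOcc T c).findIdx? (fun p => decide (w.ceil ≤ p.2.ceil)) = some A.length := by
    rw [findIdx?_colOcc T c (fun x => decide (w.ceil ≤ x.ceil)), hU]
    exact findIdx?_append_of_forall (by simpa using hA) (by simpa using hM.le) _
  rw [egCol]
  simp only
  rw [h1]
  simp only [h2, Option.getD_some, hT.colOcc_getD hU, if_true, hc, if_false]

theorem egCol_eq {T : STab} (hT : Good T) {c : ℕ} {w m M : Letter} {A B : PWord} (fuel : ℕ)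
    (hU : colLetters T c = A ++ m :: M :: B) (hA : ∀ a ∈ A, a.ceil < w.ceil)
    (hm : m.ceil = w.ceil) (hM : w.ceil < M.ceil) :
    egCol (fuel + 1) T c w = egCol fuel (setEntryG (setEntryG T A.length c (switchPrimes m M).1)
      (A.length + 1) c (switchPrimes m M).2) (c + 1) w.succL := by
  have hU' : colLetters T c = (A ++ [m]) ++ M :: B := by simp [hU]
  have h1 : (colOcc T c).findIdx? (fun p => decide (w.ceil < p.2.ceil)) =
      some (A ++ [m]).length := by
    rw [findIdx?_colOcc T c (fun x => decide (w.ceil < x.ceil)), hU']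
    refine findIdx?_append_of_forall (fun a ha => ?_) (by simpa using hM) _
    rcases List.mem_append.1 ha with ha | ha
    · simpa using (hA a ha).le
    · simp [List.mem_singleton.1 ha, hm]
  have h2 : (colOcc T c).findIdx? (fun p => decide (w.ceil ≤ p.2.ceil)) = some A.length := by
    rw [findIdx?_colOcc T c (fun x => decide (w.ceil ≤ x.ceil)), hU]
    exact findIdx?_append_of_forall (by simpa using hA) (by simp [hm]) _
  rw [egCol]
  simp only
  rw [h1]
  have h3 := hT.colOcc_getD hU'
  simp only [List.length_append, List.length_singleton] at h3
  simp only [h2, Option.getD_some, hT.colOcc_getD hU, List.length_append, List.length_singleton,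
    h3, if_neg (Nat.succ_ne_self A.length).symm]

/-! ### Column insertion -/

/-- Where the bumping path may enter column `c` with a letter of ceiling `v`. -/
structure ColInv (T : STab) (c : ℕ) (v : ℤ) (ρ : ℕ) : Prop where
  up : ∀ y, entry? T ρ c = some y → v < y.ceil
  alt : (ρ < c ∧ (∀ i y, i < ρ → entry? T i (c - 1) = some y → y.ceil < v) ∧
      (∃ y, entry? T ρ (c - 1) = some y ∧ y.ceil ≤ v ∧ (y.ceil = v →
        0 < ρ ∧ ∀ y', entry? T (ρ - 1) c = some y' → v ≤ y'.ceil))) ∨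
    (ρ = c ∧ 0 < c ∧ ∃ m, entry? T (c - 1) c = some m ∧ m.ceil = v ∧ m.primed = false)

/-- The word read before and after an insertion into column `c`. -/
def colSplit (T : STab) (c N : ℕ) (w : Letter) : PWord :=
  (List.range c).flatMap (colFrom 1 T) ++
    w :: (List.range' c (N + 1 - c)).flatMap (colFrom 1 T)

theorem colSplit_succ {T : STab} {c N : ℕ} (hc : c ≤ N) (w : Letter) :
    colSplit T c N w = (List.range c).flatMap (colFrom 1 T) ++ (w :: (colLetters T c).reverse ++
      (List.range' (c + 1) (N - c)).flatMap (colFrom 1 T)) := by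
  rw [colSplit, show N + 1 - c = (N - c) + 1 by omega, List.range'_succ]
  simp [colFrom_one]

theorem colSplit_knuth {T T' : STab} {c N : ℕ} {w w' : Letter} (hc : c ≤ N)
    (hT : ∀ c', c' ≠ c → colFrom 1 T' c' = colFrom 1 T c')
    (h : Knuth (w :: (colLetters T c).reverse) ((colLetters T' c).reverse ++ [w'])) :
    Knuth (colSplit T c N w) (colSplit T' (c + 1) N w') := by
  rw [colSplit_succ hc, colSplit, List.range_succ, List.flatMap_append,
    List.flatMap_congr (fun c' hc' => hT c' (List.mem_range.1 hc').ne),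
    show N + 1 - (c + 1) = N - c by omega,
    List.flatMap_congr (l := List.range' (c + 1) (N - c)) (f := colFrom 1 T')
      (fun c' hc' => hT c' (by rw [List.mem_range'_1] at hc'; omega))]
  have := (h.append_right ((List.range' (c + 1) (N - c)).flatMap (colFrom 1 T))).append_left
    ((List.range c).flatMap (colFrom 1 T))
  simpa [colFrom_one] using this

theorem colSplit_eq {T T' : STab} {c N : ℕ} {w : Letter} (hc : c ≤ N)
    (hT : ∀ c', c' ≠ c → colFrom 1 T' c' = colFrom 1 T c')
    (h : colLetters T' c = colLetters T c ++ [w]) :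
    colSplit T c N w = (List.range (N + 1)).flatMap (colFrom 1 T') := by
  have hr : List.range (N + 1) = List.range c ++ c :: List.range' (c + 1) (N - c) := by
    have := (List.range'_append_1 (s := 0) (m := c) (n := N - c + 1)).symm
    rw [show c + (N - c + 1) = N + 1 by omega, Nat.zero_add, ← List.range_eq_range',
      ← List.range_eq_range', List.range'_succ] at this
    exact this
  rw [colSplit_succ hc, hr, List.flatMap_append, List.flatMap_cons,
    List.flatMap_congr (fun c' hc' => hT c' (List.mem_range.1 hc').ne),
    List.flatMap_congr (l := List.range' (c + 1) (N - c)) (f := colFrom 1 T')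
      (fun c' hc' => hT c' (by rw [List.mem_range'_1] at hc'; omega)), colFrom_one, h]
  simp

theorem Good.mem_colLetters {T : STab} (hT : Good T) {c i : ℕ} {y : Letter}
    (h : entry? T i c = some y) : y ∈ colLetters T c := by
  rw [← hT.getElem?_colLetters] at h
  exact List.mem_of_getElem? h

/-- Placing a letter at the end of a column. -/
theorem egCol_none_spec {T : STab} (hT : Good T) {c N ρ : ℕ} {w : Letter} (fuel : ℕ)
    (hN : ColBound T N) (hc : c ≤ N) (hI : ColInv T c w.ceil ρ) (hV : Valid (colSplit T c N w))
    (hU : ∀ x ∈ colLetters T c, x.ceil ≤ w.ceil) :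
    Good (egCol (fuel + 1) T c w).1 ∧
      OckEquiv (colSplit T c N w) (rowWord (egCol (fuel + 1) T c w).1) := by
  have hlt : ∀ x ∈ colLetters T c, x.ceil < w.ceil := by
    rw [colSplit_succ hc] at hV
    have hincr := hT.incr_col c
    generalize colLetters T c = U at hV hU hincr
    rcases List.eq_nil_or_concat U with rfl | ⟨U', l, rfl⟩
    · simp
    · rw [List.concat_eq_append] at *
      have hne := Valid.ne_of_adjacent (p := (List.range c).flatMap (colFrom 1 T)) (x := w)
        (y := l) (s := U'.reverse ++ (List.range' (c + 1) (N - c)).flatMap (colFrom 1 T))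
        (by simpa using hV)
      have hl : l.ceil < w.ceil := lt_of_le_of_ne (hU l (by simp)) hne.symm
      intro x hx
      rcases List.mem_append.1 hx with hx | hx
      · exact lt_trans ((incr_append.1 hincr).2.2 x hx l (by simp)) hl
      · rwa [List.mem_singleton.1 hx]
  have hρ : entry? T ρ c = none := by
    cases h : entry? T ρ c with
    | none => rfl
    | some y => exact absurd (hI.up y h) (hlt y (hT.mem_colLetters h)).not_gt
  set r := (colLetters T c).length with hr
  have hr0 : entry? T r c = none := by
    rw [← hT.getElem?_colLetters, List.getElem?_eq_none hr.le]
  have hrρ : r ≤ ρ := by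
    rw [← hT.getElem?_colLetters, List.getElem?_eq_none_iff] at hρ
    exact hρ
  obtain ⟨hρc, hbelow, y, hy, hyw, heq⟩ | ⟨rfl, -, m, hm, hmw, -⟩ := hI.alt
  swap
  · exact absurd hmw (hlt m (hT.mem_colLetters hm)).ne
  obtain ⟨c, rfl⟩ : ∃ d, c = d + 1 := ⟨c - 1, by omega⟩
  rw [Nat.add_sub_cancel] at *
  obtain ⟨x, hx⟩ : ∃ x, entry? T r c = some x := by
    cases h : entry? T r c with
    | none => rw [hT.dn_of_le h hrρ] at hy; cases hy
    | some x => exact ⟨x, rfl⟩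
  have hrc := entry?_isSome_le hx
  have hrT : r < T.length := by
    by_contra h
    rw [entry?_of_length_le (by omega)] at hx
    cases hx
  have hlen : r + (T.getD r []).length = c + 1 := by
    rw [entry?_of_le (by omega)] at hx hr0
    rw [List.getElem?_eq_none_iff] at hr0
    have := (List.getElem?_eq_some_iff.1 hx).1
    omega
  have hlast : ∀ r', r = r' + 1 → ∃ y, entry? T r' (c + 1) = some y ∧ y.ceil < w.ceil := by
    intro r' hr'
    have hlt' : r' < (colLetters T (c + 1)).length := by omega
    refine ⟨(colLetters T (c + 1))[r'], ?_, hlt _ (List.getElem_mem _)⟩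
    rw [← hT.getElem?_colLetters, List.getElem?_eq_getElem hlt']
  have hU1 := upd_snoc hT.ne hrT.le w
  rw [hlen] at hU1
  rw [egCol_none fuel hU (by omega)]
  have hxw : x.ceil < w.ceil := by
    rcases hrρ.lt_or_eq with h | h
    · exact hbelow _ _ h hx
    · rw [← h, hx] at hy
      cases hy
      refine lt_of_le_of_ne hyw fun h' => ?_
      obtain ⟨h0, h1⟩ := heq h'
      obtain ⟨y', hy', hlt'⟩ := hlast (ρ - 1) (by omega)
      exact absurd (h1 y' hy') hlt'.not_ge
  have hT' := hU1.good hT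
    (by
      intro c' z hc' hz
      obtain rfl : c = c' := by omega
      rw [hx] at hz
      cases hz
      exact hxw)
    (by
      intro z hz
      rw [entry?_none_of_lt (by omega) hr0 (Nat.le_succ _)] at hz
      cases hz)
    hlast
    (by
      intro z hz
      rw [hT.dn _ _ hr0] at hz
      cases hz)
    (by omega)
  refine ⟨hT', ?_⟩
  rw [colSplit_eq hc (fun c' hc' => hU1.colFrom_of_ne 1 hc')
    (hU1.colLetters_snoc hT hT' hr.symm)]
  refine (knuth_cols hT' ?_).ockEquiv.symm
  intro r' c' hc'
  rw [hU1.entry, if_neg (by omega)]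
  exact hN _ _ (by omega)

theorem entry?_of_colLetters {T : STab} (hT : Good T) {c : ℕ} {A B : PWord} {y : Letter}
    (hU : colLetters T c = A ++ y :: B) : entry? T A.length c = some y := by
  rw [← hT.getElem?_colLetters, hU]
  simp

theorem entry?_pred_of_colLetters {T : STab} (hT : Good T) {c r : ℕ} {A B : PWord}
    (hU : colLetters T c = A ++ B) (hr : A.length = r + 1) :
    ∃ y ∈ A, entry? T r c = some y := by
  refine ⟨A[r], List.getElem_mem _, ?_⟩
  rw [← hT.getElem?_colLetters, hU, List.getElem?_append_left (by omega),
    List.getElem?_eq_getElem]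

theorem ColInv.le {T : STab} (hT : Good T) {c ρ : ℕ} {v : ℤ} (hI : ColInv T c v ρ)
    {A B : PWord} (hU : colLetters T c = A ++ B) (hA : ∀ a ∈ A, a.ceil ≤ v) : A.length ≤ ρ := by
  by_contra! h
  have h1 : entry? T ρ c = some A[ρ] := by
    rw [← hT.getElem?_colLetters, hU, List.getElem?_append_left h, List.getElem?_eq_getElem]
  exact absurd (hI.up _ h1) (hA _ (List.getElem_mem h)).not_gt

/-- Bumping an entry out of a column. -/
theorem egCol_bump_spec {T : STab} (hT : Good T) {c N ρ : ℕ} {w M : Letter} {A B : PWord}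
    (hN : ColBound T N) (hc : c ≤ N) (hI : ColInv T c w.ceil ρ)
    (hU : colLetters T c = A ++ M :: B) (hA : ∀ a ∈ A, a.ceil < w.ceil) (hM : w.ceil < M.ceil) :
    A.length ≠ c ∧ Good (setEntryG T A.length c w) ∧ ColBound (setEntryG T A.length c w) N ∧
      ColInv (setEntryG T A.length c w) (c + 1) M.ceil A.length ∧
      Knuth (colSplit T c N w) (colSplit (setEntryG T A.length c w) (c + 1) N M) := by
  have hk := hI.le hT hU fun a ha => (hA a ha).le
  have hMe := entry?_of_colLetters hT hU
  have hincr := hT.incr_col c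
  rw [hU] at hincr
  obtain ⟨hρc, hbelow, y, hy, hyw, heq⟩ | ⟨rfl, h0, m, hm, hmw, -⟩ := hI.alt
  swap
  · have := hT.mem_colLetters hm
    rw [hU] at this
    rcases List.mem_append.1 this with h | h
    · exact absurd hmw (hA m h).ne
    rcases List.mem_cons.1 h with rfl | h
    · exact absurd hmw hM.ne'
    · have h1 : M.ceil < m.ceil := (incr_cons.1 (incr_append.1 hincr).2.1).1 m h
      omega
  have hup := upd_setEntryG hT.ne hMe w
  have hpred : ∀ r', A.length = r' + 1 → ∃ y, entry? T r' c = some y ∧ y.ceil < w.ceil := by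
    intro r' hr'
    obtain ⟨y, hy, h⟩ := entry?_pred_of_colLetters hT hU hr'
    exact ⟨y, h, hA y hy⟩
  have hT' := hup.good hT
    (by
      rintro c' z rfl hz
      rw [Nat.add_sub_cancel] at *
      rcases hk.lt_or_eq with h | h
      · exact hbelow _ _ h hz
      · rw [← h, hz] at hy
        cases hy
        refine lt_of_le_of_ne hyw fun h' => ?_
        obtain ⟨h0, h1⟩ := heq h'
        obtain ⟨y', hy', hlt⟩ := hpred (ρ - 1) (by omega)
        exact absurd (h1 y' hy') hlt.not_ge)
    (fun z hz => hM.trans (hT.row _ _ _ _ hMe hz)) hpred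
    (fun z hz => hM.trans (hT.col _ _ _ _ hMe hz)) (by omega)
  refine ⟨by omega, hT', ?_, ⟨?_, Or.inl ⟨by omega, ?_, w, ?_, hM.le, ?_⟩⟩, ?_⟩
  · intro r' c' hc'
    rw [hup.entry]
    split_ifs with h
    · rw [← h.2, hN _ _ hc'] at hMe
      cases hMe
    · exact hN _ _ hc'
  · intro z hz
    rw [hup.entry, if_neg (by omega)] at hz
    exact hT.row _ _ _ _ hMe hz
  · intro i z hi hz
    rw [Nat.add_sub_cancel, hup.entry, if_neg (by omega)] at hz
    exact hT.col_lt hz hMe hi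
  · rw [Nat.add_sub_cancel, hup.entry, if_pos ⟨rfl, rfl⟩]
  · intro h
    omega
  · refine colSplit_knuth hc (fun c' hc' => hup.colFrom_of_ne 1 hc') ?_
    rw [hup.colLetters_replace hT hT' hU rfl, hU]
    have := (knuth_bump hincr (w := w)
      (incr_append.2 ⟨(incr_append.1 hincr).1, by simp [Incr], by simpa [key] using hA⟩) hM).reverse
    simpa using this

/-- Passing a letter through a column that contains a letter with the same ceiling. -/
theorem egCol_eq_spec {T : STab} (hT : Good T) {c N ρ : ℕ} {w m M : Letter} {A B : PWord}
    (hN : ColBound T N) (hc : c ≤ N) (hI : ColInv T c w.ceil ρ) (hV : Valid (colSplit T c N w))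
    (hU : colLetters T c = A ++ m :: M :: B) (hA : ∀ a ∈ A, a.ceil < w.ceil)
    (hm : m.ceil = w.ceil) (hM : w.ceil < M.ceil) :
    ∃ T', T' = setEntryG (setEntryG T A.length c (switchPrimes m M).1)
      (A.length + 1) c (switchPrimes m M).2 ∧ Good T' ∧ ColBound T' N ∧
      ColInv T' (c + 1) w.succL.ceil (A.length + 1) ∧
      Knuth (colSplit T c N w) (colSplit T' (c + 1) N w.succL) := by
  have hU' : colLetters T c = (A ++ [m]) ++ M :: B := by simp [hU]
  have hincr := hT.incr_col c
  rw [hU] at hincr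
  have hbraid : M.ceil = m.ceil + 1 ∧ M.primed = false ∧ (m.primed = false ∨ w.primed = false) := by
    have h1 := (knuth_slide_left (dual := false) (w := w) (m := M) (B := B) (by simpa [key] using hM)
      (List.pairwise_cons.1 (incr_append.1 hincr).2.1).2 []).reverse
    have h2 := (h1.append_right (m :: A.reverse ++
      (List.range' (c + 1) (N - c)).flatMap (colFrom 1 T))).append_left
        ((List.range c).flatMap (colFrom 1 T))
    rw [colSplit_succ hc, hU] at hV
    have h3 := Valid.of_equiv (by simpa using hV) h2.ockEquiv
    have h4 := Valid.braid (p := (List.range c).flatMap (colFrom 1 T) ++ B.reverse) (m := w)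
      (M := M) (w := m) (s := A.reverse ++ (List.range' (c + 1) (N - c)).flatMap (colFrom 1 T))
      (by simpa using h3) hm.symm hM
    rw [hm]
    exact ⟨h4.1, h4.2.1, h4.2.2.symm⟩
  obtain ⟨hMm, hMp, hmw⟩ := hbraid
  have hk := hI.le hT hU' (by
    intro a ha
    rcases List.mem_append.1 ha with ha | ha
    · exact (hA a ha).le
    · rw [List.mem_singleton.1 ha, hm])
  rw [List.length_append, List.length_singleton] at hk
  have hme := entry?_of_colLetters hT hU
  have hMe := entry?_of_colLetters hT hU'
  rw [List.length_append, List.length_singleton] at hMe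
  have hkc := entry?_isSome_le hMe
  have hp1 : (switchPrimes m M).1.ceil = m.ceil := by unfold switchPrimes; split_ifs <;> rfl
  have hp2 : (switchPrimes m M).2.ceil = M.ceil := by unfold switchPrimes; split_ifs <;> rfl
  have hdiag : A.length + 1 = c → m.primed = false := by
    intro h
    obtain ⟨hρc, -⟩ | ⟨rfl, h0, m', hm', hmw', hp⟩ := hI.alt
    · omega
    · rw [show ρ - 1 = A.length by omega, hme] at hm'
      cases hm'
      exact hp
  have hup1 := upd_setEntryG hT.ne hme (switchPrimes m M).1
  have hT1 := hup1.good_of_ceil hT hme hp1.symm (by omega)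
  have hMe1 : entry? (setEntryG T A.length c (switchPrimes m M).1) (A.length + 1) c = some M := by
    rw [hup1.entry, if_neg (by omega), hMe]
  have hup2 := upd_setEntryG hT1.ne hMe1 (switchPrimes m M).2
  have hT2 := hup2.good_of_ceil hT1 hMe1 hp2.symm (by
    intro h
    simp [switchPrimes, hdiag h, hMp])
  have hent : ∀ r' c', c' ≠ c → entry? (setEntryG (setEntryG T A.length c (switchPrimes m M).1)
      (A.length + 1) c (switchPrimes m M).2) r' c' = entry? T r' c' := by
    intro r' c' hc'
    rw [hup2.entry, if_neg (by omega), hup1.entry, if_neg (by omega)]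
  refine ⟨_, rfl, hT2, ?_, ⟨?_, Or.inl ⟨by omega, ?_, (switchPrimes m M).2, ?_, ?_, ?_⟩⟩, ?_⟩
  · intro r' c' hc'
    have : c' ≠ c := by
      rintro rfl
      rw [hN _ _ hc'] at hMe
      cases hMe
    rw [hent _ _ this]
    exact hN _ _ hc'
  · intro z hz
    rw [hent _ _ (by omega)] at hz
    have h1 := hT.row _ _ _ _ hMe hz
    simp only [Letter.succL]
    omega
  · intro i z hi hz
    rw [Nat.add_sub_cancel, hup2.entry, if_neg (by omega), hup1.entry] at hz
    simp only [Letter.succL]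
    split_ifs at hz with h
    · cases hz
      omega
    · have := hT.col_lt hz hme (by omega)
      omega
  · rw [Nat.add_sub_cancel, hup2.entry, if_pos ⟨rfl, rfl⟩]
  · simp only [Letter.succL]
    omega
  · refine fun _ => ⟨by omega, fun z hz => ?_⟩
    rw [Nat.add_sub_cancel, hent _ _ (by omega)] at hz
    have h1 := hT.row _ _ _ _ hme hz
    simp only [Letter.succL]
    omega
  · refine colSplit_knuth hc (fun c' hc' => ?_) ?_
    · rw [hup2.colFrom_of_ne 1 hc', hup1.colFrom_of_ne 1 hc']
    · have e1 := hup1.colLetters_replace hT hT1 hU rfl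
      rw [List.append_cons] at e1
      rw [hup2.colLetters_replace hT1 hT2 e1 (by simp), hU]
      simpa using (knuth_bump_braid hincr hm hMm hMp hmw).reverse

/-- Column insertion preserves the orthogonal Coxeter–Knuth class. -/
theorem egCol_spec (fuel : ℕ) : ∀ {T : STab} {c N ρ : ℕ} {w : Letter}, Good T → ColBound T N →
    c ≤ N → N + 1 ≤ fuel + c → ColInv T c w.ceil ρ → Valid (colSplit T c N w) →
    Good (egCol fuel T c w).1 ∧ OckEquiv (colSplit T c N w) (rowWord (egCol fuel T c w).1) := by
  induction fuel with
  | zero => intro T c N ρ w _ _ _ _; omega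
  | succ fuel ih =>
    intro T c N ρ w hT hN hc hfuel hI hV
    have hcN : ∀ {A B : PWord} {y : Letter}, colLetters T c = A ++ y :: B → c + 1 ≤ N := by
      intro A B y hU
      by_contra! h
      have := entry?_of_colLetters hT hU
      rw [hN _ _ (by omega)] at this
      cases this
    rcases (hT.incr_col c).line_cases w.ceil with hU | ⟨A, M, B, hU, hA, hM⟩ |
      ⟨A, m, M, B, hU, hA, hm, hM⟩
    · exact egCol_none_spec hT fuel hN hc hI hV hU
    · obtain ⟨hne, hT', hN', hI', hk⟩ := egCol_bump_spec hT hN hc hI hU hA hM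
      rw [egCol_bump hT fuel hU hA hM hne]
      obtain ⟨h1, h2⟩ := ih hT' hN' (hcN hU) (by omega) hI' (hV.of_equiv hk.ockEquiv)
      exact ⟨h1, hk.ockEquiv.trans h2⟩
    · obtain ⟨T', rfl, hT', hN', hI', hk⟩ := egCol_eq_spec hT hN hc hI hV hU hA hm hM
      rw [egCol_eq hT fuel hU hA hm hM]
      obtain ⟨h1, h2⟩ := ih hT' hN' (hcN hU) (by omega) hI' (hV.of_equiv hk.ockEquiv)
      exact ⟨h1, hk.ockEquiv.trans h2⟩

/-! ### One step of row insertion -/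

theorem egRow_new (fuel : ℕ) (T : STab) (w : Letter) :
    (egRow (fuel + 1) T T.length w).1 = T ++ [[w.unprime]] := by
  have h : T.getD T.length [] = [] := by simp
  rw [egRow]
  simp only [h, List.findIdx?_nil, List.isEmpty_nil, true_and, setRowG_length, List.nil_append]
  split_ifs with hw
  · rfl
  · have : w.unprime = w := unprimed_eq (by simpa using hw)
    rw [this]

theorem egRow_none (fuel : ℕ) (pre post : STab) {R : List Letter} (hR : R ≠ []) {w : Letter}
    (h : ∀ x ∈ R, x.ceil ≤ w.ceil) :
    (egRow (fuel + 1) (pre ++ R :: post) pre.length w).1 = pre ++ (R ++ [w]) :: post := by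
  have h1 : R.findIdx? (fun x => decide (w.ceil < x.ceil)) = none := by
    rw [List.findIdx?_eq_none_iff]
    intro x hx
    simpa using h x hx
  rw [egRow]
  simp only [getD_append_length, h1, setRowG_append]
  simp [hR]

theorem egRow_bump (fuel : ℕ) (pre post : STab) {A B : List Letter} {w M : Letter}
    (hA : ∀ a ∈ A, a.ceil < w.ceil) (hM : w.ceil < M.ceil) :
    egRow (fuel + 1) (pre ++ (A ++ M :: B) :: post) pre.length w =
      if A = [] then egCol fuel (pre ++ (w.unprime :: B) :: post) (pre.length + 1)
        ⟨M.ceil, w.primed⟩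
      else egRow fuel (pre ++ (A ++ w :: B) :: post) (pre.length + 1) M := by
  have h1 : (A ++ M :: B).findIdx? (fun x => decide (w.ceil < x.ceil)) = some A.length :=
    findIdx?_append_of_forall (by simpa using fun a ha => (hA a ha).le) (by simpa using hM) _
  have h2 : (A ++ M :: B).findIdx? (fun x => decide (w.ceil ≤ x.ceil)) = some A.length :=
    findIdx?_append_of_forall (by simpa using hA) (by simpa using hM.le) _
  rw [egRow]
  simp only [getD_append_length, h1, h2, setRowG_append, Option.getD_some, if_true]
  cases A with
  | nil => simp
  | cons a A => simp

theorem egRow_eq (fuel : ℕ) (pre post : STab) {A B : List Letter} {w m M : Letter}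
    (hA : ∀ a ∈ A, a.ceil < w.ceil) (hm : m.ceil = w.ceil) (hM : w.ceil < M.ceil) :
    egRow (fuel + 1) (pre ++ (A ++ m :: M :: B) :: post) pre.length w =
      if A = [] then egCol fuel
        (pre ++ (A ++ (switchPrimes m M).1 :: (switchPrimes m M).2 :: B) :: post)
        (pre.length + 1) w.succL
      else egRow fuel (pre ++ (A ++ (switchPrimes m M).1 :: (switchPrimes m M).2 :: B) :: post)
        (pre.length + 1) w.succL := by
  have h1 : (A ++ m :: M :: B).findIdx? (fun x => decide (w.ceil < x.ceil)) =
      some (A.length + 1) := by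
    have := findIdx?_append_of_forall (p := fun x : Letter => decide (w.ceil < x.ceil))
      (A := A ++ [m]) (y := M) (fun a ha => by
        rcases List.mem_append.1 ha with ha | ha
        · simpa using (hA a ha).le
        · simp [List.mem_singleton.1 ha, hm]) (by simpa using hM) B
    simpa using this
  have h2 : (A ++ m :: M :: B).findIdx? (fun x => decide (w.ceil ≤ x.ceil)) = some A.length :=
    findIdx?_append_of_forall (by simpa using hA) (by simp [hm]) _
  rw [egRow]
  simp only [getD_append_length, h1, h2, setRowG_append, Option.getD_some]
  rw [if_neg (Nat.succ_ne_self _).symm]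
  have e : ∀ x y : Letter, ((A ++ m :: M :: B).set A.length x).set (A.length + 1) y =
      A ++ x :: y :: B := by
    intro x y
    simp
  have e1 : (A ++ m :: M :: B).getD A.length default = m := by simp
  have e2 : (A ++ m :: M :: B).getD (A.length + 1) default = M := by simp
  simp only [e, e1, e2]
  simp

theorem upd_row {pre post : STab} {A B : List Letter} {y : Letter}
    (hT : ∀ R ∈ pre ++ (A ++ y :: B) :: post, R ≠ []) (x : Letter) :
    Upd (pre ++ (A ++ y :: B) :: post) (pre ++ (A ++ x :: B) :: post) pre.length
      (pre.length + A.length) x := by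
  have := upd_setRowG hT (r := pre.length) (k := A.length) (x := x) (R' := A ++ x :: B)
    (by simp) (fun i => by
      rw [getD_append_length]
      rcases lt_trichotomy i A.length with hi | rfl | hi
      · rw [if_neg hi.ne, List.getElem?_append_left hi, List.getElem?_append_left hi]
      · simp
      · rw [if_neg hi.ne', List.getElem?_append_right hi.le, List.getElem?_append_right hi.le,
          show i - A.length = (i - A.length - 1) + 1 by omega]
        rfl)
  rwa [setRowG_append] at this

theorem upd_row_snoc {pre post : STab} {R : List Letter}
    (hT : ∀ S ∈ pre ++ R :: post, S ≠ []) (x : Letter) :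
    Upd (pre ++ R :: post) (pre ++ (R ++ [x]) :: post) pre.length
      (pre.length + R.length) x := by
  have := upd_snoc hT (r := pre.length) (by simp) x
  rwa [getD_append_length, setRowG_append] at this

theorem upd_new_row {T : STab} (hT : ∀ S ∈ T, S ≠ []) (x : Letter) :
    Upd T (T ++ [[x]]) T.length T.length x := by
  have := upd_snoc hT le_rfl x
  simpa [setRowG_length] using this

theorem entry?_row (pre post : STab) (R : List Letter) (k : ℕ) :
    entry? (pre ++ R :: post) pre.length (pre.length + k) = R[k]? := by
  rw [entry?_add, getD_append_length]

/-! ### Row insertion -/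

/-- Where the bumping path may enter row `r` with a letter of ceiling `v`. -/
structure RowInv (T : STab) (r : ℕ) (v : ℤ) (γ : ℕ) : Prop where
  le : r ≤ γ
  up : ∀ y, entry? T r γ = some y → v < y.ceil
  alt : 0 < r → (∀ j y, j < γ → entry? T (r - 1) j = some y → y.ceil < v) ∧
    ∃ y, entry? T (r - 1) γ = some y ∧ y.ceil ≤ v ∧ (y.ceil = v →
      r < γ ∧ ∀ y', entry? T r (γ - 1) = some y' → v ≤ y'.ceil)

/-- A letter entering row `r` exceeds the entry below its box. -/
theorem RowInv.below {T : STab} {r γ k : ℕ} {v : ℤ} (hI : RowInv T r v γ)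
    (hk : r + k ≤ γ) (hlast : 0 < k → ∃ y, entry? T r (r + k - 1) = some y ∧ y.ceil < v) :
    ∀ r', r = r' + 1 → ∃ y, entry? T r' (r + k) = some y ∧ y.ceil < v := by
  rintro r' rfl
  obtain ⟨h1, y, hy, hyv, heq⟩ := hI.alt (Nat.succ_pos _)
  rw [Nat.add_sub_cancel] at *
  obtain ⟨x, hx⟩ : ∃ x, entry? T r' (r' + 1 + k) = some x := by
    cases h : entry? T r' (r' + 1 + k) with
    | none => rw [entry?_none_of_lt (by omega) h hk] at hy; cases hy
    | some x => exact ⟨x, rfl⟩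
  refine ⟨x, hx, ?_⟩
  rcases hk.lt_or_eq with h | h
  · exact h1 _ _ h hx
  · rw [← h, hx] at hy
    cases hy
    refine lt_of_le_of_ne hyv fun h' => ?_
    obtain ⟨h2, h3⟩ := heq h'
    obtain ⟨y', hy', hlt⟩ := hlast (by omega)
    rw [← h] at h3
    exact absurd (h3 y' hy') hlt.not_ge

theorem RowInv.length_le {pre post : STab} {v : ℤ} {γ : ℕ} {A B : PWord}
    (hI : RowInv (pre ++ (A ++ B) :: post) pre.length v γ) (hA : ∀ a ∈ A, a.ceil ≤ v) :
    pre.length + A.length ≤ γ := by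
  by_contra! h
  obtain ⟨k, rfl⟩ := Nat.exists_eq_add_of_le hI.le
  have hk : k < A.length := by omega
  have h1 := entry?_row pre post (A ++ B) k
  rw [List.getElem?_append_left hk, List.getElem?_eq_getElem hk] at h1
  exact absurd (hI.up _ h1) (hA _ (List.getElem_mem hk)).not_gt

theorem entry?_row_last {pre post : STab} {A B : PWord} {v : ℤ} (hA : ∀ a ∈ A, a.ceil < v)
    (h : 0 < A.length) : ∃ y, entry? (pre ++ (A ++ B) :: post) pre.length
      (pre.length + A.length - 1) = some y ∧ y.ceil < v := by
  have hk : A.length - 1 < A.length := by omega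
  refine ⟨A[A.length - 1], ?_, hA _ (List.getElem_mem hk)⟩
  rw [show pre.length + A.length - 1 = pre.length + (A.length - 1) by omega, entry?_row,
    List.getElem?_append_left hk, List.getElem?_eq_getElem hk]

theorem good_new_row {T : STab} (hT : Good T) {γ : ℕ} {w : Letter}
    (hI : RowInv T T.length w.ceil γ) : Good (T ++ [[w.unprime]]) := by
  refine (upd_new_row hT.ne w.unprime).good hT ?_ ?_ ?_ ?_ (fun _ => rfl)
  · intro c' y h hy
    rw [entry?_of_length_le le_rfl] at hy
    cases hy
  · intro y hy
    rw [entry?_of_length_le le_rfl] at hy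
    cases hy
  · exact hI.below (k := 0) hI.le (by omega)
  · intro y hy
    rw [entry?_of_length_le (by omega)] at hy
    cases hy

theorem good_row_snoc {pre post : STab} {R : List Letter} (hT : Good (pre ++ R :: post)) {γ : ℕ}
    {w : Letter} (hI : RowInv (pre ++ R :: post) pre.length w.ceil γ)
    (hR : ∀ x ∈ R, x.ceil < w.ceil) : Good (pre ++ (R ++ [w]) :: post) := by
  have hne := hT.ne R (by simp)
  have hpos := List.length_pos_of_ne_nil hne
  have hlast := fun h => entry?_row_last (pre := pre) (post := post) (B := []) hR h
  have hle := RowInv.length_le (B := []) (by simpa using hI) (fun a ha => (hR a ha).le)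
  rw [List.append_nil] at hlast
  have hnone : entry? (pre ++ R :: post) pre.length (pre.length + R.length) = none := by
    rw [entry?_row]; simp
  refine (upd_row_snoc hT.ne w).good hT ?_ ?_ ?_ ?_ (by omega)
  · intro c' y h hy
    obtain ⟨y', hy', hlt⟩ := hlast hpos
    rw [show pre.length + R.length - 1 = c' by omega, hy] at hy'
    cases hy'
    exact hlt
  · intro y hy
    rw [entry?_none_of_lt (by omega) hnone (Nat.le_succ _)] at hy
    cases hy
  · exact hI.below hle hlast
  · intro y hy
    rw [hT.dn _ _ hnone] at hy
    cases hy

theorem good_row_bump {pre post : STab} {A B : List Letter} {M w : Letter}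
    (hT : Good (pre ++ (A ++ M :: B) :: post)) {γ : ℕ}
    (hI : RowInv (pre ++ (A ++ M :: B) :: post) pre.length w.ceil γ)
    (hA : ∀ a ∈ A, a.ceil < w.ceil) (hM : w.ceil < M.ceil) {w' : Letter} (hw : w'.ceil = w.ceil)
    (hd : A = [] → w'.primed = false) : Good (pre ++ (A ++ w' :: B) :: post) := by
  have hlast := fun h => entry?_row_last (pre := pre) (post := post) (B := M :: B) hA h
  have hle := hI.length_le (fun a ha => (hA a ha).le)
  have hMe : entry? (pre ++ (A ++ M :: B) :: post) pre.length (pre.length + A.length) =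
      some M := by
    rw [entry?_row]; simp
  refine (upd_row hT.ne w').good hT ?_ ?_ ?_ ?_ ?_
  · intro c' y h hy
    have := entry?_isSome_le hy
    obtain ⟨y', hy', hlt⟩ := hlast (by omega)
    rw [show pre.length + A.length - 1 = c' by omega, hy] at hy'
    cases hy'
    rwa [hw]
  · intro y hy
    rw [hw]
    exact hM.trans (hT.row _ _ _ _ hMe hy)
  · rw [hw]
    exact hI.below hle hlast
  · intro y hy
    rw [hw]
    exact hM.trans (hT.col _ _ _ _ hMe hy)
  · intro h
    exact hd (List.eq_nil_of_length_eq_zero (by omega))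

theorem ColBound.of_same {T T' : STab} {N r c : ℕ} {x y : Letter} (hN : ColBound T N)
    (h : Upd T T' r c x) (hy : entry? T r c = some y) : ColBound T' N := by
  intro r' c' hc'
  rw [h.entry]
  split_ifs with h1
  · rw [← h1.2, hN _ _ hc'] at hy
    cases hy
  · exact hN _ _ hc'

theorem Good.of_append {S T : STab} (h : Good (S ++ T)) : Good T := by
  induction S with
  | nil => exact h
  | cons R S ih => exact ih h.of_cons

theorem mem_rowWord {T : STab} {x : Letter} (h : x ∈ rowWord T) :
    ∃ r c, entry? T r c = some x := by
  simp only [rowWord, List.mem_flatten, List.mem_reverse] at h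
  obtain ⟨R, hR, hx⟩ := h
  obtain ⟨r, hr, rfl⟩ := List.getElem_of_mem hR
  obtain ⟨k, hk, rfl⟩ := List.getElem_of_mem hx
  refine ⟨r, r + k, ?_⟩
  rw [entry?_add, List.getD_eq_getElem _ _ hr, List.getElem?_eq_getElem hk]

theorem Good.lt_of_mem_above {m M : Letter} {B : List Letter} {post : STab}
    (hT : Good ((m :: M :: B) :: post)) {y : Letter} (hy : y ∈ rowWord post) :
    M.ceil < y.ceil := by
  obtain ⟨r, c, hrc⟩ := mem_rowWord hy
  rw [← entry?_cons_succ (m :: M :: B)] at hrc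
  cases h : entry? ((m :: M :: B) :: post) 0 (c + 1) with
  | none => rw [hT.dn_of_le h (Nat.zero_le _)] at hrc; cases hrc
  | some z =>
    have h1 := hT.col_lt h hrc (Nat.succ_pos _)
    have hM : entry? ((m :: M :: B) :: post) 0 1 = some M := by simp [entry?_cons_zero]
    rcases Nat.eq_zero_or_pos c with rfl | hc
    · rw [zero_add, hM] at h
      cases h
      exact h1
    · exact (hT.row_lt hM h (by omega)).trans h1

theorem mem_rowWord_of_mem_diagList {T : STab} (hT : ∀ R ∈ T, R ≠ []) {y : Letter}
    (hy : y ∈ diagList T) : y ∈ rowWord T := by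
  simp only [diagList, List.mem_map] at hy
  obtain ⟨R, hR, rfl⟩ := hy
  obtain ⟨x, B, rfl⟩ := List.exists_cons_of_ne_nil (hT R hR)
  simp only [rowWord, List.mem_flatten, List.mem_reverse]
  exact ⟨_, hR, by simp⟩

/-- Bumping a diagonal entry. -/
theorem egRow_bump_diag_spec {pre post : STab} {B : List Letter} {w M : Letter} {N : ℕ} (fuel : ℕ)
    (hT : Good (pre ++ (M :: B) :: post)) (hT' : Good (pre ++ (w.unprime :: B) :: post))
    (hN : ColBound (pre ++ (M :: B) :: post) N) (hlen : (pre ++ (M :: B) :: post).length ≤ N)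
    (hfuel : N ≤ fuel + pre.length) (hM : w.ceil < M.ceil)
    (hV : Valid (rowWord post ++ M :: B ++ w :: rowWord pre)) :
    Good (egCol fuel (pre ++ (w.unprime :: B) :: post) (pre.length + 1) ⟨M.ceil, w.primed⟩).1 ∧
      OckEquiv (rowWord post ++ M :: B ++ w :: rowWord pre)
        (rowWord (egCol fuel (pre ++ (w.unprime :: B) :: post) (pre.length + 1)
          ⟨M.ceil, w.primed⟩).1) := by
  have hup := upd_row (A := []) (y := M) (B := B) hT.ne w.unprime
  simp only [List.nil_append, List.length_nil, Nat.add_zero] at hup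
  have hMe : entry? (pre ++ (M :: B) :: post) pre.length pre.length = some M := by
    have := entry?_row pre post (M :: B) 0
    simpa using this
  have hMp := hT.diag _ _ hMe
  have hN' : ColBound (pre ++ (w.unprime :: B) :: post) N := hN.of_same hup hMe
  simp only [List.length_append, List.length_cons] at hlen
  have hincr := hT.incr_row (R := M :: B) (by simp)
  have k1 := ((knuth_slide_left (dual := false) (w := w) (by simpa [key] using hM) hincr
    (rowWord pre)).append_left (rowWord post)).ockEquiv
  have k2 : OckEquiv (rowWord post ++ M :: w :: B ++ rowWord pre)
      (colSplit (pre ++ (w.unprime :: B) :: post) (pre.length + 1) N ⟨M.ceil, w.primed⟩) := by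
    have := ockEquiv_diag (x := w.unprime) (v := M.ceil) (p := w.primed)
      (M := N - pre.length) hT' (hN'.mono (by omega)) hM (by
        intro y hy
        have h := hT.incr_diagList
        simp only [diagList, List.map_append, List.map_cons] at h
        exact (incr_cons.1 (incr_append.1 h).2.1).1 y hy)
    rw [unprimed_eq hMp] at this
    rw [colSplit, show N + 1 - (pre.length + 1) = N - pre.length by omega]
    exact this
  have k := (by simpa using k1 : OckEquiv _ _).trans (by simpa using k2)
  have hup' : ∀ r' c', ¬ (r' = pre.length ∧ c' = pre.length) →
      entry? (pre ++ (w.unprime :: B) :: post) r' c' =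
        entry? (pre ++ (M :: B) :: post) r' c' := by
    intro r' c' h
    rw [hup.entry, if_neg h]
  have hI : ColInv (pre ++ (w.unprime :: B) :: post) (pre.length + 1) M.ceil pre.length := by
    refine ⟨?_, Or.inl ⟨by omega, ?_, w.unprime, ?_, hM.le, fun h => absurd h hM.ne⟩⟩
    · intro y hy
      rw [hup' _ _ (by omega)] at hy
      exact hT.row _ _ _ _ hMe hy
    · intro i y hi hy
      rw [Nat.add_sub_cancel, hup' _ _ (by omega)] at hy
      exact hT.col_lt hy hMe hi
    · rw [Nat.add_sub_cancel, hup.entry, if_pos ⟨rfl, rfl⟩]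
  have hV' := hV.of_equiv (by simpa using k)
  obtain ⟨h1, h2⟩ := egCol_spec fuel (w := ⟨M.ceil, w.primed⟩) hT' hN' (by omega) (by omega) hI hV'
  exact ⟨h1, OckEquiv.trans (by simpa using k) h2⟩

theorem Valid.row_braid {P S A B : PWord} {w m M : Letter}
    (hV : Valid (P ++ (A ++ m :: M :: B) ++ w :: S)) (hincr : Incr false (A ++ m :: M :: B))
    (hm : m.ceil = w.ceil) (hM : w.ceil < M.ceil) :
    M.ceil = m.ceil + 1 ∧ M.primed = false ∧ (m.primed = false ∨ w.primed = false) := by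
  have h1 := ((knuth_slide_left (dual := false) (w := w) (by simpa [key] using hM)
    (List.pairwise_cons.1 (incr_append.1 hincr).2.1).2 S).append_left (P ++ (A ++ [m]))).ockEquiv
  have h2 := Valid.of_equiv (by simpa using hV) h1
  exact Valid.braid (p := P ++ A) (s := B ++ S) (by simpa using h2) hm (hm ▸ hM)

/-- Inserting a letter into a row whose diagonal entry has the same ceiling. -/
theorem egRow_eq_diag_spec {pre post : STab} {B : List Letter} {w m M : Letter} {N : ℕ} (fuel : ℕ)
    (hT : Good (pre ++ (m :: M :: B) :: post))
    (hN : ColBound (pre ++ (m :: M :: B) :: post) N)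
    (hlen : (pre ++ (m :: M :: B) :: post).length ≤ N)
    (hfuel : N ≤ fuel + pre.length) (hm : m.ceil = w.ceil) (hM : w.ceil < M.ceil)
    (hV : Valid (rowWord post ++ m :: M :: B ++ w :: rowWord pre)) :
    switchPrimes m M = (m, M) ∧
    Good (egCol fuel (pre ++ (m :: M :: B) :: post) (pre.length + 1) w.succL).1 ∧
      OckEquiv (rowWord post ++ m :: M :: B ++ w :: rowWord pre)
        (rowWord (egCol fuel (pre ++ (m :: M :: B) :: post) (pre.length + 1) w.succL).1) := by
  have hincr := hT.incr_row (R := m :: M :: B) (by simp)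
  have hme : entry? (pre ++ (m :: M :: B) :: post) pre.length pre.length = some m := by
    have := entry?_row pre post (m :: M :: B) 0
    simpa using this
  have hMe : entry? (pre ++ (m :: M :: B) :: post) pre.length (pre.length + 1) = some M := by
    rw [entry?_row]; rfl
  have hmp := hT.diag _ _ hme
  obtain ⟨hMm, hMp, hmw⟩ := Valid.row_braid (A := []) hV hincr hm hM
  have hsw : switchPrimes m M = (m, M) := by simp [switchPrimes, hmp, hMp]
  have habove : ∀ y ∈ rowWord post, m.ceil + 1 < y.ceil := by
    intro y hy
    have := hT.of_append.lt_of_mem_above hy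
    omega
  have hwp : w.primed = false := by
    refine Valid.unprimed_of_repeat (p := rowWord post) (x := m) (q := M :: B) (s := rowWord pre)
      (by simpa using hV) habove ?_ hm.symm
    exact (incr_cons.1 hincr).1
  simp only [List.length_append, List.length_cons] at hlen
  have k1 := ((knuth_bump_braid (A := []) (w := w) hincr hm hMm hMp hmw).append_right
    (rowWord pre)).append_left (rowWord post)
  rw [hsw] at k1
  have k2 := ockEquiv_diag (x := m) (v := m.ceil + 1) (p := false) (M := N - pre.length) hT
    (hN.mono (by omega)) (by omega) fun y hy => habove y
      (mem_rowWord_of_mem_diagList (fun R hR => hT.ne R (by simp [hR])) hy)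
  have hsucc : w.succL = ⟨m.ceil + 1, false⟩ := by simp [Letter.succL, hm, hwp]
  have k : OckEquiv (rowWord post ++ m :: M :: B ++ w :: rowWord pre)
      (colSplit (pre ++ (m :: M :: B) :: post) (pre.length + 1) N w.succL) := by
    rw [unprimed_eq hmp] at k2
    rw [colSplit, show N + 1 - (pre.length + 1) = N - pre.length by omega, hsucc]
    rw [hsucc] at k1
    exact OckEquiv.trans (by simpa using k1.ockEquiv) (by simpa using k2)
  refine ⟨hsw, ?_⟩
  have hcol : ∀ y, entry? (pre ++ (m :: M :: B) :: post) (pre.length + 1) (pre.length + 1) =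
      some y → w.succL.ceil < y.ceil := by
    intro y hy
    have := hT.col _ _ _ _ hMe hy
    simp only [Letter.succL]
    omega
  obtain ⟨h1, h2⟩ := egCol_spec fuel (w := w.succL) (ρ := pre.length + 1) hT hN (by omega)
    (by omega) ⟨hcol, Or.inr ⟨rfl, by omega, M, hMe, by simp only [Letter.succL]; omega, hMp⟩⟩
    (hV.of_equiv k)
  exact ⟨h1, k.trans h2⟩

/-- Row insertion preserves the orthogonal Coxeter–Knuth class. -/
theorem egRow_spec (fuel : ℕ) : ∀ {pre post : STab} {N γ : ℕ} {w : Letter}, Good (pre ++ post) →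
    ColBound (pre ++ post) N → (pre ++ post).length ≤ N → N + 1 ≤ fuel + pre.length →
    RowInv (pre ++ post) pre.length w.ceil γ → Valid (rowWord post ++ w :: rowWord pre) →
    Good (egRow fuel (pre ++ post) pre.length w).1 ∧
      OckEquiv (rowWord post ++ w :: rowWord pre)
        (rowWord (egRow fuel (pre ++ post) pre.length w).1) := by
  induction fuel with
  | zero =>
    intro pre post N γ w _ _ hlen
    rw [List.length_append] at hlen
    omega
  | succ fuel ih =>
    intro pre post N γ w hT hN hlen hfuel hI hV
    cases post with
    | nil =>
      rw [List.append_nil] at *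
      rw [egRow_new]
      refine ⟨good_new_row hT hI, ?_⟩
      rw [rowWord_append, rowWord_cons, rowWord_nil, List.nil_append]
      by_cases hw : w.primed = true
      · have := ockEquiv_toggle w (rowWord pre)
        simpa [ock1, hw, Letter.unprime] using this
      · rw [show w.unprime = w from unprimed_eq (by simpa using hw)]
        exact OckEquiv.refl _
    | cons R post =>
      have hR := hT.ne R (by simp)
      have hincr := hT.incr_row (R := R) (by simp)
      rw [rowWord_cons] at hV ⊢
      have step : ∀ {R' : List Letter} {w' : Letter} {γ' : ℕ}, Good (pre ++ R' :: post) →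
          ColBound (pre ++ R' :: post) N →
          RowInv (pre ++ R' :: post) (pre.length + 1) w'.ceil γ' →
          Knuth (R ++ [w]) (w' :: R') →
          Good (egRow fuel (pre ++ R' :: post) (pre.length + 1) w').1 ∧
            OckEquiv (rowWord post ++ R ++ w :: rowWord pre)
              (rowWord (egRow fuel (pre ++ R' :: post) (pre.length + 1) w').1) := by
        intro R' w' γ' hT' hN' hI' hk
        have k := ((hk.append_right (rowWord pre)).append_left (rowWord post)).ockEquiv
        have e : pre ++ R' :: post = (pre ++ [R']) ++ post := by simp
        have e' : pre.length + 1 = (pre ++ [R']).length := by simp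
        rw [e] at hT' hN' hI' ⊢
        rw [e'] at hI' ⊢
        have hword : rowWord (pre ++ [R']) = R' ++ rowWord pre := by
          simp [rowWord_append, rowWord_cons, rowWord_nil]
        have k' : OckEquiv (rowWord post ++ R ++ w :: rowWord pre)
            (rowWord post ++ w' :: rowWord (pre ++ [R'])) := by
          rw [hword]
          simpa using k
        obtain ⟨h1, h2⟩ := ih (pre := pre ++ [R']) (post := post) hT' hN' (by simpa using hlen)
          (by simp; omega) hI' (hV.of_equiv k')
        exact ⟨h1, k'.trans h2⟩
      rcases hincr.line_cases w.ceil with hU | ⟨A, M, B, rfl, hA, hM⟩ |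
        ⟨A, m, M, B, rfl, hA, hm, hM⟩
      · rw [egRow_none fuel pre post hR hU]
        have hlt : ∀ x ∈ R, x.ceil < w.ceil := by
          rcases List.eq_nil_or_concat R with rfl | ⟨R', l, rfl⟩
          · simp
          · rw [List.concat_eq_append] at *
            have hne := Valid.ne_of_adjacent (p := rowWord post ++ R') (x := l)
              (y := w) (s := rowWord pre) (by simpa using hV)
            have hl : l.ceil < w.ceil := lt_of_le_of_ne (hU l (by simp)) hne
            intro x hx
            rcases List.mem_append.1 hx with hx | hx
            · exact lt_trans ((incr_append.1 hincr).2.2 x hx l (by simp)) hl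
            · rwa [List.mem_singleton.1 hx]
        refine ⟨good_row_snoc hT hI hlt, ?_⟩
        rw [rowWord_append, rowWord_cons]
        simpa using OckEquiv.refl _
      · rw [egRow_bump fuel pre post hA hM]
        have hT' := fun (w' : Letter) (hw : w'.ceil = w.ceil) =>
          good_row_bump hT hI hA hM (w' := w') hw
        have hMe : entry? (pre ++ (A ++ M :: B) :: post) pre.length (pre.length + A.length) =
            some M := by
          rw [entry?_row]; simp
        split_ifs with hA0
        · subst hA0
          exact egRow_bump_diag_spec fuel hT (hT' w.unprime rfl fun _ => rfl) hN hlen (by omega)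
            hM (by simpa using hV)
        · have hpos := List.length_pos_of_ne_nil hA0
          have hup := upd_row hT.ne w
          refine step (γ' := pre.length + A.length) (hT' w rfl fun h => absurd h hA0)
            (hN.of_same hup hMe) ⟨by omega, ?_, fun _ => ⟨?_, w, ?_, hM.le,
              fun h => absurd h hM.ne⟩⟩ ?_
          · intro y hy
            rw [hup.entry, if_neg (by omega)] at hy
            exact hT.col _ _ _ _ hMe hy
          · intro j y hj hy
            rw [Nat.add_sub_cancel, hup.entry, if_neg (by omega)] at hy
            exact hT.row_lt hy hMe hj
          · rw [Nat.add_sub_cancel, hup.entry, if_pos ⟨rfl, rfl⟩]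
          · exact knuth_bump hincr (incr_append.2
              ⟨(incr_append.1 hincr).1, by simp [Incr], by simpa [key] using hA⟩) hM
      · rw [egRow_eq fuel pre post hA hm hM]
        split_ifs with hA0
        · subst hA0
          obtain ⟨h1, h2⟩ := egRow_eq_diag_spec fuel hT hN hlen (by omega) hm hM
            (by simpa using hV)
          rw [h1]
          exact h2
        · have hpos := List.length_pos_of_ne_nil hA0
          obtain ⟨hMm, hMp, hmw⟩ := Valid.row_braid hV hincr hm hM
          have hp1 : (switchPrimes m M).1.ceil = m.ceil := by
            unfold switchPrimes; split_ifs <;> rfl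
          have hp2 : (switchPrimes m M).2.ceil = M.ceil := by
            unfold switchPrimes; split_ifs <;> rfl
          have hme : entry? (pre ++ (A ++ m :: M :: B) :: post) pre.length
              (pre.length + A.length) = some m := by
            rw [entry?_row]; simp
          have hMe : entry? (pre ++ (A ++ m :: M :: B) :: post) pre.length
              (pre.length + A.length + 1) = some M := by
            rw [Nat.add_assoc, entry?_row]; simp
          have hup1 := upd_row hT.ne (switchPrimes m M).1
          have hT1 := hup1.good_of_ceil hT hme hp1.symm (by omega)
          have hup2 := upd_row (A := A ++ [(switchPrimes m M).1]) (y := M) (B := B)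
            (pre := pre) (post := post) (by simpa using hT1.ne) (switchPrimes m M).2
          simp only [List.append_assoc, List.singleton_append, List.length_append,
            List.length_singleton, ← Nat.add_assoc] at hup2
          have hMe1 : entry? (pre ++ (A ++ (switchPrimes m M).1 :: M :: B) :: post) pre.length
              (pre.length + A.length + 1) = some M := by
            rw [hup1.entry, if_neg (by omega), hMe]
          have hT2 := hup2.good_of_ceil hT1 hMe1 hp2.symm (by omega)
          refine step (γ' := pre.length + A.length + 1) hT2
            ((hN.of_same hup1 hme).of_same hup2 hMe1) ⟨by omega, ?_, fun _ => ⟨?_,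
              (switchPrimes m M).2, ?_, ?_, fun _ => ⟨by omega, ?_⟩⟩⟩ ?_
          · intro y hy
            rw [hup2.entry, if_neg (by omega), hup1.entry, if_neg (by omega)] at hy
            have := hT.col _ _ _ _ hMe hy
            simp only [Letter.succL]
            omega
          · intro j y hj hy
            rw [Nat.add_sub_cancel, hup2.entry, if_neg (by omega), hup1.entry] at hy
            simp only [Letter.succL]
            split_ifs at hy with h
            · cases hy
              omega
            · have := hT.row_lt hy hMe hj
              omega
          · rw [Nat.add_sub_cancel, hup2.entry, if_pos ⟨rfl, rfl⟩]
          · simp only [Letter.succL]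
            omega
          · intro y hy
            rw [Nat.add_sub_cancel, hup2.entry, if_neg (by omega), hup1.entry,
              if_neg (by omega)] at hy
            have := hT.col _ _ _ _ hme hy
            simp only [Letter.succL]
            omega
          · exact knuth_bump_braid hincr hm hMm hMp hmw

/-- Orthogonal Edelman–Greene insertion preserves the orthogonal Coxeter–Knuth class. -/
theorem egInsert_spec {T : STab} {u : Letter} (hT : Good T) (hV : Valid (rowWord T ++ [u])) :
    Good (egInsert T u).1 ∧ OckEquiv (rowWord T ++ [u]) (rowWord (egInsert T u).1) := by
  have hN : ColBound T (T.flatten.length + T.length) := by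
    cases T with
    | nil => exact colBound_nil
    | cons R T =>
      refine hT.colBound_cons.mono ?_
      simp only [List.flatten_cons, List.length_append]
      omega
  refine egRow_spec (pre := []) (γ := T.flatten.length + T.length) _ hT hN (by simp) (by simp)
    ⟨by simp, ?_, fun h => absurd h (lt_irrefl _)⟩ (by simpa [rowWord_nil] using hV)
  intro y hy
  rw [List.nil_append, hN _ _ le_rfl] at hy
  cases hy

theorem foldl_twist_inver {a b : ℤ} {w : List ℤ} : ∀ {y : Equiv.Perm ℤ}, y * y = 1 → Asc y w →
    (∀ x ∈ w, x + 1 < a ∨ b < x) → Inver y a b → Inver (w.foldl twist y) a b := by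
  induction w with
  | nil => exact fun _ _ _ h => h
  | cons x w ih =>
    intro y hy hA hx h
    have hab := h.1
    have h0 := hx x (by simp)
    have h1 := h.twist hy hA.1
    rw [sPerm_of_ne (by omega) (by omega), sPerm_of_ne (by omega) (by omega)] at h1
    exact ih (twist_invol hy x) hA.2 (fun z hz => hx z (by simp [hz])) h1

theorem foldl_twist_apply {a b : ℤ} (hab : a < b) {w : List ℤ} : ∀ {y : Equiv.Perm ℤ},
    y * y = 1 → Asc y w → (∀ x ∈ w, b < x) → y a = b → w.foldl twist y a = b := by
  induction w with
  | nil => exact fun _ _ _ h => h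
  | cons x w ih =>
    intro y hy hA hx h
    have h0 := hx x (by simp)
    refine ih (twist_invol hy x) hA.2 (fun z hz => hx z (by simp [hz])) ?_
    by_cases hf : Fix2 y x
    · rw [twist_apply_of_fixed hy hf, sPerm_of_ne (by omega) (by omega), h]
    · rw [twist_apply_of_not_fixed hy hA.1 hf, sPerm_of_ne (j := a) (by omega) (by omega), h,
        sPerm_of_ne (by omega) (by omega)]

/-- An increasing word moves the larger end of an inversion along its initial run. -/
theorem foldl_twist_run {a : ℤ} {w : List ℤ} : ∀ {b : ℤ} {y : Equiv.Perm ℤ}, a < b →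
    y * y = 1 → Asc y w → w.Pairwise (· < ·) → (∀ x ∈ w, b ≤ x) →
    ∃ k : ℕ, (∀ i < k, w[i]? = some (b + i)) ∧
      (Inver y a b → Inver (w.foldl twist y) a (b + k)) ∧
      (y a = b → w.foldl twist y a = b + k) := by
  induction w with
  | nil => exact fun _ _ _ _ _ => ⟨0, by simp, by simp, by simp⟩
  | cons x w ih =>
    intro b y hab hy hA hw hx
    obtain ⟨hxw, hw'⟩ := List.pairwise_cons.1 hw
    have hbx := hx x (by simp)
    rcases hbx.eq_or_lt with rfl | hlt
    · obtain ⟨k, h1, h2, h3⟩ := ih (b := b + 1) (by omega) (twist_invol hy b) hA.2 hw'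
        fun z hz => hxw z hz
      refine ⟨k + 1, ?_, fun h => ?_, fun h => ?_⟩
      · rintro (_ | i) hi
        · simp
        · rw [List.getElem?_cons_succ, h1 i (by omega)]
          push_cast
          congr 1
          ring
      · have h4 := h.twist hy hA.1
        rw [sPerm_of_ne (by omega) (by omega), sPerm_left] at h4
        have := h2 h4
        push_cast
        rwa [show b + ((k : ℤ) + 1) = b + 1 + k by ring]
      · have hb : y b = a := by rw [← h, invol_apply hy]
        have hf : ¬ Fix2 y b := fun h' => by
          have := h'.1
          omega
        have := h3 (by rw [twist_apply_of_not_fixed hy hA.1 hf,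
          sPerm_of_ne (j := a) (by omega) (by omega), h, sPerm_left])
        push_cast
        rwa [show b + ((k : ℤ) + 1) = b + 1 + k by ring]
    · have hall : ∀ z ∈ x :: w, b < z := by
        intro z hz
        rcases List.mem_cons.1 hz with rfl | hz
        · exact hlt
        · exact hlt.trans (hxw z hz)
      exact ⟨0, by simp, fun h => by
        simpa using foldl_twist_inver hy hA (fun z hz => Or.inr (hall z hz)) h, fun h => by
        simpa using foldl_twist_apply hab hy hA hall h⟩

/-- A consecutive run cannot exhaust an inversion. -/
theorem not_asc_run {n : ℕ} : ∀ {a : ℤ} {w : List ℤ} {y : Equiv.Perm ℤ}, y * y = 1 → Asc y w →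
    (∀ i < n, w[i]? = some (a + i)) → ¬ Inver y a (a + n) := by
  induction n with
  | zero =>
    intro a w y _ _ _ h
    have := h.1
    simp at this
  | succ n ih =>
    intro a w y hy hA hw h
    have h0 := hw 0 (by omega)
    obtain _ | ⟨x, w⟩ := w
    · simp at h0
    · simp only [List.getElem?_cons_zero, Option.some.injEq] at h0
      simp only [Nat.cast_zero, add_zero] at h0
      subst h0
      rcases Nat.eq_zero_or_pos n with rfl | hn
      · have h1 := h.2
        have h2 := hA.1
        simp only [zero_add, Nat.cast_one] at h1
        omega
      · have h1 := h.twist hy hA.1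
        push_cast at h1
        rw [sPerm_left, sPerm_of_ne (by omega) (by omega)] at h1
        refine ih (twist_invol hy x) hA.2 (fun i hi => ?_) (by
          rwa [show x + 1 + (n : ℤ) = x + ((n : ℤ) + 1) by ring])
        have := hw (i + 1) (by omega)
        rw [List.getElem?_cons_succ] at this
        rw [this]
        push_cast
        congr 1
        ring

theorem foldl_twist_apply_self {k : ℤ} {w : List ℤ} : ∀ {y : Equiv.Perm ℤ}, y * y = 1 →
    (∀ x ∈ w, k < x) → y k = k → w.foldl twist y k = k := by
  induction w with
  | nil => exact fun _ _ h => h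
  | cons x w ih =>
    intro y hy hx h
    exact ih (twist_invol hy x) (fun z hz => hx z (by simp [hz]))
      ((twist_apply_eq_self_iff hy (hx x (by simp))).2 h)

/-- Two successive rows of a reduced reading word do not agree in a column. -/
theorem not_asc_rows {P A s A' t : List ℤ} {X : ℤ} (hs : (X :: s).Pairwise (· < ·))
    (ht : t.Pairwise (· < ·)) (ht0 : t[0]? = some X)
    (hst : ∀ i v, s[i]? = some v → ∃ r, t[i + 1]? = some r ∧ r ≤ v)
    (hA' : (∀ x ∈ A', x + 1 < X) ∨ (A = [] ∧ A' = [X - 1] ∧ ∀ x ∈ P, X + 1 < x)) :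
    ¬ Asc 1 (P ++ (A ++ X :: s) ++ (A' ++ t)) := by
  intro hA
  obtain ⟨hXs, hs⟩ := List.pairwise_cons.1 hs
  simp only [asc_append, Asc, List.foldl_append, List.foldl_cons] at hA
  obtain ⟨⟨-, -, hasc, h1⟩, h2, h3⟩ := hA
  set y := A.foldl twist (P.foldl twist 1) with hy
  have hyi : y * y = 1 := foldl_twist_invol (foldl_twist_invol (one_mul 1) P) A
  have hyt := twist_invol hyi X
  obtain ⟨k, k1, k2, k3⟩ := foldl_twist_run (lt_add_one X) hyt h1 hs fun x hx => hXs x hx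
  have hys := foldl_twist_invol hyt s
  have hinv : Inver (A'.foldl twist (s.foldl twist (twist y X))) X (X + (k + 1 : ℕ)) := by
    have e : X + 1 + (k : ℤ) = X + (k + 1 : ℕ) := by push_cast; ring
    rw [e] at k2 k3
    rcases hA' with hA' | ⟨rfl, rfl, hP⟩
    · exact foldl_twist_inver hys h2 (fun x hx => Or.inl (hA' x hx))
        (k2 (inver_twist_self hyi hasc))
    · have hfix : ∀ j, j ≤ X + 1 → y j = j := by
        intro j hj
        exact foldl_twist_apply_self (w := P) (one_mul 1) (fun x hx => hj.trans_lt (hP x hx)) rfl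
      have hf : Fix2 y X := ⟨hfix _ (by omega), hfix _ le_rfl⟩
      have hX := k3 (by rw [twist_apply_of_fixed hyi hf, sPerm_left, hf.2])
      have hX1 : s.foldl twist (twist y X) (X - 1) = X - 1 :=
        foldl_twist_apply_self hyt (fun x hx => by have := hXs x hx; omega)
          ((twist_apply_eq_self_iff hyi (by omega)).2 (hfix _ (by omega)))
      set y' := s.foldl twist (twist y X)
      have hXk : y' (X + (k + 1 : ℕ)) = X := by rw [← hX, invol_apply hys]
      have hnf : ¬ Fix2 y' (X - 1) := fun h => by
        have := h.2
        rw [sub_add_cancel, hX] at this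
        push_cast at this
        omega
      have e1 : sPerm (X - 1) X = X - 1 := by
        have := sPerm_right (X - 1)
        rwa [sub_add_cancel] at this
      refine ⟨by push_cast; omega, ?_⟩
      simp only [List.foldl_cons, List.foldl_nil]
      rw [twist_apply_of_not_fixed hys h2.1 hnf, twist_apply_of_not_fixed hys h2.1 hnf, e1, hX1,
        sPerm_left, sub_add_cancel, sPerm_of_ne (j := X + (k + 1 : ℕ)) (by push_cast; omega)
        (by push_cast; omega), hXk, e1]
      omega
  refine not_asc_run (foldl_twist_invol hys A') h3 ?_ hinv
  intro i
  induction i with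
  | zero => simpa using ht0
  | succ i ih =>
    intro hi
    obtain ⟨r, hr, hle⟩ := hst i _ (k1 i (by omega))
    have h4 := ih (by omega)
    obtain ⟨l1, g1⟩ := List.getElem?_eq_some_iff.1 h4
    obtain ⟨l2, g2⟩ := List.getElem?_eq_some_iff.1 hr
    have := List.pairwise_iff_getElem.1 ht i (i + 1) l1 l2 (by omega)
    rw [hr]
    congr 1
    push_cast
    omega

/-- Strictness of the columns meeting two successive rows follows from reducedness. -/
theorem Good.ceil_lt_of_valid {R S : List Letter} {post : STab} (hG : Good (S :: post))
    (hV : Valid (rowWord post ++ S ++ R)) (hR : Incr false R) (hlen : S.length < R.length)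
    (hw : ∀ i s r, S[i]? = some s → R[i + 1]? = some r → r.ceil ≤ s.ceil) :
    ∀ i s r, S[i]? = some s → R[i + 1]? = some r → r.ceil < s.ceil := by
  intro i
  induction i using Nat.strong_induction_on with
  | _ i ih =>
  intro s r hs hr
  refine lt_of_le_of_ne (hw i s r hs hr) fun e => ?_
  obtain ⟨l1, g1⟩ := List.getElem?_eq_some_iff.1 hs
  obtain ⟨l2, g2⟩ := List.getElem?_eq_some_iff.1 hr
  have hS : S = S.take i ++ s :: S.drop (i + 1) := by
    rw [← g1, ← List.drop_eq_getElem_cons, List.take_append_drop]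
  have hSi := hG.incr_row (R := S) (by simp)
  have hasc := hV.asc
  rw [← List.take_append_drop (i + 1) R, hS] at hasc
  simp only [unprimeWord, List.map_append, List.map_cons] at hasc
  refine not_asc_rows ?_ ?_ ?_ ?_ ?_ hasc
  · rw [hS] at hSi
    have := (incr_append.1 hSi).2.1
    rw [← List.map_cons, List.pairwise_map]
    exact this
  · rw [List.pairwise_map]
    exact List.Pairwise.sublist (List.drop_sublist _ _) hR
  · simp [hr, e]
  · intro j v hv
    simp only [List.getElem?_map, List.getElem?_drop, Option.map_eq_some_iff] at hv ⊢
    obtain ⟨x, hx, rfl⟩ := hv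
    have hj := (List.getElem?_eq_some_iff.1 hx).1
    refine ⟨_, ⟨_, List.getElem?_eq_getElem (by omega), rfl⟩, hw (i + 1 + j) _ _ hx ?_⟩
    rw [List.getElem?_eq_getElem (by omega)]
    congr 2
  · have hlast : ∀ j (hj : j < i + 1), (R[j]'(by omega)).ceil < s.ceil := by
      intro j hj
      rw [← e, ← g2]
      exact List.pairwise_iff_getElem.1 hR _ _ _ _ hj
    rcases Nat.eq_zero_or_pos i with rfl | hi
    · have h0 := hlast 0 (by omega)
      have htake : (R.take 1).map Letter.ceil = [R[0].ceil] := by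
        rw [List.take_one, List.head?_eq_getElem?, List.getElem?_eq_getElem (by omega)]
        rfl
      rw [zero_add, htake]
      by_cases h1 : R[0].ceil + 1 < s.ceil
      · left
        simpa using h1
      · right
        refine ⟨rfl, by congr 1; omega, ?_⟩
        simp only [List.mem_map]
        rintro _ ⟨y, hy, rfl⟩
        rw [List.take_zero, List.nil_append] at hS
        cases hd : S.drop (0 + 1) with
        | nil =>
          obtain ⟨r', c, hrc⟩ := mem_rowWord hy
          rw [← entry?_cons_succ S] at hrc
          have h2 : entry? (S :: post) 0 1 = none := by
            rw [entry?_cons_zero, hS, hd]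
            rfl
          rw [hG.dn_of_le (entry?_none_of_lt (Nat.zero_le _) h2 (by omega)) (Nat.zero_le _)] at hrc
          cases hrc
        | cons M B =>
          rw [hd] at hS
          rw [hS] at hG hSi
          have h2 := hG.lt_of_mem_above hy
          have h3 : s.ceil < M.ceil := (incr_cons.1 hSi).1 M (by simp)
          omega
    · left
      simp only [List.mem_map]
      rintro _ ⟨y, hy, rfl⟩
      obtain ⟨j, hj, rfl⟩ := List.getElem_of_mem hy
      rw [List.getElem_take]
      rw [List.length_take] at hj
      have h1 := ih (i - 1) (by omega) S[i - 1] R[i] (List.getElem?_eq_getElem _)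
        (by rw [show i - 1 + 1 = i by omega]; exact List.getElem?_eq_getElem _)
      have h2 : S[i - 1].ceil < S[i].ceil :=
        List.pairwise_iff_getElem.1 hSi _ _ _ _ (by omega)
      rw [g1] at h2
      rcases (show j < i ∨ j = i by omega) with h | rfl
      · have h3 : R[j].ceil < R[i].ceil := List.pairwise_iff_getElem.1 hR _ _ _ _ h
        omega
      · omega

theorem ceil_le_of_lt {x y : Letter} (h : x < y) : x.ceil ≤ y.ceil := by
  have h' : toLex (x.ceil, !x.primed) < toLex (y.ceil, !y.primed) := h
  rw [Prod.Lex.toLex_lt_toLex] at h'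
  rcases h' with h' | h'
  · exact h'.le
  · exact h'.1.le

theorem incr_of_valid {p R : List Letter} (hV : Valid (p ++ R))
    (hw : ∀ i x y, R[i]? = some x → R[i + 1]? = some y → x < y) : Incr false R := by
  have : Std.Irrefl (fun a b : Letter => key false a < key false b) := ⟨fun a => lt_irrefl _⟩
  have : IsTrans Letter (fun a b : Letter => key false a < key false b) :=
    ⟨fun a b c h h' => lt_trans h h'⟩
  rw [Incr, ← List.isChain_iff_pairwise, List.isChain_iff_getElem]
  intro i hi
  refine lt_of_le_of_ne (ceil_le_of_lt (hw i _ _ (List.getElem?_eq_getElem _)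
    (List.getElem?_eq_getElem hi))) ?_
  refine Valid.ne_of_adjacent (p := p ++ R.take i) (s := R.drop (i + 1 + 1)) ?_
  rw [List.append_assoc, ← List.drop_eq_getElem_cons, ← List.drop_eq_getElem_cons,
    List.take_append_drop]
  exact hV

theorem good_nil : Good [] :=
  have e : ∀ r c, entry? [] r c = none := fun r c => entry?_of_length_le (by simp) c
  ⟨by simp, fun r c _ => e _ _, by simp [e], by simp [e], by simp [e]⟩

/-- An increasing tableau with reduced row reading word is strictly increasing after unpriming. -/
theorem good_of_isIncreasing {T : STab} (hS : IsShifted T) (hI : IsIncreasing T)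
    (hD : NoDiagPrimes T) (hV : Valid (rowWord T)) : Good T := by
  induction T with
  | nil => exact good_nil
  | cons R T ih =>
    rw [rowWord_cons] at hV
    have hG : Good T := by
      refine ih ⟨?_, fun m hm => hS.2 m (List.mem_cons_of_mem _ hm)⟩
        ⟨fun r c x y h1 h2 => hI.1 (r + 1) (c + 1) x y ?_ ?_,
          fun r c x y h1 h2 => hI.2 (r + 1) (c + 1) x y ?_ ?_⟩
        (fun r x h => hD (r + 1) x ?_) hV.of_append
      · exact List.IsChain.tail hS.1
      all_goals rwa [entry?_cons_succ]
    have hR : Incr false R := incr_of_valid hV fun i x y hx hy =>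
      hI.1 0 i x y (by rwa [entry?_cons_zero]) (by rwa [entry?_cons_zero])
    have hlen : ∀ c, R[c]? = none → entry? T 0 (c - 1) = none := by
      intro c hc
      cases T with
      | nil => exact entry?_of_length_le (by simp) _
      | cons S T =>
        have h1 : S.length < R.length := by
          have := hS.1
          simp only [shapeOf, List.map_cons] at this
          exact (List.isChain_cons_cons.1 this).1
        rw [List.getElem?_eq_none_iff] at hc
        rw [entry?_cons_zero, List.getElem?_eq_none_iff]
        omega
    refine ⟨?_, ?_, ?_, ?_, hD⟩
    · intro L hL
      exact List.ne_nil_of_length_pos (hS.2 _ (List.mem_map_of_mem hL))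
    · rintro (_ | r) (_ | c) h
      · exact entry?_of_lt (by omega)
      · rw [entry?_cons_zero] at h
        rw [entry?_cons_succ]
        exact hlen _ h
      · exact entry?_of_lt (by omega)
      · rw [entry?_cons_succ] at h ⊢
        exact hG.dn _ _ h
    · intro r c x y hx hy
      obtain _ | r := r
      · rw [entry?_cons_zero] at hx hy
        obtain ⟨l1, rfl⟩ := List.getElem?_eq_some_iff.1 hx
        obtain ⟨l2, rfl⟩ := List.getElem?_eq_some_iff.1 hy
        exact List.pairwise_iff_getElem.1 hR _ _ l1 l2 (Nat.lt_succ_self c)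
      obtain _ | c := c
      · rw [entry?_of_lt (by omega)] at hx
        cases hx
      · rw [entry?_cons_succ] at hx hy
        exact hG.row _ _ _ _ hx hy
    · rintro (_ | r) (_ | c) x y hx hy
      · rw [entry?_of_lt (by omega)] at hy
        cases hy
      · cases T with
        | nil =>
          rw [entry?_of_length_le (by simp)] at hy
          cases hy
        | cons S T =>
          rw [entry?_cons_succ, entry?_cons_zero] at hy
          rw [entry?_cons_zero] at hx
          rw [rowWord_cons] at hV
          refine hG.ceil_lt_of_valid hV hR ?_ (fun i s r hs hr => ceil_le_of_lt
            (hI.2 0 (i + 1) r s ?_ ?_)) c y x hy hx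
          · by_contra h
            have := hlen _ (List.getElem?_eq_none_iff.2 (not_lt.1 h))
            rw [entry?_cons_zero, List.getElem?_eq_none_iff] at this
            have := List.length_pos_of_ne_nil (hG.ne S (by simp))
            omega
          · rwa [entry?_cons_zero]
          · rwa [entry?_cons_succ, entry?_cons_zero]
      · rw [entry?_of_lt (by omega)] at hx
        cases hx
      · rw [entry?_cons_succ] at hx hy
        exact hG.col _ _ _ _ hx hy

/-- A primed involution word is equivalent to the row reading word of its insertion tableau. -/
theorem PEG_spec {a : PWord} : Valid a → Good (PEG a) ∧ OckEquiv a (rowWord (PEG a)) := by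
  induction a using List.reverseRecOn with
  | nil => exact fun _ => ⟨good_nil, OckEquiv.refl _⟩
  | append_singleton a u ih =>
    intro hV
    obtain ⟨h1, h2⟩ := ih hV.of_append
    have h3 := h2.append_right [u]
    obtain ⟨h4, h5⟩ := egInsert_spec h1 (hV.of_equiv h3)
    rw [PEG, List.foldl_append]
    exact ⟨h4, h3.trans h5⟩

end ShiftedEG

/-- Proposition 3.29: if `T` is increasing with no diagonal primes
and `row(T)u ∈ R_inv⁺(z)`, then `row(T)u ~ᴼ row(T ←ᴼ u)`; consequently
`a ~ᴼ row(P_EGᴼ(a))` for every `a ∈ R_inv⁺(z)`. -/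
theorem stmt12 (z : Equiv.Perm ℤ) (hz : IZ z) :
    (∀ (T : STab) (u : Letter), IsShifted T → IsIncreasing T → NoDiagPrimes T →
      rowWord T ++ [u] ∈ RinvPlus z →
      OckEquiv (rowWord T ++ [u]) (rowWord (egInsert T u).1)) ∧
    (∀ a ∈ RinvPlus z, OckEquiv a (rowWord (PEG a))) := by
  refine ⟨fun T u hS hI hD hu => ?_, fun a ha => (ShiftedEG.PEG_spec ⟨z, ha⟩).2⟩
  have hV : ShiftedEG.Valid (rowWord T ++ [u]) := ⟨z, hu⟩
  exact (ShiftedEG.egInsert_spec (ShiftedEG.good_of_isIncreasing hS hI hD hV.of_append) hV).2
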